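/- Suppose n = 2·p₁⋯p_{t₁}·q₁⋯q_{t₂}, where p₁,…,p_{t₁},q₁,…,q_{t₂} are t₁ + t₂ ≥ 1 distinct primes, all congruent to 1 (mod 4) and coprime to l, with (p_i/l) = −1 for all i ∈ {1,…,t₁} and (q_j/l) = 1 for all j ∈ {1,…,t₂}. If (2/l)₄ = (−1)^((l−1)/8) and (q_j/l)₄ = (l/q_j)₄ for all j, then r₂(H) = t₁ + 2t₂ + 2; if (2/l)₄ ≠ (−1)^((l−1)/8), or (q_j/l)₄ ≠ (l/q_j)₄ for at least one j, then r₂(H) = t₁ + 2t₂ + 1. -/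

import Mathlib

/-- `ε` is the fundamental unit of the real quadratic field `ℚ(√l)` (viewed inside `ℝ`):
it lies in `ℚ(√l)`, it is a unit of the ring of integers (both `ε` and `ε⁻¹` are
algebraic integers), `ε > 1`, and it is the smallest such unit. -/
def IsFundamentalUnit (l : ℕ) (ε : ℝ) : Prop :=
  1 < ε ∧ ε ∈ IntermediateField.adjoin ℚ ({Real.sqrt (l : ℝ)} : Set ℝ) ∧
    IsIntegral ℤ ε ∧ IsIntegral ℤ ε⁻¹ ∧
    ∀ x : ℝ, 1 < x → x ∈ IntermediateField.adjoin ℚ ({Real.sqrt (l : ℝ)} : Set ℝ) →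
      IsIntegral ℤ x → IsIntegral ℤ x⁻¹ → ε ≤ x

/-- The Legendre symbol `(a/p)`, via Euler's criterion (so that no `Fact p.Prime`
instance is needed): for an odd prime `p` it is `1` if `a` is a nonzero square mod `p`,
`0` if `p ∣ a`, and `-1` otherwise. -/
def legSym (p : ℕ) (a : ℤ) : ℤ :=
  if (a : ZMod p) ^ ((p - 1) / 2) = 1 then 1 else if (a : ZMod p) = 0 then 0 else -1

/-- The rational fourth power residue symbol `(a/p)₄ ∈ {±1}`, meaningful when
`(a/p) = 1`; it is determined by `(a/p)₄ ≡ a ^ ((p-1)/4) (mod p)`. -/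
def quartSym (p : ℕ) (a : ℤ) : ℤ :=
  if (a : ZMod p) ^ ((p - 1) / 4) = 1 then 1 else -1

/-- The cardinality of the 2-torsion subgroup of the class group of `K`.
For a number field `K` this equals `2 ^ r₂(H)`, where `r₂(H)` is the rank of the
2-class group `H` of `K` (i.e. `dim_{𝔽₂} Cl(K)/Cl(K)²`); in particular
`r₂(H) = r` iff this cardinality is `2 ^ r`. -/
noncomputable def twoTorsCard (K : IntermediateField ℚ ℝ) : ℕ :=
  Nat.card {x : ClassGroup (NumberField.RingOfIntegers K) // x ^ 2 = 1}

lemma jacobiSym_cast_eq_pow {p : ℕ} [Fact p.Prime] (hp : p % 2 = 1) (a : ℤ) :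
    ((jacobiSym a p : ℤ) : ZMod p) = (a : ZMod p) ^ ((p - 1) / 2) := by
  rw [← jacobiSym.legendreSym.to_jacobiSym, legendreSym.eq_pow]
  congr 1
  omega

lemma eq_of_cast_eq_of_sq_eq_one {p : ℕ} (hp : 2 < p) {a b : ℤ} (ha : a ^ 2 = 1) (hb : b ^ 2 = 1)
    (h : (a : ZMod p) = b) : a = b := by
  have : Fact (2 < p) := ⟨hp⟩
  have hne : (-1 : ZMod p) ≠ 1 := ZMod.neg_one_ne_one
  rcases sq_eq_one_iff.1 ha with rfl | rfl <;>
  rcases sq_eq_one_iff.1 hb with rfl | rfl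
  · rfl
  · push_cast at h; exact absurd h.symm hne
  · push_cast at h; exact absurd h hne
  · rfl

lemma quartSym_sq (p : ℕ) (a : ℤ) : quartSym p a ^ 2 = 1 := by
  unfold quartSym; split_ifs <;> norm_num

lemma quartSym_cast {p : ℕ} [Fact p.Prime] (hp : p % 4 = 1) {a : ℤ}
    (ha : (a : ZMod p) ^ ((p - 1) / 2) = 1) :
    ((quartSym p a : ℤ) : ZMod p) = (a : ZMod p) ^ ((p - 1) / 4) := by
  have h : ((a : ZMod p) ^ ((p - 1) / 4)) ^ 2 = 1 := by
    rw [← pow_mul, show (p - 1) / 4 * 2 = (p - 1) / 2 by omega, ha]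
  unfold quartSym
  split_ifs with h1
  · simp [h1]
  · simpa using ((sq_eq_one_iff.1 h).resolve_left h1).symm

lemma jacobiSym_eq_one_of_dvd {a z : ℤ} {b : ℕ} (h : (b : ℤ) ∣ z ^ 2 - a)
    (hc : IsCoprime a b) : jacobiSym a b = 1 := by
  have h1 : jacobiSym a b = jacobiSym (z ^ 2) b :=
    jacobiSym.mod_left' (Int.modEq_iff_dvd.2 h)
  have hz : IsCoprime z b := by
    have : IsCoprime (z ^ 2) b := by
      obtain ⟨c, hc'⟩ := h
      rw [show z ^ 2 = a + b * c by linear_combination hc']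
      exact IsCoprime.add_mul_left_left hc c
    exact (IsCoprime.pow_left_iff two_pos).1 this
  rw [h1]
  exact jacobiSym.sq_one' (Int.isCoprime_iff_gcd_eq_one.1 hz)

lemma quartSym_two_iff {l : ℕ} (hl : l.Prime) (hl8 : l % 8 = 1) {u v : ℕ} (hu : 4 ∣ u)
    (huv : u ^ 2 + 1 = v ^ 2 * l) : quartSym l 2 = (-1) ^ ((l - 1) / 8) ↔ 8 ∣ u := by
  have : Fact l.Prime := ⟨hl⟩
  have hodd : Odd (1 + u) := by grind
  have hlodd : Odd l := by grind
  have hu2 : (u : ZMod l) ^ 2 = -1 := by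
    have := congrArg (Nat.cast : ℕ → ZMod l) huv
    push_cast at this
    rw [CharP.cast_eq_zero (ZMod l) l] at this
    linear_combination this
  have h2 : ((2 : ℤ) : ZMod l) ^ ((l - 1) / 2) = 1 := by
    rw [← jacobiSym_cast_eq_pow (by omega), jacobiSym.at_two hlodd, ZMod.χ₈_nat_mod_eight, hl8]
    have : ZMod.χ₈ ((1 : ℕ) : ZMod 8) = 1 := by decide
    rw [this, Int.cast_one]
  have hJ : jacobiSym (1 + u : ℕ) l = quartSym l 2 * (-1) ^ ((l - 1) / 8) := by
    refine eq_of_cast_eq_of_sq_eq_one (p := l) (by have := hl.two_le; omega) ?_ ?_ ?_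
    · refine jacobiSym.sq_one ?_
      rw [Int.gcd_natCast_natCast]
      refine ((Nat.Prime.coprime_iff_not_dvd hl).2 fun hd => ?_).symm
      have h0 := (CharP.cast_eq_zero_iff (ZMod l) l (1 + u)).2 hd
      push_cast at h0
      have h3 : (2 : ZMod l) = 0 := by linear_combination (1 - (u : ZMod l)) * h0 + hu2
      have := h2
      push_cast at this
      rw [h3, zero_pow] at this
      · exact zero_ne_one this
      · have := hl.two_le; omega
    · rw [mul_pow, quartSym_sq, ← pow_mul, mul_comm _ 2, pow_mul]; simp
    · push_cast
      rw [quartSym_cast (by omega) h2, jacobiSym_cast_eq_pow (by omega)]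
      push_cast
      rw [← hu2, show (l - 1) / 2 = 2 * ((l - 1) / 4) by omega, pow_mul,
        ← pow_mul (u : ZMod l), show 2 * ((l - 1) / 8) = (l - 1) / 4 by omega, ← mul_pow]
      congr 1
      linear_combination hu2
  have hcop : IsCoprime ((2 : ℤ) * v ^ 2 * l) ((1 + u : ℕ) : ℤ) := by
    obtain ⟨m, rfl⟩ := hu
    have h3 : IsCoprime (2 : ℤ) ((1 + 4 * m : ℕ) : ℤ) := ⟨-2 * m, 1, by push_cast; ring⟩
    have h4 : (2 : ℤ) * v ^ 2 * l = 2 * 2 + ((1 + 4 * m : ℕ) : ℤ) * (2 * (4 * m - 1)) := by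
      zify at huv
      push_cast
      linear_combination -2 * huv
    rw [h4]
    exact IsCoprime.add_mul_left_left (h3.mul_left h3) _
  have h5 : jacobiSym (2 * v ^ 2 * l) (1 + u) = 1 := by
    refine jacobiSym_eq_one_of_dvd (z := 1 - u) ⟨-(1 + u), ?_⟩ hcop
    zify at huv
    push_cast
    linear_combination 2 * huv
  have hv : (v : ℤ).gcd (1 + u : ℕ) = 1 := Int.isCoprime_iff_gcd_eq_one.1 <|
    (IsCoprime.pow_left_iff two_pos).1 hcop.of_mul_left_left.of_mul_left_right
  rw [jacobiSym.mul_left, jacobiSym.mul_left, jacobiSym.sq_one' hv, mul_one,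
    ← jacobiSym.quadratic_reciprocity_one_mod_four' hodd (by omega), hJ,
    jacobiSym.at_two hodd] at h5
  have h6 : ((-1 : ℤ) ^ ((l - 1) / 8)) = 1 ∨ ((-1 : ℤ) ^ ((l - 1) / 8)) = -1 :=
    neg_one_pow_eq_or ℤ _
  have h7 := sq_eq_one_iff.1 (quartSym_sq l 2)
  have h8 : ZMod.χ₈ ((1 + u : ℕ) : ZMod 8) = if 8 ∣ u then 1 else -1 := by
    rw [ZMod.χ₈_nat_eq_if_mod_eight]
    have : (1 + u) % 2 ≠ 0 := by omega
    rw [if_neg this]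
    congr 1
    simp only [eq_iff_iff]
    omega
  rw [h8] at h5
  generalize (-1 : ℤ) ^ ((l - 1) / 8) = e at *
  rcases h6 with rfl | rfl <;> rcases h7 with h7 | h7 <;> rw [h7] at h5 ⊢ <;>
    split_ifs at h5 with h <;> simp_all

lemma mod_four_eq_one_of_sq_add_one {u v l : ℕ} (hv : v % 2 = 1) (huv : u ^ 2 + 1 = v ^ 2 * l) :
    v % 4 = 1 := by
  have h1 : jacobiSym (-1) v = 1 := by
    refine jacobiSym_eq_one_of_dvd (z := u) ⟨v * l, ?_⟩ isCoprime_one_left.neg_left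
    zify at huv
    linear_combination huv
  rw [jacobiSym.at_neg_one (Nat.odd_iff.2 hv)] at h1
  by_contra h
  rw [ZMod.χ₄_nat_three_mod_four (by omega)] at h1
  norm_num at h1

lemma isCoprime_of_sq_sub_eq_prime_pow {l q h : ℕ} (hl : l.Prime) (hq : q.Prime) (hne : q ≠ l)
    (hh : h ≠ 0) {x y : ℤ} (hxy : x ^ 2 - l * y ^ 2 = q ^ h) (hqy : ¬ (q : ℤ) ∣ y) :
    IsCoprime x y ∧ IsCoprime x q ∧ IsCoprime x l := by
  have hqy' : IsCoprime y (q : ℤ) :=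
    ((Nat.prime_iff_prime_int.1 hq).coprime_iff_not_dvd.2 hqy).symm
  have hlq : IsCoprime (l : ℤ) (q : ℤ) :=
    Nat.isCoprime_iff_coprime.2 ((Nat.coprime_primes hl hq).2 hne.symm)
  obtain ⟨h, rfl⟩ : ∃ m, h = m + 1 := ⟨h - 1, by omega⟩
  refine ⟨(IsCoprime.pow_left_iff two_pos).1 ?_, (IsCoprime.pow_left_iff two_pos).1 ?_,
    (IsCoprime.pow_left_iff two_pos).1 ?_⟩
  · rw [show x ^ 2 = (q : ℤ) ^ (h + 1) + y * (l * y) by linear_combination hxy]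
    exact IsCoprime.add_mul_left_left hqy'.symm.pow_left _
  · rw [show x ^ 2 = l * y ^ 2 + q * (q : ℤ) ^ h by linear_combination hxy]
    exact IsCoprime.add_mul_left_left (hlq.mul_left hqy'.pow_left) _
  · rw [show x ^ 2 = (q : ℤ) ^ (h + 1) + l * (y ^ 2) by linear_combination hxy]
    exact IsCoprime.add_mul_left_left hlq.symm.pow_left _

private lemma quartSym_eq_iff_aux {l q : ℕ} (hl : l.Prime) (hl4 : l % 4 = 1) (hq : q.Prime)
    (hq4 : q % 4 = 1) (hne : q ≠ l) {u v : ℕ} (hu : 4 ∣ u) (hv : v % 2 = 1)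
    (huv : u ^ 2 + 1 = v ^ 2 * l)
    {x : ℕ} {y : ℤ} {h : ℕ} (hh : Odd h) (hxy : (x : ℤ) ^ 2 - l * y ^ 2 = q ^ h)
    (hqy : ¬ (q : ℤ) ∣ y) {C : ℤ} (hC : ((C : ℤ) : ZMod q) ^ 2 = l)
    (hx : ((x : ℤ) : ZMod q) = - y * C) :
    quartSym l q = quartSym q l ↔ IsSquare (((u + v * C : ℤ) : ZMod q)) := by
  have : Fact l.Prime := ⟨hl⟩
  have : Fact q.Prime := ⟨hq⟩
  have hv4 := mod_four_eq_one_of_sq_add_one hv huv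
  have hqodd : Odd q := by grind
  have hlodd : Odd l := by grind
  have hq2 : 2 < q := by have := hq.two_le; omega
  have hl2 : 2 < l := by have := hl.two_le; omega
  obtain ⟨hcxy, hcxq, hcxl⟩ := isCoprime_of_sq_sub_eq_prime_pow hl hq hne hh.pos.ne' hxy hqy
  have hqh : ((q : ℤ) ^ h) % 4 = 1 := by
    have : ((q : ℤ)) ≡ 1 [ZMOD 4] := by unfold Int.ModEq; omega
    simpa [Int.ModEq] using this.pow h
  have hpar : x % 2 = 1 ∧ y % 2 = 0 := by
    obtain ⟨m, hm⟩ : ∃ m, l = 4 * m + 1 := ⟨l / 4, by omega⟩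
    have h1 : ((x : ℤ) ^ 2 - y ^ 2) % 4 = 1 := by
      have : (x : ℤ) ^ 2 - y ^ 2 = q ^ h + 4 * (m * y ^ 2) := by
        rw [← hxy, hm]; push_cast; ring
      omega
    have hx2 : (x : ℤ) ^ 2 % 4 = x % 2 := by
      rcases Int.even_or_odd' x with ⟨a, ha | ha⟩ <;> rw [ha]
      · rw [show (2 * a) ^ 2 = 4 * a ^ 2 by ring]; omega
      · rw [show (2 * a + 1) ^ 2 = 4 * (a ^ 2 + a) + 1 by ring]; omega
    have hy2 : y ^ 2 % 4 = y % 2 := by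
      rcases Int.even_or_odd' y with ⟨a, ha | ha⟩ <;> rw [ha]
      · rw [show (2 * a) ^ 2 = 4 * a ^ 2 by ring]; omega
      · rw [show (2 * a + 1) ^ 2 = 4 * (a ^ 2 + a) + 1 by ring]; omega
    omega
  have hxodd : Odd x := Nat.odd_iff.2 hpar.1
  have hWpos : 0 < (v : ℤ) * x - u * y := by
    by_contra hcon
    push Not at hcon
    have h1 : (v : ℤ) ^ 2 * x ^ 2 ≤ u ^ 2 * y ^ 2 := by
      have : ((v : ℤ) * x) ^ 2 ≤ (u * y) ^ 2 :=
        pow_le_pow_left₀ (by positivity) (by linarith) 2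
      simpa [mul_pow] using this
    have h2 : (x : ℤ) ^ 2 = l * y ^ 2 + q ^ h := by linear_combination hxy
    have h3 : (v : ℤ) ^ 2 * l = u ^ 2 + 1 := by exact_mod_cast huv.symm
    have h4 : (0 : ℤ) < v ^ 2 * q ^ h := by
      have := hq.pos
      have : 0 < v := by omega
      positivity
    have h5 : (v : ℤ) ^ 2 * x ^ 2 = u ^ 2 * y ^ 2 + y ^ 2 + v ^ 2 * q ^ h := by
      rw [h2]; linear_combination y ^ 2 * h3
    nlinarith [sq_nonneg y]
  obtain ⟨W, hW⟩ : ∃ W : ℕ, (W : ℤ) = v * x - u * y := ⟨_, Int.toNat_of_nonneg hWpos.le⟩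
  have hWx : W % 4 = x % 4 := by
    obtain ⟨a, rfl⟩ := hu
    obtain ⟨b, rfl⟩ : ∃ b, v = 4 * b + 1 := ⟨v / 4, by omega⟩
    have : (W : ℤ) = x + 4 * (b * x - a * y) := by rw [hW]; push_cast; ring
    omega
  have hWodd : Odd W := Nat.odd_iff.2 (by omega)
  have hunit : ((u + v * C : ℤ) : ZMod q) * ((u - v * C : ℤ) : ZMod q) = -1 := by
    have := congrArg (Nat.cast : ℕ → ZMod q) huv
    push_cast at this ⊢
    linear_combination this - (v : ZMod q) ^ 2 * hC
  have hWq : ((W : ℤ) : ZMod q) = ((-1 * y * (u + v * C) : ℤ) : ZMod q) := by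
    rw [hW]
    push_cast at hx ⊢
    linear_combination (v : ZMod q) * hx
  have hy0 : ((y : ℤ) : ZMod q) ≠ 0 := fun h0 => hqy ((ZMod.intCast_zmod_eq_zero_iff_dvd _ _).1 h0)
  have ht0 : ((u + v * C : ℤ) : ZMod q) ≠ 0 := fun h0 => by
    rw [h0, zero_mul] at hunit
    exact one_ne_zero (neg_eq_zero.1 hunit.symm)
  have hW0 : ((W : ℤ) : ZMod q) ≠ 0 := by
    rw [hWq]
    push_cast at hy0 ht0 ⊢
    exact mul_ne_zero (mul_ne_zero (by simp) hy0) ht0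
  have hcqW : IsCoprime ((q : ℤ) ^ h) W :=
    ((Nat.prime_iff_prime_int.1 hq).coprime_iff_not_dvd.2 fun hd =>
      hW0 ((ZMod.intCast_zmod_eq_zero_iff_dvd _ _).2 hd)).pow_left
  have hl1 : jacobiSym l q = 1 := by
    rw [← jacobiSym.legendreSym.to_jacobiSym]
    refine (legendreSym.eq_one_iff q ?_).2 ⟨C, ?_⟩
    · intro h0
      rw [Int.cast_natCast, CharP.cast_eq_zero_iff (ZMod q) q] at h0
      exact hne ((Nat.prime_dvd_prime_iff_eq hq hl).1 h0)
    · rw [Int.cast_natCast, ← hC, sq]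
  have hq1 : jacobiSym q l = 1 := by
    rw [jacobiSym.quadratic_reciprocity_one_mod_four hq4 hlodd, hl1]
  have hlpow : (((l : ℤ) : ℤ) : ZMod q) ^ ((q - 1) / 2) = 1 := by
    rw [← jacobiSym_cast_eq_pow (by omega), hl1, Int.cast_one]
  have hqpow : (((q : ℤ) : ℤ) : ZMod l) ^ ((l - 1) / 2) = 1 := by
    rw [← jacobiSym_cast_eq_pow (by omega), hq1, Int.cast_one]
  have sqJ : ∀ {a : ℤ} {b : ℕ}, IsCoprime a b → jacobiSym a b ^ 2 = 1 := fun hc =>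
    jacobiSym.sq_one (Int.isCoprime_iff_gcd_eq_one.1 hc)
  have hcyq : IsCoprime y (q : ℤ) :=
    ((Nat.prime_iff_prime_int.1 hq).coprime_iff_not_dvd.2 hqy).symm
  have E1 : quartSym l q = jacobiSym l x := by
    rw [jacobiSym.quadratic_reciprocity_one_mod_four hl4 hxodd]
    refine eq_of_cast_eq_of_sq_eq_one hl2 (quartSym_sq _ _) (sqJ hcxl) ?_
    have h1 : quartSym l q ^ h = quartSym l q := by
      obtain ⟨m, rfl⟩ := hh
      rw [pow_succ, pow_mul, quartSym_sq, one_pow, one_mul]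
    rw [← h1, Int.cast_pow, quartSym_cast hl4 hqpow, jacobiSym_cast_eq_pow (by omega), ← pow_mul,
      mul_comm, pow_mul, show (l - 1) / 2 = 2 * ((l - 1) / 4) by omega, pow_mul]
    congr 1
    have := congrArg (Int.cast : ℤ → ZMod l) hxy
    push_cast at this ⊢
    rw [← this, CharP.cast_eq_zero (ZMod l) l]
    ring
  have E2 : quartSym q l * jacobiSym y q = jacobiSym q x := by
    rw [jacobiSym.quadratic_reciprocity_one_mod_four hq4 hxodd]
    refine eq_of_cast_eq_of_sq_eq_one hq2 ?_ (sqJ hcxq) ?_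
    · rw [mul_pow, quartSym_sq, sqJ hcyq, one_mul]
    · rw [Int.cast_mul, quartSym_cast hq4 hlpow, jacobiSym_cast_eq_pow (by omega),
        jacobiSym_cast_eq_pow (by omega), show (q - 1) / 2 = 2 * ((q - 1) / 4) by omega, pow_mul,
        pow_mul, ← mul_pow]
      congr 1
      rw [hx]
      push_cast
      linear_combination -(y : ZMod q) ^ 2 * hC
  have oddpow : ∀ e : ℤ, e ^ 2 = 1 → e ^ h = e := by
    intro e he
    obtain ⟨m, rfl⟩ := hh
    rw [pow_succ, pow_mul, he, one_pow, one_mul]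
  have E3 : jacobiSym (-1) x * jacobiSym l x * jacobiSym q x = 1 := by
    have := jacobiSym_eq_one_of_dvd (a := -1 * l * q ^ h) (z := l * y) (b := x) ⟨l * x, by
      linear_combination -(l : ℤ) * hxy⟩ ((isCoprime_one_left.neg_left.mul_left
        hcxl.symm).mul_left hcxq.symm.pow_left)
    rwa [jacobiSym.mul_left, jacobiSym.mul_left, jacobiSym.pow_left, oddpow _ (sqJ hcxq.symm)]
      at this
  have hcqW' : IsCoprime (q : ℤ) W := (IsCoprime.pow_left_iff hh.pos).1 hcqW
  have E4 : jacobiSym (-1) W * jacobiSym q W = 1 := by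
    have := jacobiSym_eq_one_of_dvd (a := -1 * q ^ h) (z := x * u - l * v * y) (b := W) ⟨l * W, by
      rw [hW]
      zify at huv
      linear_combination (u ^ 2 - l * v ^ 2) * hxy + (q : ℤ) ^ h * huv⟩
      (isCoprime_one_left.neg_left.mul_left hcqW)
    rwa [jacobiSym.mul_left, jacobiSym.pow_left, oddpow _ (sqJ hcqW')] at this
  have E5 : jacobiSym (-1) W = jacobiSym (-1) x := by
    rw [jacobiSym.at_neg_one hWodd, jacobiSym.at_neg_one hxodd, ZMod.χ₄_nat_mod_four, hWx,
      ← ZMod.χ₄_nat_mod_four]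
  have E6 : jacobiSym q W = jacobiSym y q * jacobiSym (u + v * C) q := by
    rw [jacobiSym.quadratic_reciprocity_one_mod_four hq4 hWodd]
    have : jacobiSym W q = jacobiSym (-1 * y * (u + v * C)) q :=
      jacobiSym.mod_left' ((ZMod.intCast_eq_intCast_iff _ _ _).1 hWq)
    rw [this, jacobiSym.mul_left, jacobiSym.mul_left, jacobiSym.at_neg_one hqodd,
      ZMod.χ₄_nat_one_mod_four hq4, one_mul]
  have E7 : IsSquare (((u + v * C : ℤ) : ZMod q)) ↔ jacobiSym (u + v * C) q = 1 := by
    rw [← jacobiSym.legendreSym.to_jacobiSym, legendreSym.eq_one_iff q ht0]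
  have hsq1 := sqJ hcyq
  have hsq2 := sqJ hcxl.symm
  have hsq3 : jacobiSym (-1) x ^ 2 = 1 := sqJ isCoprime_one_left.neg_left
  have hsq4 := quartSym_sq q l
  rw [E7, E1]
  rw [← E2] at E3
  rw [E5, E6] at E4
  clear E1 E2 E5 E6 E7
  generalize jacobiSym (u + v * C) q = t at *
  generalize jacobiSym y q = a at *
  generalize jacobiSym (-1) x = b at *
  generalize jacobiSym l x = c at *
  generalize quartSym q l = d at *
  have h0 : t = c * d := by
    linear_combination (c * d) * E4 - t * E3
  rw [h0]
  constructor
  · rintro rfl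
    rw [← sq, hsq2]
  · intro h
    linear_combination d * h - c * hsq4

lemma quartSym_eq_iff {l q : ℕ} (hl : l.Prime) (hl4 : l % 4 = 1) (hq : q.Prime)
    (hq4 : q % 4 = 1) (hne : q ≠ l) {u v : ℕ} (hu : 4 ∣ u) (hv : v % 2 = 1)
    (huv : u ^ 2 + 1 = v ^ 2 * l)
    {x y : ℤ} {h : ℕ} (hh : Odd h) (hxy : x ^ 2 - l * y ^ 2 = q ^ h)
    (hqy : ¬ (q : ℤ) ∣ y) {c : ZMod q} (hc : c ^ 2 = l) :
    quartSym l q = quartSym q l ↔ IsSquare (u + v * c) := by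
  have : Fact q.Prime := ⟨hq⟩
  obtain ⟨C, rfl⟩ := ZMod.intCast_surjective c
  have h1 : (((x.natAbs : ℕ) : ℤ) : ZMod q) ^ 2 = ((y : ZMod q) * C) ^ 2 := by
    rw [← Int.cast_pow, Int.natAbs_sq]
    have := congrArg (Int.cast : ℤ → ZMod q) hxy
    obtain ⟨m, rfl⟩ := hh
    push_cast at this ⊢
    rw [CharP.cast_eq_zero (ZMod q) q, zero_pow (by omega)] at this
    linear_combination this - (y : ZMod q) ^ 2 * hc
  rcases sq_eq_sq_iff_eq_or_eq_neg.1 h1 with h2 | h2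
  · have := quartSym_eq_iff_aux hl hl4 hq hq4 hne hu hv huv (x := x.natAbs) (y := -y) (C := C) hh
      (by rw [Int.natAbs_sq]; linear_combination hxy) (by rwa [dvd_neg]) hc (by rw [h2]; simp)
    simpa using this
  · have := quartSym_eq_iff_aux hl hl4 hq hq4 hne hu hv huv (x := x.natAbs) (y := y) (C := C) hh
      (by rw [Int.natAbs_sq]; linear_combination hxy) hqy hc (by rw [h2]; simp)
    simpa using this

/-- The norm map `x ↦ x * σ x` attached to an endomorphism `σ` of a commutative group. -/
def sigmaNorm {G : Type*} [CommGroup G] (σ : G →* G) : G →* G := MonoidHom.id G * σ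

/-- The map `x ↦ x / σ x` attached to an endomorphism `σ` of a commutative group. -/
def coboundHom {G : Type*} [CommGroup G] (σ : G →* G) : G →* G := MonoidHom.id G / σ

/-- The subgroup of elements fixed by an endomorphism. -/
def fixedSub {G : Type*} [CommGroup G] (σ : G →* G) : Subgroup G := (coboundHom σ).ker

section abstractGroups

variable {X I C : Type*} [CommGroup X] [CommGroup I] [CommGroup C]

@[simp] lemma sigmaNorm_apply (σ : X →* X) (x : X) : sigmaNorm σ x = x * σ x := rfl

@[simp] lemma coboundHom_apply (σ : X →* X) (x : X) : coboundHom σ x = x / σ x := rfl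

lemma mem_fixedSub {σ : X →* X} {x : X} : x ∈ fixedSub σ ↔ σ x = x := by
  rw [fixedSub, MonoidHom.mem_ker, coboundHom_apply, div_eq_one, eq_comm]

/-- The group-theoretic core of the ambiguous class number formula for a quadratic extension of
a base with odd class number. -/
theorem ambiguous_class_formula (div : X →* I) (σ : X →* X) (s : I →* I) (cl : I →* C)
    (hcl : Function.Surjective cl) (hker : cl.ker = div.range)
    (hσ : ∀ x, σ (σ x) = x) (hs : ∀ J, s (s J) = J) (hdiv : ∀ x, s (div x) = div (σ x))
    (D : Subgroup I) (hDfix : D ≤ fixedSub s) (hDnorm : ∀ J, J * s J ∈ D)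
    (hFD : ∀ x, σ x = x → div x ∈ D)
    (h90 : ∀ x, x * σ x = 1 → ∃ y, x = y / σ y)
    (h90I : ∀ x, div x * s (div x) = 1 → ∃ J, div x = J / s J)
    (h : ℕ) (hodd : Odd h) (hD : ∀ J ∈ D, ∃ x, σ x = x ∧ div x = J ^ h) :
    Nat.card {c : C // c ^ 2 = 1} *
        (div.ker.map (coboundHom σ)).relIndex (div.ker ⊓ (sigmaNorm σ).ker) =
      D.relIndex (fixedSub s) *
        (div.ker.map (sigmaNorm σ)).relIndex ((div.ker ⊓ fixedSub σ) ⊓ (sigmaNorm σ).range) := by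
  obtain ⟨m, rfl⟩ := hodd
  have hclker : ∀ J, cl J = 1 ↔ ∃ x, div x = J := fun J => by
    rw [← MonoidHom.mem_ker, hker, MonoidHom.mem_range]
  set φ : I →* C := (powMonoidHom (2 * m + 1)).comp cl with hφ
  have hφa : ∀ J, φ J = cl (J ^ (2 * m + 1)) := fun J => by simp [hφ]
  -- the group of pairs `(J, β)` with `J = β * s J`
  let 𝒢 : Subgroup (I × X) :=
    ((coboundHom s).comp (MonoidHom.fst I X)).eqLocus (div.comp (MonoidHom.snd I X))
  have h𝒢 : ∀ z : I × X, z ∈ 𝒢 ↔ z.1 / s z.1 = div z.2 := fun z => Iff.rfl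
  let f : 𝒢 →* C := (φ.comp (MonoidHom.fst I X)).comp 𝒢.subtype
  let g : 𝒢 →* X := ((sigmaNorm σ).comp (MonoidHom.snd I X)).comp 𝒢.subtype
  have hf : ∀ z : 𝒢, f z = φ z.1.1 := fun z => rfl
  have hg : ∀ z : 𝒢, g z = z.1.2 * σ z.1.2 := fun z => rfl
  have hgrange : g.range = (div.ker ⊓ fixedSub σ) ⊓ (sigmaNorm σ).range := by
    ext x
    constructor
    · rintro ⟨⟨⟨J, β⟩, hz⟩, rfl⟩
      have hz' : J / s J = div β := hz
      refine ⟨⟨?_, ?_⟩, ⟨β, rfl⟩⟩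
      · change div (β * σ β) = 1
        rw [map_mul, ← hdiv, ← hz', map_div, hs]; simp
      · refine mem_fixedSub.2 ?_
        change σ (β * σ β) = β * σ β
        rw [map_mul, hσ, mul_comm]
    · rintro ⟨⟨hx1, -⟩, ⟨β, rfl⟩⟩
      have : div β * s (div β) = 1 := by
        rw [hdiv, ← map_mul]; exact hx1
      obtain ⟨J, hJ⟩ := h90I β this
      exact ⟨⟨(J, β), hJ.symm⟩, rfl⟩
  set N := div.ker.map (sigmaNorm σ) with hN
  set H := N.comap g with hH
  have hHindex : H.index = N.relIndex g.range := Subgroup.index_comap N g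
  -- squares of fixed units are norms
  have hkerle : f.ker ≤ H := by
    rintro ⟨⟨J, β⟩, hz⟩ hk
    have hz' : J / s J = div β := hz
    have hk' : cl (J ^ (2 * m + 1)) = 1 := by rw [← hφa]; exact hk
    obtain ⟨γ, hγ⟩ := (hclker _).1 hk'
    have h1 : div (β ^ (2 * m + 1) / (γ / σ γ)) = 1 := by
      rw [map_div, map_pow, ← hz', map_div, ← hdiv, hγ, map_pow, div_pow]; simp
    refine ⟨(β ^ (2 * m + 1) / (γ / σ γ)) / (β * σ β) ^ m, ?_, ?_⟩
    · change div _ = 1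
      rw [map_div, h1, map_pow, map_mul, ← hdiv, ← hz', map_div, hs]; simp
    · change _ = β * σ β
      simp only [sigmaNorm_apply, map_div, map_pow, map_mul, hσ]
      apply Additive.ofMul.injective
      simp only [ofMul_mul, ofMul_div, ofMul_pow]
      module
  have hfrange : Nat.card {c : C // c ^ 2 = 1} = Nat.card f.range := by
    refine Nat.card_congr (Equiv.subtypeEquivRight fun c => ?_)
    constructor
    · intro hc
      obtain ⟨J, rfl⟩ := hcl c
      rw [← map_pow] at hc
      obtain ⟨γ, hγ⟩ := (hclker _).1 hc
      obtain ⟨b, hb1, hb⟩ := hD _ (hDnorm J)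
      -- `(J * s J) ^ 2 = div (γ * σ γ)`
      have h2 : (J * s J) ^ 2 = div (γ * σ γ) := by
        rw [map_mul, ← hdiv, hγ, mul_pow, map_pow]
      have h3 : J * s J = div (b / (γ * σ γ) ^ m) := by
        rw [map_div, hb, map_pow, ← h2, ← pow_mul, pow_succ]; simp
      refine ⟨⟨(J, γ / (b / (γ * σ γ) ^ m)), ?_⟩, ?_⟩
      · change J / s J = div (γ / (b / (γ * σ γ) ^ m))
        rw [map_div, ← h3, hγ, sq, div_eq_mul_inv, div_eq_mul_inv, mul_inv, mul_assoc]; simp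
      · rw [hf, hφa]
        change cl (J ^ (2 * m + 1)) = _
        rw [pow_succ, pow_mul, map_mul, map_pow, hc]; simp
    · rintro ⟨⟨⟨J, β⟩, hz⟩, rfl⟩
      have hz' : J / s J = div β := hz
      obtain ⟨b, hb1, hb⟩ := hD _ (hDnorm J)
      rw [hf, hφa, ← map_pow, hclker]
      refine ⟨b * β ^ (2 * m + 1), ?_⟩
      rw [map_mul, hb, map_pow, ← hz', ← mul_pow, ← pow_mul, mul_comm (2 * m + 1) 2, pow_mul]
      congr 1
      change J * s J * (J / s J) = J ^ 2
      apply Additive.ofMul.injective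
      simp only [ofMul_mul, ofMul_div, ofMul_pow]
      module
  have hmapH : H.map f = (fixedSub s).map φ := by
    ext c
    constructor
    · rintro ⟨⟨⟨J, β⟩, hz⟩, hk, rfl⟩
      have hz' : J / s J = div β := hz
      obtain ⟨θ, hθ, hθ2⟩ : ∃ θ, div θ = 1 ∧ θ * σ θ = β * σ β := hk
      obtain ⟨γ, hγ⟩ := h90 (β / θ) (by
        rw [map_div, div_mul_div_comm, hθ2, div_self'])
      refine ⟨J / div γ, ?_, ?_⟩
      · rw [SetLike.mem_coe, mem_fixedSub, map_div, hdiv]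
        have : J / s J = div γ / div (σ γ) := by
          rw [hz', ← map_div, ← hγ, map_div, hθ, div_one]
        rw [div_eq_div_iff_mul_eq_mul] at this ⊢
        rw [mul_comm, ← this, mul_comm]
      · rw [hf, hφa, hφa, div_pow, map_div, ← map_pow div,
          (hclker (div (γ ^ (2 * m + 1)))).2 ⟨_, rfl⟩, div_one]
    · rintro ⟨J, hJ, rfl⟩
      rw [SetLike.mem_coe, mem_fixedSub] at hJ
      exact ⟨⟨(J, 1), by rw [h𝒢, hJ]; simp⟩, ⟨1, by simp, by simp [hg]⟩, rfl⟩
  have hcard : Nat.card f.range = (φ.ker.relIndex (fixedSub s)) * N.relIndex g.range := by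
    rw [Subgroup.relIndex_ker, ← hmapH, ← hHindex]
    have h1 : (H.map f.rangeRestrict).index = H.index :=
      Subgroup.index_map_eq _ f.rangeRestrict_surjective (by
        rw [MonoidHom.ker_rangeRestrict]; exact hkerle)
    rw [← h1, ← Subgroup.card_mul_index (H.map f.rangeRestrict)]
    congr 1
    rw [← Subgroup.card_map_of_injective (K := H.map f.rangeRestrict) f.range.subtype_injective,
      Subgroup.map_map]
    rfl
  set U : Subgroup X := (fixedSub s).comap div with hU
  have hDφ : D ≤ φ.ker ⊓ fixedSub s := by
    refine le_inf (fun J hJ => ?_) hDfix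
    obtain ⟨x, -, hx⟩ := hD J hJ
    rw [MonoidHom.mem_ker, hφa, hclker]
    exact ⟨x, hx⟩
  have hsplit : φ.ker ⊓ fixedSub s = U.map div ⊔ D := by
    apply le_antisymm
    · rintro J ⟨hJ1, hJ2⟩
      replace hJ1 : φ J = 1 := hJ1
      rw [hφa, hclker] at hJ1
      obtain ⟨γ, hγ⟩ := hJ1
      have hJ3 := mem_fixedSub.1 hJ2
      have hJ4 : J ^ 2 ∈ D := by
        have := hDnorm J
        rwa [hJ3, ← sq] at this
      have : J = div γ * ((J ^ 2) ^ m)⁻¹ := by rw [hγ, pow_succ', pow_mul]; simp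
      rw [this]
      refine mul_mem (Subgroup.mem_sup_left ⟨γ, ?_, rfl⟩)
        (Subgroup.mem_sup_right (inv_mem (pow_mem hJ4 _)))
      change div γ ∈ fixedSub s
      rw [hγ]
      exact pow_mem hJ2 _
    · refine sup_le ?_ hDφ
      rintro _ ⟨γ, hγ, rfl⟩
      refine ⟨?_, hγ⟩
      change φ (div γ) = 1
      rw [hφa, ← map_pow div, hclker]
      exact ⟨_, rfl⟩
  have hUM : U.map (coboundHom σ) = div.ker ⊓ (sigmaNorm σ).ker := by
    ext x
    constructor
    · rintro ⟨γ, hγ, rfl⟩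
      have hγ' : s (div γ) = div γ := mem_fixedSub.1 hγ
      refine ⟨?_, ?_⟩
      · change div (γ / σ γ) = 1
        rw [map_div, ← hdiv, hγ']; simp
      · change (γ / σ γ) * σ (γ / σ γ) = 1
        rw [map_div, hσ]; simp
    · rintro ⟨hx1, hx2⟩
      have hx1' : div x = 1 := hx1
      obtain ⟨y, rfl⟩ := h90 x hx2
      refine ⟨y, ?_, rfl⟩
      change div y ∈ fixedSub s
      rw [mem_fixedSub, hdiv]
      rw [map_div, div_eq_one] at hx1'
      exact hx1'.symm
  have hcompare : D.comap div ⊓ U = (div.ker.map (coboundHom σ)).comap (coboundHom σ) ⊓ U := by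
    ext x
    constructor
    · rintro ⟨hx, hxU⟩
      refine ⟨?_, hxU⟩
      have hx' : div x ∈ D := hx
      obtain ⟨b, hb1, hb⟩ := hD _ hx'
      have hxx := hDfix hx'
      rw [mem_fixedSub, hdiv] at hxx
      refine ⟨x * (x * σ x) ^ m / b, ?_, ?_⟩
      · change div _ = 1
        rw [map_div, hb, map_mul, map_pow, map_mul, hxx, ← sq, ← pow_mul, ← pow_succ', div_self']
      · simp only [coboundHom_apply, map_div, map_mul, map_pow, hσ, hb1]
        apply Additive.ofMul.injective
        simp only [ofMul_mul, ofMul_div, ofMul_pow]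
        module
    · rintro ⟨⟨θ, hθ, hx⟩, hxU⟩
      refine ⟨?_, hxU⟩
      have hθ' : div θ = 1 := hθ
      have hx' : θ / σ θ = x / σ x := hx
      have := hFD (x / θ) (by
        rw [map_div, div_eq_div_iff_mul_eq_mul, mul_comm x]
        rw [div_eq_div_iff_mul_eq_mul] at hx'
        rw [mul_comm, hx', mul_comm])
      rwa [map_div, hθ', div_one] at this
  have e1 : D.relIndex (U.map div) = (D.comap div).relIndex U :=
    (Subgroup.relIndex_comap D div U).symm
  have e2 : (D.comap div).relIndex U =
      (div.ker.map (coboundHom σ)).relIndex (div.ker ⊓ (sigmaNorm σ).ker) := by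
    rw [← hUM, ← Subgroup.inf_relIndex_right, hcompare, Subgroup.inf_relIndex_right,
      Subgroup.relIndex_comap]
  have e3 : D.relIndex (fixedSub s) =
      D.relIndex (U.map div) * (φ.ker.relIndex (fixedSub s)) := by
    rw [← Subgroup.relIndex_mul_relIndex D (φ.ker ⊓ fixedSub s) (fixedSub s) hDφ inf_le_right,
      Subgroup.inf_relIndex_right, hsplit, Subgroup.relIndex_sup_right]
  rw [hfrange, hcard, e3, e1, e2, ← hgrange]
  ring
end abstractGroups

section unitIndex

variable {X Y : Type*} [CommGroup X] [CommGroup Y]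

lemma relIndex_map_map_of_inf_ker_le (f : X →* Y) {H K : Subgroup X} (hHK : H ≤ K)
    (hker : K ⊓ f.ker ≤ H) : (H.map f).relIndex (K.map f) = H.relIndex K := by
  have h1 : K ⊔ f.ker = K ⊔ (H ⊔ f.ker) := by
    rw [← sup_assoc, sup_eq_left.2 hHK]
  rw [Subgroup.relIndex_map_map, h1, Subgroup.relIndex_sup_right, ← Subgroup.inf_relIndex_right,
    sup_inf_assoc_of_le _ hHK, inf_comm, sup_eq_left.2 hker]

/-- The subgroup of squares of elements of a subgroup. -/
def squaresOf (H : Subgroup X) : Subgroup X := H.map (powMonoidHom 2)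

lemma mem_squaresOf {H : Subgroup X} {x : X} : x ∈ squaresOf H ↔ ∃ y ∈ H, y ^ 2 = x := Iff.rfl

lemma squaresOf_le (H : Subgroup X) : squaresOf H ≤ H := by
  rintro _ ⟨y, hy, rfl⟩
  exact pow_mem hy 2

/-- The unit index computation behind the Herbrand quotient of the units of a quadratic
extension of totally real fields. -/
theorem unit_index_formula (σ : X →* X) (hσ : ∀ x, σ (σ x) = x) (E : Subgroup X)
    (hE : ∀ x ∈ E, σ x ∈ E) (q : ℕ) (hq : q ≠ 0)
    (hqE : (squaresOf E).relIndex E = q ^ 2)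
    (hqE0 : (squaresOf (E ⊓ fixedSub σ)).relIndex (E ⊓ fixedSub σ) = q)
    (m : X) (hm1 : m ≠ 1) (hmE : m ∈ E) (hm2 : m ^ 2 = 1) (hmσ : σ m = m)
    (htors : ∀ x ∈ E, x ^ 2 = 1 → x = 1 ∨ x = m) (hmsq : ∀ x ∈ E, x ^ 2 ≠ m) :
    (E.map (coboundHom σ)).relIndex (E ⊓ (sigmaNorm σ).ker) =
      2 * (E.map (sigmaNorm σ)).relIndex (E ⊓ fixedSub σ) := by
  set M := E ⊓ (sigmaNorm σ).ker with hM
  set F := E ⊓ fixedSub σ with hF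
  set H := M ⊔ F with hH
  have hHE : H ≤ E := sup_le inf_le_left inf_le_left
  have hmemM : ∀ x, x ∈ M ↔ x ∈ E ∧ x * σ x = 1 := fun x => Iff.rfl
  have hmemF : ∀ x, x ∈ F ↔ x ∈ E ∧ σ x = x := fun x => by
    rw [hF, Subgroup.mem_inf, mem_fixedSub]
  have hmF : m ∈ F := (hmemF m).2 ⟨hmE, hmσ⟩
  have hmM : m ∈ M := (hmemM m).2 ⟨hmE, by rw [hmσ, ← sq, hm2]⟩
  have hN : H.map (sigmaNorm σ) = squaresOf F := by
    have h1 : M.map (sigmaNorm σ) = ⊥ :=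
      (Subgroup.map_eq_bot_iff _).2 inf_le_right
    rw [hH, Subgroup.map_sup, h1, bot_sup_eq]
    ext x
    constructor
    · rintro ⟨y, hy, rfl⟩
      exact ⟨y, hy, by simp [((hmemF y).1 hy).2, sq]⟩
    · rintro ⟨y, hy, rfl⟩
      exact ⟨y, hy, by simp [((hmemF y).1 hy).2, sq]⟩
  have hB : H.map (coboundHom σ) = squaresOf M := by
    have h1 : F.map (coboundHom σ) = ⊥ := (Subgroup.map_eq_bot_iff _).2 inf_le_right
    rw [hH, Subgroup.map_sup, h1, sup_bot_eq]
    ext x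
    have key : ∀ y ∈ M, y / σ y = y ^ 2 := fun y hy => by
      rw [sq, eq_inv_of_mul_eq_one_right ((hmemM y).1 hy).2, div_inv_eq_mul]
    constructor
    · rintro ⟨y, hy, rfl⟩
      exact ⟨y, hy, (key y hy).symm⟩
    · rintro ⟨y, hy, rfl⟩
      exact ⟨y, hy, key y hy⟩
  set i := H.relIndex E with hi
  have hiN : (squaresOf F).relIndex (E.map (sigmaNorm σ)) = i := by
    rw [← hN]
    exact relIndex_map_map_of_inf_ker_le _ hHE le_sup_left
  have hiB : (squaresOf M).relIndex (E.map (coboundHom σ)) = i := by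
    rw [← hB]
    exact relIndex_map_map_of_inf_ker_le _ hHE le_sup_right
  have hiQ : (squaresOf H).relIndex (squaresOf E) = i := by
    refine relIndex_map_map_of_inf_ker_le _ hHE ?_
    rintro x ⟨hx1, hx2⟩
    rcases htors x hx1 hx2 with rfl | rfl
    · exact one_mem _
    · exact Subgroup.mem_sup_left hmM
  have hNF : E.map (sigmaNorm σ) ≤ F := by
    rintro _ ⟨x, hx, rfl⟩
    exact (hmemF _).2 ⟨mul_mem hx (hE x hx), by simp [hσ, mul_comm]⟩
  have hBM : E.map (coboundHom σ) ≤ M := by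
    rintro _ ⟨x, hx, rfl⟩
    exact (hmemM _).2 ⟨div_mem hx (hE x hx), by simp [hσ]⟩
  have e1 : i * (E.map (sigmaNorm σ)).relIndex F = q := by
    rw [← hiN, ← hqE0]
    refine Subgroup.relIndex_mul_relIndex _ _ _ ?_ hNF
    rw [← hN]
    exact Subgroup.map_mono hHE
  have e2 : i * (E.map (coboundHom σ)).relIndex M = (squaresOf M).relIndex M := by
    rw [← hiB]
    refine Subgroup.relIndex_mul_relIndex _ _ _ ?_ hBM
    rw [← hB]
    exact Subgroup.map_mono hHE
  have hi0 : i ≠ 0 := by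
    rintro h0
    rw [h0, zero_mul] at e1
    exact hq e1.symm
  have e3 : (squaresOf H).relIndex H = q ^ 2 := by
    have h1 := Subgroup.relIndex_mul_relIndex _ _ _ (squaresOf_le H) hHE
    have h2 := Subgroup.relIndex_mul_relIndex (squaresOf H) (squaresOf E) E
      (Subgroup.map_mono hHE) (squaresOf_le E)
    rw [← h1, hqE, hiQ, ← hi, mul_comm] at h2
    exact (Nat.eq_of_mul_eq_mul_right (Nat.pos_of_ne_zero hi0) h2).symm
  have hMF : M ⊓ F = Subgroup.zpowers m := by
    apply le_antisymm
    · rintro x ⟨hx1, hx2⟩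
      have h1 := ((hmemM x).1 hx1)
      rw [((hmemF x).1 hx2).2, ← sq] at h1
      rcases htors x h1.1 h1.2 with rfl | rfl
      · exact one_mem _
      · exact Subgroup.mem_zpowers x
    · rw [Subgroup.zpowers_le]
      exact ⟨hmM, hmF⟩
  have hzm : ∀ x ∈ Subgroup.zpowers m, x = 1 ∨ x = m := by
    rw [← hMF]
    rintro x ⟨hx1, hx2⟩
    have h1 := ((hmemM x).1 hx1)
    rw [((hmemF x).1 hx2).2, ← sq] at h1
    exact htors x h1.1 h1.2
  have e4 : q = 2 * (M ⊔ squaresOf F).relIndex H := by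
    have h1 : H = F ⊔ (M ⊔ squaresOf F) := by
      rw [sup_left_comm, sup_eq_left.2 (squaresOf_le F)]
    have h2 : (squaresOf F ⊔ M) ⊓ F = squaresOf F ⊔ Subgroup.zpowers m := by
      rw [sup_inf_assoc_of_le _ (squaresOf_le F), hMF]
    have h3 : (M ⊔ squaresOf F).relIndex H =
        (squaresOf F ⊔ Subgroup.zpowers m).relIndex F := by
      rw [h1, Subgroup.relIndex_sup_right, ← Subgroup.inf_relIndex_right, sup_comm, h2]
    have h4 := Subgroup.relIndex_mul_relIndex (squaresOf F)
      (squaresOf F ⊔ Subgroup.zpowers m) F le_sup_left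
      (sup_le (squaresOf_le F) (by rwa [Subgroup.zpowers_le]))
    rw [hqE0, sup_comm, Subgroup.relIndex_sup_right, ← Subgroup.inf_relIndex_right] at h4
    have h5 : squaresOf F ⊓ Subgroup.zpowers m = ⊥ := by
      rw [eq_bot_iff]
      rintro x ⟨hx1, hx2⟩
      rcases hzm x hx2 with rfl | rfl
      · exact one_mem _
      · obtain ⟨y, hy, hyx⟩ := hx1
        exact absurd hyx (hmsq y ((hmemF y).1 hy).1)
    rw [h5, Subgroup.relIndex_bot_left, Nat.card_zpowers, orderOf_eq_prime hm2 hm1, sup_comm] at h4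
    rw [h3, h4]
  have hQH : squaresOf H = squaresOf M ⊔ squaresOf F := Subgroup.map_sup _ _ _
  have e5 : (squaresOf H).relIndex (M ⊔ squaresOf F) = (squaresOf M).relIndex M := by
    have h1 : M ⊔ squaresOf F = M ⊔ squaresOf H := by
      rw [hQH, ← sup_assoc, sup_eq_left.2 (squaresOf_le M)]
    have h2 : squaresOf F ⊓ M = ⊥ := by
      rw [eq_bot_iff]
      rintro x ⟨⟨y, hy, hyx⟩, hx2⟩
      have hyx : y ^ 2 = x := hyx
      have hyE := (hmemF y).1 hy
      have hxM := (hmemM x).1 hx2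
      have : x ^ 2 = 1 := by
        have hx := hxM.2
        rwa [← hyx, map_pow, hyE.2, hyx, ← sq] at hx
      rcases htors x hxM.1 this with rfl | rfl
      · exact one_mem _
      · exact absurd hyx (hmsq y hyE.1)
    rw [h1, Subgroup.relIndex_sup_right, ← Subgroup.inf_relIndex_right, hQH,
      sup_inf_assoc_of_le _ (squaresOf_le M), h2, sup_bot_eq]
  have e6 := Subgroup.relIndex_mul_relIndex (squaresOf H) (M ⊔ squaresOf F) H
    (by rw [hQH]; exact sup_le_sup_right (squaresOf_le M) _)
    (sup_le_sup_left (squaresOf_le F) _)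
  rw [e5, e3, ← e2] at e6
  have hpos : 0 < i * (M ⊔ squaresOf F).relIndex H := by
    refine Nat.mul_pos (Nat.pos_of_ne_zero hi0) (Nat.pos_of_ne_zero fun h0 => ?_)
    rw [h0] at e4
    exact hq e4
  refine Nat.eq_of_mul_eq_mul_right hpos ?_
  calc _ = q ^ 2 := by rw [← e6]; ring
    _ = q * q := sq q
    _ = (i * (E.map (sigmaNorm σ)).relIndex F) * (2 * (M ⊔ squaresOf F).relIndex H) := by
      rw [e1, ← e4]
    _ = _ := by ring

end unitIndex

section totallyRealUnits

open NumberField NumberField.Units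

variable (K : Type*) [Field K] [NumberField K] [IsTotallyReal K]

lemma exists_real_embedding : Nonempty (K →+* ℝ) :=
  ⟨InfinitePlace.embedding_of_isReal (IsTotallyReal.isReal (Classical.arbitrary (InfinitePlace K)))⟩

variable {K} in
lemma sq_ne_neg_one (x : K) : x ^ 2 ≠ -1 := by
  obtain ⟨φ⟩ := exists_real_embedding K
  intro h
  have h1 : φ x ^ 2 = -1 := by rw [← map_pow, h, map_neg, map_one]
  nlinarith [sq_nonneg (φ x)]

lemma torsion_eq_of_isTotallyReal (x : (𝓞 K)ˣ) (hx : x ∈ torsion K) : x = 1 ∨ x = -1 := by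
  by_cases! hc : 2 < orderOf x
  · have e : orderOf (x : K) = orderOf x := by
      rw [← orderOf_units]
      exact orderOf_injective (algebraMap (𝓞 K) K : 𝓞 K →* K) RingOfIntegers.coe_injective _
    rw [← e] at hc
    have h1 := NumberField.InfinitePlace.IsPrimitiveRoot.nrRealPlaces_eq_zero_of_two_lt hc
      (IsPrimitiveRoot.orderOf (x : K))
    have h2 := IsTotallyReal.finrank (K := K)
    have h3 := Module.finrank_pos (R := ℚ) (M := K)
    omega
  · interval_cases hi : orderOf x
    · linarith [orderOf_pos_iff.2 ((CommGroup.mem_torsion x).1 hx)]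
    · exact Or.intro_left _ (orderOf_eq_one_iff.1 hi)
    · rw [← orderOf_units, CharP.orderOf_eq_two_iff 0 (by decide)] at hi
      simp [← Units.val_inj, Units.val_neg, Units.val_one, hi]

omit [NumberField K] [IsTotallyReal K] in
lemma neg_one_mem_torsion' : (-1 : (𝓞 K)ˣ) ∈ torsion K := by
  rw [torsion, CommGroup.mem_torsion, isOfFinOrder_iff_pow_eq_one]
  exact ⟨2, by norm_num, by simp⟩

/-- The index of the subgroup of squares in the unit group of a totally real field. -/
theorem index_unit_squares :
    (powMonoidHom 2 : (𝓞 K)ˣ →* (𝓞 K)ˣ).range.index = 2 ^ Module.finrank ℚ K := by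
  set S := (powMonoidHom 2 : (𝓞 K)ˣ →* (𝓞 K)ˣ).range
  set T := torsion K with hT
  have hrank : rank K + 1 = Module.finrank ℚ K := by
    have h1 := IsTotallyReal.finrank (K := K)
    have h2 := Module.finrank_pos (R := ℚ) (M := K)
    have h3 := InfinitePlace.card_eq_nrRealPlaces_add_nrComplexPlaces K
    have h4 := IsTotallyReal.nrComplexPlaces_eq_zero K
    rw [rank]
    omega
  have h1 : (S ⊔ T).index = 2 ^ rank K := by
    have h2 := AddSubgroup.index_range_nsmul (Additive ((𝓞 K)ˣ ⧸ T)) 2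
    rw [finrank_modTorsion] at h2
    rw [← h2]
    have h3 : (S.map (QuotientGroup.mk' T)).index = (S ⊔ T).index := by
      rw [Subgroup.index_map, QuotientGroup.ker_mk', QuotientGroup.range_mk', Subgroup.index_top,
        mul_one]
    rw [← h3, ← Subgroup.index_toAddSubgroup]
    congr 1
    ext x
    constructor
    · rintro ⟨_, ⟨y, rfl⟩, rfl⟩
      exact ⟨Additive.ofMul (QuotientGroup.mk' T y), rfl⟩
    · rintro ⟨y, rfl⟩
      obtain ⟨z, hz⟩ := QuotientGroup.mk'_surjective T y.toMul
      refine ⟨_, ⟨z, rfl⟩, ?_⟩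
      rw [powMonoidHom_apply, map_pow, hz]
      rfl
  have h2 : S.relIndex (S ⊔ T) = 2 := by
    rw [Subgroup.relIndex_sup_left, ← Subgroup.inf_relIndex_right]
    have h3 : S ⊓ T = ⊥ := by
      rw [eq_bot_iff]
      rintro x ⟨⟨y, hy⟩, hx2⟩
      rcases torsion_eq_of_isTotallyReal K x hx2 with rfl | rfl
      · exact one_mem _
      · refine absurd ?_ (sq_ne_neg_one (y : K))
        rw [← Units.coe_pow, show y ^ 2 = -1 from hy]
        simp
    have h4 : T = Subgroup.zpowers (-1) := by
      apply le_antisymm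
      · intro x hx
        rcases torsion_eq_of_isTotallyReal K x hx with rfl | rfl
        · exact one_mem _
        · exact Subgroup.mem_zpowers _
      · rw [Subgroup.zpowers_le]
        exact neg_one_mem_torsion' K
    have h5 : (-1 : (𝓞 K)ˣ) ≠ 1 := by
      intro h
      have h6 := congrArg (fun u : (𝓞 K)ˣ => (u : K)) h
      simp only [coe_neg_one, coe_one] at h6
      norm_num at h6
    rw [h3, Subgroup.relIndex_bot_left, h4, Nat.card_zpowers, orderOf_eq_prime (p := 2) neg_one_sq h5]
  rw [← Subgroup.relIndex_mul_index (le_sup_left : S ≤ S ⊔ T), h1, h2, ← hrank, pow_succ']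

end totallyRealUnits

section QuadraticClassGroup

open NumberField nonZeroDivisors FractionalIdeal IsDedekindDomain

set_option linter.unusedSectionVars false

/-- `K = k(d)` is a quadratic extension with `d² = δ` and `τ` is the nontrivial automorphism. -/
structure IsQuadExt {k K : Type*} [Field k] [Field K] [Algebra k K] (δ : 𝓞 k) (d : K)
    (τ : K ≃ₐ[k] K) : Prop where
  sq_eq : d ^ 2 = algebraMap k K δ
  ne : d ≠ 0
  conj : τ d = -d
  rep : ∀ x : K, ∃ a b : k, x = algebraMap k K a + algebraMap k K b * d

namespace IsQuadExt

section Field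

variable {k K : Type*} [Field k] [Field K] [Algebra k K] {δ : 𝓞 k} {d : K} {τ : K ≃ₐ[k] K}

lemma conj_rep (h : IsQuadExt δ d τ) (a b : k) :
    τ (algebraMap k K a + algebraMap k K b * d) = algebraMap k K a - algebraMap k K b * d := by
  simp [h.conj, sub_eq_add_neg]

lemma conj_conj (h : IsQuadExt δ d τ) (x : K) : τ (τ x) = x := by
  obtain ⟨a, b, rfl⟩ := h.rep x
  simp [h.conj]

lemma eq_algebraMap_of_conj_eq [CharZero K] (h : IsQuadExt δ d τ) {x : K} (hx : τ x = x) :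
    ∃ a : k, algebraMap k K a = x := by
  obtain ⟨a, b, rfl⟩ := h.rep x
  rw [h.conj_rep] at hx
  have : algebraMap k K b * d = 0 := by
    have h2 : 2 * (algebraMap k K b * d) = 0 := by linear_combination -hx
    simpa using h2
  exact ⟨a, by rw [this, add_zero]⟩

lemma norm_rep (h : IsQuadExt δ d τ) (a b : k) :
    (algebraMap k K a + algebraMap k K b * d) * τ (algebraMap k K a + algebraMap k K b * d) =
      algebraMap k K (a ^ 2 - δ * b ^ 2) := by
  rw [h.conj_rep]
  simp only [map_sub, map_mul, map_pow]
  rw [← h.sq_eq]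
  ring

end Field

section Integers

variable {k K : Type*} [Field k] [NumberField k] [Field K] [NumberField K] [Algebra k K]
  {δ : 𝓞 k} {d : K} {τ : K ≃ₐ[k] K}

/-- The restriction of an automorphism to the ring of integers. -/
noncomputable abbrev conjInt (τ : K ≃ₐ[k] K) : 𝓞 K →+* 𝓞 K :=
  RingOfIntegers.mapRingHom (τ : K →+* K)

lemma conjInt_conjInt (h : IsQuadExt δ d τ) (x : 𝓞 K) : conjInt τ (conjInt τ x) = x := by
  ext
  exact h.conj_conj x

lemma conjInt_comp (h : IsQuadExt δ d τ) : (conjInt τ).comp (conjInt τ) = RingHom.id _ :=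
  RingHom.ext h.conjInt_conjInt

lemma conjInt_algebraMap (a : 𝓞 k) :
    conjInt τ (algebraMap (𝓞 k) (𝓞 K) a) = algebraMap (𝓞 k) (𝓞 K) a := by
  ext
  exact τ.commutes a

lemma conjInt_comp_algebraMap :
    (conjInt τ).comp (algebraMap (𝓞 k) (𝓞 K)) = algebraMap (𝓞 k) (𝓞 K) :=
  RingHom.ext conjInt_algebraMap

lemma exists_int_of_coe_eq {a : k} {x : 𝓞 K} (hx : algebraMap k K a = x) :
    ∃ b : 𝓞 k, algebraMap (𝓞 k) (𝓞 K) b = x ∧ (b : k) = a := by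
  have ha : IsIntegral ℤ a := by
    have : IsIntegral ℤ (x : K) := RingOfIntegers.isIntegral_coe x
    rw [← hx] at this
    exact (isIntegral_algebraMap_iff (algebraMap k K).injective).1 this
  refine ⟨⟨a, ha⟩, ?_, rfl⟩
  ext
  exact hx

lemma exists_int_of_conjInt_eq (h : IsQuadExt δ d τ) {x : 𝓞 K} (hx : conjInt τ x = x) :
    ∃ b : 𝓞 k, algebraMap (𝓞 k) (𝓞 K) b = x := by
  obtain ⟨a, ha⟩ := h.eq_algebraMap_of_conj_eq (x := (x : K)) (congrArg (algebraMap (𝓞 K) K) hx)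
  obtain ⟨b, hb, -⟩ := exists_int_of_coe_eq ha
  exact ⟨b, hb⟩

lemma map_map_conjInt (h : IsQuadExt δ d τ) (J : Ideal (𝓞 K)) :
    (J.map (conjInt τ)).map (conjInt τ) = J := by
  rw [Ideal.map_map, h.conjInt_comp, Ideal.map_id]

lemma map_conjInt_map (a : Ideal (𝓞 k)) :
    (a.map (algebraMap (𝓞 k) (𝓞 K))).map (conjInt τ) = a.map (algebraMap (𝓞 k) (𝓞 K)) := by
  rw [Ideal.map_map, conjInt_comp_algebraMap]

lemma conjInt_mem_map (h : IsQuadExt δ d τ) {J : Ideal (𝓞 K)} {x : 𝓞 K}  :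
    conjInt τ x ∈ J.map (conjInt τ) ↔ x ∈ J := by
  refine ⟨fun hx => ?_, Ideal.mem_map_of_mem _⟩
  have := Ideal.mem_map_of_mem (conjInt τ) hx
  rwa [h.map_map_conjInt, h.conjInt_conjInt] at this

lemma mem_map_conjInt (h : IsQuadExt δ d τ) {J : Ideal (𝓞 K)} {x : 𝓞 K}  :
    x ∈ J.map (conjInt τ) ↔ conjInt τ x ∈ J := by
  rw [← h.conjInt_mem_map (x := conjInt τ x), h.conjInt_conjInt]

lemma map_conjInt_ne_bot (h : IsQuadExt δ d τ) {J : Ideal (𝓞 K)} (hJ : J ≠ ⊥) :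
    J.map (conjInt τ) ≠ ⊥ := by
  intro hb
  apply hJ
  rw [← h.map_map_conjInt J, hb, Ideal.map_bot]

/-- An element which is integral over an ideal of a Dedekind domain, of degree two, belongs
to it. -/
lemma mem_of_sq_mem {R : Type*} [CommRing R] [IsDedekindDomain R] {B : Ideal R}
    (hB : B ≠ ⊥) {z t n : R} (ht : t ∈ B) (hn : n ∈ B ^ 2) (hz : z ^ 2 = t * z - n) : z ∈ B := by
  set Z := Ideal.span {z}
  have hzZ : z ∈ Z := Ideal.mem_span_singleton_self z
  have hC : (Z ⊔ B) * (Z ⊔ B) = B * (Z ⊔ B) := by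
    rw [Ideal.sup_mul]
    refine sup_eq_right.2 ?_
    rw [Ideal.mul_sup]
    refine sup_le ?_ ?_
    · rw [Ideal.span_singleton_mul_span_singleton, Ideal.span_singleton_le_iff_mem, ← sq, hz]
      refine sub_mem (Ideal.mul_mem_mul ht (Ideal.mem_sup_left hzZ)) ?_
      rw [sq] at hn
      exact Ideal.mul_mono_right le_sup_right hn
    · rw [mul_comm]
      exact Ideal.mul_mono_right le_sup_left
  have hne : Z ⊔ B ≠ ⊥ := fun h0 => hB (le_bot_iff.1 (h0 ▸ le_sup_right))
  have := mul_right_cancel₀ hne hC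
  exact this ▸ Ideal.mem_sup_left hzZ

/-- The product of an ideal with its conjugate is extended from the base. -/
lemma map_comap_mul_conj (h : IsQuadExt δ d τ) {J : Ideal (𝓞 K)} (hJ : J ≠ ⊥) :
    ((J * J.map (conjInt τ)).comap (algebraMap (𝓞 k) (𝓞 K))).map (algebraMap (𝓞 k) (𝓞 K)) =
      J * J.map (conjInt τ) := by
  set A := algebraMap (𝓞 k) (𝓞 K)
  set N := J * J.map (conjInt τ)
  refine le_antisymm Ideal.map_comap_le ?_
  set B := (N.comap A).map A
  have hmem : ∀ {x y : 𝓞 K}, x ∈ J → y ∈ J → x * conjInt τ y ∈ N := fun hx hy =>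
    Ideal.mul_mem_mul hx (Ideal.mem_map_of_mem _ hy)
  have hfix : ∀ {x : 𝓞 K}, x ∈ N → conjInt τ x = x → x ∈ B := by
    intro x hx hx'
    obtain ⟨b, rfl⟩ := h.exists_int_of_conjInt_eq hx'
    exact Ideal.mem_map_of_mem A hx
  have hnorm : ∀ {x : 𝓞 K}, x ∈ J → x * conjInt τ x ∈ B := fun {x} hx =>
    hfix (hmem hx hx) (by rw [map_mul, h.conjInt_conjInt, mul_comm])
  have hB : B ≠ ⊥ := by
    obtain ⟨x, hx, hx0⟩ := Submodule.exists_mem_ne_zero_of_ne_bot hJ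
    intro hb
    have h1 := hnorm hx
    rw [hb, Ideal.mem_bot, mul_eq_zero] at h1
    rcases h1 with h1 | h1
    · exact hx0 h1
    · apply hx0
      rw [← h.conjInt_conjInt x, h1, map_zero]
  refine Ideal.mul_le.2 fun x hx y hy => ?_
  rw [h.mem_map_conjInt] at hy
  obtain ⟨y, rfl⟩ : ∃ z, y = conjInt τ z := ⟨_, (h.conjInt_conjInt y).symm⟩
  rw [h.conjInt_conjInt] at hy
  refine mem_of_sq_mem hB (t := x * conjInt τ y + y * conjInt τ x)
    (n := (x * conjInt τ x) * (y * conjInt τ y)) (hfix (add_mem (hmem hx hy) (hmem hy hx)) ?_) ?_ ?_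
  · simp only [map_add, map_mul, h.conjInt_conjInt]; ring
  · rw [sq]; exact Ideal.mul_mem_mul (hnorm hx) (hnorm hy)
  · ring

end Integers

end IsQuadExt

namespace IsQuadExt

/-- The invertible fractional ideals of a number field. -/
abbrev FracIdeals (K : Type*) [Field K] [NumberField K] := (FractionalIdeal (𝓞 K)⁰ K)ˣ

section

variable {K : Type*} [Field K] [NumberField K]

/-- A nonzero integral ideal as an invertible fractional ideal. -/
noncomputable def ofIdeal (J : Ideal (𝓞 K)) (hJ : J ≠ ⊥) : FracIdeals K :=
  FractionalIdeal.mk0 K ⟨J, mem_nonZeroDivisors_iff_ne_zero.2 hJ⟩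

@[simp] lemma coe_ofIdeal (J : Ideal (𝓞 K)) (hJ : J ≠ ⊥) :
    ((ofIdeal J hJ : FracIdeals K) : FractionalIdeal (𝓞 K)⁰ K) = J := rfl

lemma ofIdeal_mul (J J' : Ideal (𝓞 K)) (hJ : J ≠ ⊥) (hJ' : J' ≠ ⊥) :
    ofIdeal (J * J') (mul_ne_zero hJ hJ') = ofIdeal J hJ * ofIdeal J' hJ' := by
  ext1
  simp [coeIdeal_mul]

lemma exists_eq_ofIdeal_mul (I : FracIdeals K) :
    ∃ (J : Ideal (𝓞 K)) (hJ : J ≠ ⊥) (x : Kˣ), I = ofIdeal J hJ * toPrincipalIdeal (𝓞 K) K x := by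
  obtain ⟨a, J, ha, hI⟩ := FractionalIdeal.exists_eq_spanSingleton_mul (I : FractionalIdeal (𝓞 K)⁰ K)
  have hJ : J ≠ ⊥ := by
    rintro rfl
    apply I.ne_zero
    rw [hI]
    simp
  have ha' : algebraMap (𝓞 K) K a ≠ 0 := by simpa using ha
  refine ⟨J, hJ, (Units.mk0 _ ha')⁻¹, ?_⟩
  ext1
  rw [hI, mul_comm]
  simp

end

variable {k K : Type*} [Field k] [NumberField k] [Field K] [NumberField K] [Algebra k K]
  {δ : 𝓞 k} {d : K} {τ : K ≃ₐ[k] K}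

lemma conjInt_injective (τ : K ≃ₐ[k] K) : Function.Injective (conjInt τ) := by
  intro x y hxy
  ext
  exact τ.injective (congrArg (algebraMap (𝓞 K) K) hxy)

/-- The action of an automorphism on fractional ideals. -/
noncomputable def conjFracHom (τ : K ≃ₐ[k] K) :
    FractionalIdeal (𝓞 K)⁰ K →+* FractionalIdeal (𝓞 K)⁰ K :=
  extendedHom' K (f := conjInt τ)
    (nonZeroDivisors_le_comap_nonZeroDivisors_of_injective _ (conjInt_injective τ))

/-- The action of an automorphism on invertible fractional ideals. -/
noncomputable def conjFrac (τ : K ≃ₐ[k] K) : FracIdeals K →* FracIdeals K :=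
  Units.map (conjFracHom τ).toMonoidHom

variable (k K) in
/-- The extension of fractional ideals. -/
noncomputable def extFracHom : FractionalIdeal (𝓞 k)⁰ k →+* FractionalIdeal (𝓞 K)⁰ K :=
  extendedHom K (𝓞 K)

variable (k K) in
/-- The extension of invertible fractional ideals. -/
noncomputable def extFrac : FracIdeals k →* FracIdeals K :=
  Units.map (extFracHom k K).toMonoidHom

lemma map_ne_bot {a : Ideal (𝓞 k)} (ha : a ≠ ⊥) : a.map (algebraMap (𝓞 k) (𝓞 K)) ≠ ⊥ := by
  rwa [ne_eq, Ideal.map_eq_bot_iff_of_injective (FaithfulSMul.algebraMap_injective _ _)]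

lemma extFrac_ofIdeal (a : Ideal (𝓞 k)) (ha : a ≠ ⊥) :
    extFrac k K (ofIdeal a ha) = ofIdeal (a.map (algebraMap (𝓞 k) (𝓞 K))) (map_ne_bot ha) := by
  ext1
  exact extendedHom_coeIdeal_eq_map K (𝓞 K) a

lemma extFrac_toPrincipalIdeal (x : kˣ) :
    extFrac k K (toPrincipalIdeal (𝓞 k) k x) =
      toPrincipalIdeal (𝓞 K) K (Units.map (algebraMap k K : k →* K) x) := by
  ext1
  rw [extFrac, Units.coe_map, coe_toPrincipalIdeal, coe_toPrincipalIdeal]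
  refine (extendedHom_spanSingleton K (𝓞 K) (x : k)).trans ?_
  congr 1
  obtain ⟨a, b, hb, hx⟩ := IsFractionRing.div_surjective (A := 𝓞 k) (x : k)
  rw [← hx]
  simp only [map_div₀, IsFractionRing.map, IsLocalization.map_eq, Units.coe_map, MonoidHom.coe_coe,
    ← hx]
  rfl

lemma conjFrac_ofIdeal (h : IsQuadExt δ d τ) (J : Ideal (𝓞 K)) (hJ : J ≠ ⊥) :
    conjFrac τ (ofIdeal J hJ) = ofIdeal (J.map (conjInt τ)) (h.map_conjInt_ne_bot hJ) := by
  ext1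
  exact extended_coeIdeal_eq_map K _ J

lemma conjFrac_toPrincipalIdeal (x : Kˣ) :
    conjFrac τ (toPrincipalIdeal (𝓞 K) K x) =
      toPrincipalIdeal (𝓞 K) K (Units.map (τ : K →* K) x) := by
  ext1
  rw [conjFrac, Units.coe_map, coe_toPrincipalIdeal, coe_toPrincipalIdeal]
  refine (extended_spanSingleton K _ (x : K)).trans ?_
  congr 1
  obtain ⟨a, b, hb, hx⟩ := IsFractionRing.div_surjective (A := 𝓞 K) (x : K)
  rw [← hx]
  simp only [map_div₀, IsLocalization.map_eq, Units.coe_map, MonoidHom.coe_coe, ← hx]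
  rfl

lemma conjFrac_conjFrac (h : IsQuadExt δ d τ) (I : FracIdeals K) :
    conjFrac τ (conjFrac τ I) = I := by
  obtain ⟨J, hJ, x, rfl⟩ := exists_eq_ofIdeal_mul I
  simp only [map_mul, h.conjFrac_ofIdeal, conjFrac_toPrincipalIdeal]
  congr 1
  · ext1; simp [h.map_map_conjInt]
  · congr 1; ext1; exact h.conj_conj x

lemma conjFrac_extFrac (h : IsQuadExt δ d τ) (I : FracIdeals k) :
    conjFrac τ (extFrac k K I) = extFrac k K I := by
  obtain ⟨J, hJ, x, rfl⟩ := exists_eq_ofIdeal_mul I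
  simp only [map_mul, extFrac_ofIdeal, extFrac_toPrincipalIdeal, h.conjFrac_ofIdeal,
    conjFrac_toPrincipalIdeal]
  congr 1
  · ext1; simp [map_conjInt_map]
  · congr 1; ext1; simp

lemma mul_conjFrac_mem_range (h : IsQuadExt δ d τ) (I : FracIdeals K) :
    I * conjFrac τ I ∈ (extFrac k K).range := by
  obtain ⟨J, hJ, x, rfl⟩ := exists_eq_ofIdeal_mul I
  rw [map_mul, mul_mul_mul_comm]
  refine mul_mem ?_ ?_
  · have hb : (J * J.map (conjInt τ)).comap (algebraMap (𝓞 k) (𝓞 K)) ≠ ⊥ := by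
      intro hb
      have := h.map_comap_mul_conj hJ
      rw [hb, Ideal.map_bot] at this
      exact mul_ne_zero hJ (h.map_conjInt_ne_bot hJ) this.symm
    refine ⟨ofIdeal _ hb, ?_⟩
    rw [extFrac_ofIdeal, h.conjFrac_ofIdeal, ← ofIdeal_mul]
    congr 1
    exact h.map_comap_mul_conj hJ
  · have hx : τ ((x : K) * τ x) = x * τ x := by rw [map_mul, h.conj_conj, mul_comm]
    obtain ⟨a, ha⟩ := h.eq_algebraMap_of_conj_eq hx
    have ha0 : a ≠ 0 := by
      rintro rfl
      rw [map_zero] at ha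
      simpa using ha.symm
    refine ⟨toPrincipalIdeal _ _ (Units.mk0 a ha0), ?_⟩
    rw [extFrac_toPrincipalIdeal, conjFrac_toPrincipalIdeal, ← map_mul]
    congr 1
    ext1
    exact ha

lemma hilbert90 (h : IsQuadExt δ d τ) (x : Kˣ) (hx : x * Units.map (τ : K →* K) x = 1) :
    ∃ y : Kˣ, x = y / Units.map (τ : K →* K) y := by
  have hx' : (x : K) * τ x = 1 := congrArg Units.val hx
  by_cases h1 : (1 : K) + x = 0
  · refine ⟨Units.mk0 d h.ne, ?_⟩
    ext1
    have : τ d ≠ 0 := by simpa using h.ne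
    simp only [Units.val_div_eq_div_val, Units.val_mk0, Units.coe_map, MonoidHom.coe_coe]
    rw [eq_div_iff this]
    change (x : K) * τ d = d
    rw [h.conj]
    linear_combination (-d) * h1
  · refine ⟨Units.mk0 _ h1, ?_⟩
    ext1
    have : τ (1 + x) ≠ 0 := (map_ne_zero τ).2 h1
    simp only [Units.val_div_eq_div_val, Units.val_mk0, Units.coe_map, MonoidHom.coe_coe]
    rw [eq_div_iff this]
    change (x : K) * τ (1 + x) = 1 + x
    rw [map_add, map_one]
    linear_combination hx'

lemma hilbert90_ideal (x : Kˣ)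
    (hx : toPrincipalIdeal (𝓞 K) K x * conjFrac τ (toPrincipalIdeal (𝓞 K) K x) = 1) :
    ∃ J : FracIdeals K, toPrincipalIdeal (𝓞 K) K x = J / conjFrac τ J := by
  set X : FractionalIdeal (𝓞 K)⁰ K := (toPrincipalIdeal (𝓞 K) K x).val with hX
  set e := conjFracHom τ with he
  have h1 : X * e X = 1 := congrArg Units.val hx
  have hne : (1 : FractionalIdeal (𝓞 K)⁰ K) + X ≠ 0 := by
    intro h0
    have : (1 : FractionalIdeal (𝓞 K)⁰ K) ≤ 0 := by
      rw [← h0, ← sup_eq_add]; exact le_sup_left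
    exact one_ne_zero (le_antisymm this (FractionalIdeal.zero_le _))
  refine ⟨Units.mk0 _ hne, eq_div_of_mul_eq' ?_⟩
  ext1
  rw [Units.val_mul, ← hX]
  change X * e (1 + X) = 1 + X
  rw [map_add, map_one, mul_add, h1, mul_one, add_comm]

end IsQuadExt

/-- The data needed to describe the ramification of a quadratic extension `k(√δ)/k`: the ideal
`(δ)` is the product of the distinct primes `𝔭 i`, and at the primes above `2` either `δ` is
divisible by `2` or `δ` is congruent to `1` modulo `4`. -/
structure RamData {k : Type*} [Field k] [NumberField k] (δ : 𝓞 k) {ι : Type*} [Fintype ι]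
    (𝔭 : ι → Ideal (𝓞 k)) : Prop where
  ne_zero : δ ≠ 0
  prime : ∀ i, (𝔭 i).IsPrime
  inj : Function.Injective 𝔭
  prod_eq : Ideal.span {δ} = ∏ i, 𝔭 i
  two : (∃ c : 𝓞 k, δ = 1 + 4 * c) ∨ 2 ∣ δ

namespace RamData

variable {k : Type*} [Field k] [NumberField k] {δ : 𝓞 k} {ι : Type*} [Fintype ι]
  {𝔭 : ι → Ideal (𝓞 k)}

lemma mem (h : RamData δ 𝔭) (i : ι) : δ ∈ 𝔭 i := by
  have : δ ∈ ∏ i, 𝔭 i := h.prod_eq ▸ Ideal.mem_span_singleton_self δ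
  exact Ideal.prod_le_inf.trans (Finset.inf_le (Finset.mem_univ i)) this

lemma ne_bot (h : RamData δ 𝔭) (i : ι) : 𝔭 i ≠ ⊥ := by
  intro hb
  have := h.mem i
  rw [hb] at this
  exact h.ne_zero this

lemma isMaximal (h : RamData δ 𝔭) (i : ι) : (𝔭 i).IsMaximal :=
  (h.prime i).isMaximal (h.ne_bot i)

lemma exists_eq (h : RamData δ 𝔭) {Q : Ideal (𝓞 k)} (hQ : Q.IsPrime) (hδ : δ ∈ Q) :
    ∃ i, 𝔭 i = Q := by
  have : ∏ i, 𝔭 i ≤ Q := by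
    rw [← h.prod_eq, Ideal.span_singleton_le_iff_mem]; exact hδ
  obtain ⟨i, -, hi⟩ := (hQ.prod_le).1 this
  exact ⟨i, (h.isMaximal i).eq_of_le hQ.ne_top hi⟩

lemma exists_cofactor (h : RamData δ 𝔭) (i : ι) :
    ∃ c : Ideal (𝓞 k), Ideal.span {δ} = 𝔭 i * c ∧ 𝔭 i ⊔ c = ⊤ := by
  classical
  refine ⟨∏ j ∈ Finset.univ.erase i, 𝔭 j, ?_, ?_⟩
  · rw [h.prod_eq, Finset.mul_prod_erase _ _ (Finset.mem_univ i)]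
  · by_contra hne
    have hle : ∏ j ∈ Finset.univ.erase i, 𝔭 j ≤ 𝔭 i := by
      have := (h.isMaximal i).eq_of_le hne le_sup_left
      exact this ▸ le_sup_right
    obtain ⟨j, hj, hji⟩ := ((h.prime i).prod_le).1 hle
    exact Finset.ne_of_mem_erase hj (h.inj ((h.isMaximal j).eq_of_le (h.prime i).ne_top hji))

end RamData

namespace IsQuadExt

variable {k K : Type*} [Field k] [NumberField k] [Field K] [NumberField K] [Algebra k K]
  {δ : 𝓞 k} {d : K} {τ : K ≃ₐ[k] K} {ι : Type*} [Fintype ι]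
  {𝔭 : ι → Ideal (𝓞 k)}

lemma map_le_iff_comap {a : Ideal (𝓞 k)} {J : Ideal (𝓞 K)} :
    J ∣ a.map (algebraMap (𝓞 k) (𝓞 K)) ↔ a ≤ J.comap (algebraMap (𝓞 k) (𝓞 K)) := by
  rw [Ideal.dvd_iff_le, Ideal.map_le_iff_le_comap]

lemma exists_sqrt_int (h : IsQuadExt δ d τ) :
    ∃ D : 𝓞 K, (D : K) = d ∧ D ^ 2 = algebraMap (𝓞 k) (𝓞 K) δ ∧ conjInt τ D = -D := by
  have hd : IsIntegral ℤ d := by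
    refine IsIntegral.of_pow (n := 2) (by norm_num) ?_
    rw [h.sq_eq]
    exact (RingOfIntegers.isIntegral_coe δ).map (algebraMap k K : k →+* K).toIntAlgHom
  refine ⟨⟨d, hd⟩, rfl, ?_, ?_⟩
  · ext; exact h.sq_eq
  · ext; exact h.conj

lemma map_comap_dvd (h : IsQuadExt δ d τ) {P : Ideal (𝓞 K)} (hP : P ≠ ⊥) :
    (P.comap (algebraMap (𝓞 k) (𝓞 K))).map (algebraMap (𝓞 k) (𝓞 K)) ∣
      P * P.map (conjInt τ) := by
  rw [Ideal.dvd_iff_le, ← h.map_comap_mul_conj hP]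
  exact Ideal.map_mono (Ideal.comap_mono Ideal.mul_le_left)

lemma isPrime_map_conj (h : IsQuadExt δ d τ) {P : Ideal (𝓞 K)} (hP : P.IsPrime) :
    (P.map (conjInt τ)).IsPrime := by
  refine ⟨?_, ?_⟩
  · rw [Ideal.ne_top_iff_one, h.mem_map_conjInt, map_one, ← Ideal.ne_top_iff_one]
    exact hP.ne_top
  · intro x y
    simp only [h.mem_map_conjInt, map_mul]
    exact fun h => hP.mem_or_mem h

lemma sub_conj_mem (h : IsQuadExt δ d τ) {P : Ideal (𝓞 K)} (hP0 : P ≠ ⊥)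
    (hτ : P.map (conjInt τ) = P)
    (hsq : P ^ 2 ∣ (P.comap (algebraMap (𝓞 k) (𝓞 K))).map (algebraMap (𝓞 k) (𝓞 K))) (x : 𝓞 K) :
    x - conjInt τ x ∈ P := by
  have hconj : ∀ {y}, y ∈ P → conjInt τ y ∈ P := fun hy => by
    rw [← h.mem_map_conjInt, hτ]; exact hy
  have htr : ∀ {y}, y ∈ P → y + conjInt τ y ∈ P ^ 2 := fun {y} hy => by
    obtain ⟨b, hb⟩ := h.exists_int_of_conjInt_eq (x := y + conjInt τ y)
      (by rw [map_add, h.conjInt_conjInt, add_comm])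
    refine Ideal.dvd_iff_le.1 hsq ?_
    rw [← hb]
    refine Ideal.mem_map_of_mem _ ?_
    rw [Ideal.mem_comap, hb]
    exact add_mem hy (hconj hy)
  have hle : P * Ideal.span {x - conjInt τ x} ≤ P * P := by
    rw [Ideal.mul_le]
    intro y hy z hz
    obtain ⟨w, rfl⟩ := Ideal.mem_span_singleton'.1 hz
    have h1 := htr (Ideal.mul_mem_right x P hy)
    have h2 := Ideal.mul_mem_right (conjInt τ x) _ (htr hy)
    have h3 := Ideal.mul_mem_left _ w (sub_mem h1 h2)
    rw [sq, map_mul] at h3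
    convert h3 using 1
    ring
  rw [← Ideal.dvd_iff_le] at hle
  have := (mul_dvd_mul_iff_left hP0).1 hle
  rwa [Ideal.dvd_iff_le, Ideal.span_singleton_le_iff_mem] at this

lemma not_sq_dvd (h : IsQuadExt δ d τ) (h2 : (∃ c : 𝓞 k, δ = 1 + 4 * c) ∨ 2 ∣ δ)
    {P : Ideal (𝓞 K)} (hP : P.IsPrime) (hP0 : P ≠ ⊥) (hδ : algebraMap (𝓞 k) (𝓞 K) δ ∉ P) :
    ¬ P ^ 2 ∣ (P.comap (algebraMap (𝓞 k) (𝓞 K))).map (algebraMap (𝓞 k) (𝓞 K)) := by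
  intro hsq
  have hPc : P.map (conjInt τ) = P := by
    have h1 : P * P ∣ P * P.map (conjInt τ) := sq P ▸ hsq.trans (h.map_comap_dvd hP0)
    have h2 := Ideal.dvd_iff_le.1 ((mul_dvd_mul_iff_left hP0).1 h1)
    exact ((h.isPrime_map_conj hP).isMaximal (h.map_conjInt_ne_bot hP0)).eq_of_le hP.ne_top h2
  have hmem := h.sub_conj_mem hP0 hPc hsq
  obtain ⟨D, hD, hD2, hDc⟩ := h.exists_sqrt_int
  have hDP : D ∉ P := fun hDP => hδ (hD2 ▸ Ideal.pow_mem_of_mem P hDP 2 (by norm_num))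
  rcases h2 with ⟨c, hc⟩ | ⟨c, hc⟩
  · have hx : IsIntegral ℤ (((1 : K) + d) / 2) := by
      have hc' : IsIntegral ℤ (algebraMap k K c) :=
        (RingOfIntegers.isIntegral_coe c).map (algebraMap k K : k →+* K).toIntAlgHom
      refine isIntegral_trans (R := ℤ) (A := 𝓞 K) _ ?_
      refine ⟨Polynomial.X ^ 2 + (-Polynomial.X - Polynomial.C (algebraMap (𝓞 k) (𝓞 K) c)), ?_, ?_⟩
      · refine Polynomial.monic_X_pow_add ?_
        refine lt_of_le_of_lt (Polynomial.degree_sub_le _ _) (max_lt ?_ ?_)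
        · rw [Polynomial.degree_neg, Polynomial.degree_X]; norm_num
        · exact Polynomial.degree_C_le.trans_lt (by norm_num)
      · have h3 : d ^ 2 = 1 + 4 * algebraMap k K c := by
          rw [h.sq_eq, hc]
          simp [map_ofNat (algebraMap (𝓞 k) k), map_ofNat (algebraMap k K)]
        have h4 : (algebraMap (𝓞 K) K) (algebraMap (𝓞 k) (𝓞 K) c) = algebraMap k K c := rfl
        simp only [Polynomial.eval₂_add, Polynomial.eval₂_pow, Polynomial.eval₂_X,
          Polynomial.eval₂_sub, Polynomial.eval₂_neg, Polynomial.eval₂_C]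
        rw [h4]
        linear_combination h3 / 4
    have h5 := hmem ⟨_, hx⟩
    apply hDP
    convert h5 using 1
    ext
    change (D : K) = (1 + d) / 2 - τ ((1 + d) / 2)
    rw [hD, map_div₀, map_add, map_one, h.conj, map_ofNat]
    ring
  · have h5 := hmem D
    rw [hDc, sub_neg_eq_add, ← two_mul] at h5
    rcases hP.mem_or_mem h5 with h6 | h6
    · apply hδ
      rw [hc, map_mul, map_ofNat]
      exact Ideal.mul_mem_right _ _ h6
    · exact hDP h6

lemma map_comap_dvd_of_conj (h : IsQuadExt δ d τ)
    (h2 : (∃ c : 𝓞 k, δ = 1 + 4 * c) ∨ 2 ∣ δ)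
    {P : Ideal (𝓞 K)} (hP : P.IsPrime) (hP0 : P ≠ ⊥) (hδ : algebraMap (𝓞 k) (𝓞 K) δ ∉ P)
    {J : Ideal (𝓞 K)} (hJ : J.map (conjInt τ) = J) (hPJ : P ∣ J) :
    (P.comap (algebraMap (𝓞 k) (𝓞 K))).map (algebraMap (𝓞 k) (𝓞 K)) ∣ J := by
  have hPp : Prime P := Ideal.prime_of_isPrime hP0 hP
  by_cases hc : P.map (conjInt τ) = P
  · have h1 := h.map_comap_dvd hP0
    rw [hc, ← sq] at h1
    obtain ⟨i, hi, ha⟩ := (dvd_prime_pow hPp 2).1 h1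
    rw [associated_iff_eq] at ha
    interval_cases i
    · exfalso
      rw [pow_zero, Ideal.one_eq_top] at ha
      exact hP.ne_top (top_le_iff.1 (ha ▸ Ideal.map_comap_le))
    · rw [ha, pow_one]; exact hPJ
    · exact absurd (dvd_of_eq ha.symm) (h.not_sq_dvd h2 hP hP0 hδ)
  · refine (h.map_comap_dvd hP0).trans ?_
    have hcp := h.isPrime_map_conj hP
    have hc0 := h.map_conjInt_ne_bot hP0
    obtain ⟨R, rfl⟩ := hPJ
    refine mul_dvd_mul_left P ?_
    have hd : P.map (conjInt τ) ∣ P * R := by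
      rw [← hJ, Ideal.map_mul]
      exact dvd_mul_right _ _
    refine ((Ideal.prime_of_isPrime hc0 hcp).dvd_or_dvd hd).resolve_left fun h3 => hc ?_
    exact ((hP.isMaximal hP0).eq_of_le hcp.ne_top (Ideal.dvd_iff_le.1 h3)).symm

lemma exists_ramified_prime (h : IsQuadExt δ d τ) (hr : RamData δ 𝔭) (i : ι) :
    ∃ P : Ideal (𝓞 K), P.IsPrime ∧ P ≠ ⊥ ∧ P.map (conjInt τ) = P ∧
      P ^ 2 = (𝔭 i).map (algebraMap (𝓞 k) (𝓞 K)) := by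
  set A := algebraMap (𝓞 k) (𝓞 K)
  obtain ⟨D, -, hD2, hDc⟩ := h.exists_sqrt_int
  obtain ⟨c, hc, hc1⟩ := hr.exists_cofactor i
  set P : Ideal (𝓞 K) := Ideal.span {D} ⊔ (𝔭 i).map A with hPdef
  have hP2 : P ^ 2 = (𝔭 i).map A := by
    have h1 : Ideal.span {D} * Ideal.span {D} = (𝔭 i).map A * c.map A := by
      rw [Ideal.span_singleton_mul_span_singleton, ← sq, hD2, ← Ideal.map_mul, ← hc,
        Ideal.map_span, Set.image_singleton]
    have h3 : (𝔭 i).map A ⊔ c.map A = ⊤ := by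
      rw [← Ideal.map_sup, hc1, Ideal.map_top]
    rw [sq, hPdef, Ideal.sup_mul, Ideal.mul_sup, Ideal.mul_sup, h1,
      mul_comm (Ideal.span {D}), ← Ideal.mul_sup, ← Ideal.mul_sup, ← Ideal.mul_sup]
    have : c.map A ⊔ Ideal.span {D} ⊔ (Ideal.span {D} ⊔ (𝔭 i).map A) = ⊤ := by
      rw [eq_top_iff, ← h3]
      exact sup_le (le_sup_right.trans le_sup_right) (le_sup_left.trans le_sup_left)
    rw [this, Ideal.mul_top]
  have hP0 : P ≠ ⊥ := by
    intro h0
    rw [h0] at hP2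
    refine map_ne_bot (K := K) (hr.ne_bot i) ?_
    rw [← hP2]; simp [sq]
  have hPc : P.map (conjInt τ) = P := by
    rw [hPdef, Ideal.map_sup, map_conjInt_map, Ideal.map_span, Set.image_singleton, hDc,
      Ideal.span_singleton_neg]
  have hPtop : P ≠ ⊤ := by
    intro h0
    rw [h0, sq, Ideal.mul_top] at hP2
    have h5 : extendedHom K (𝓞 K) (𝔭 i : FractionalIdeal (𝓞 k)⁰ k) = 1 := by
      rw [extendedHom_coeIdeal_eq_map, coeIdeal_eq_one, Ideal.one_eq_top]
      exact hP2.symm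
    rw [extendedHom_eq_one_iff _ _ (coeIdeal_ne_zero.2 (hr.ne_bot i)), coeIdeal_eq_one] at h5
    exact (hr.prime i).ne_top (h5.trans Ideal.one_eq_top)
  obtain ⟨Q, hQ, hPQ⟩ := Ideal.exists_le_maximal P hPtop
  have hQ0 : Q ≠ ⊥ := fun h0 => hP0 (le_bot_iff.1 (h0 ▸ hPQ))
  have hQc : Q.comap A = 𝔭 i := by
    refine ((hr.isMaximal i).eq_of_le ?_ ?_).symm
    · exact Ideal.comap_ne_top _ hQ.ne_top
    · rw [← Ideal.map_le_iff_le_comap]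
      exact le_sup_right.trans hPQ
  have hdvd := h.map_comap_dvd hQ0
  rw [hQc, ← hP2] at hdvd
  obtain ⟨R, hR⟩ := Ideal.dvd_iff_le.2 hPQ
  have hQp := h.isPrime_map_conj hQ.isPrime
  have hQp0 := h.map_conjInt_ne_bot hQ0
  have hR1 : IsUnit R := by
    by_contra hRu
    have h4 : Q * (Q * R * R) ∣ Q * Q.map (conjInt τ) := by
      refine dvd_trans (dvd_of_eq ?_) hdvd
      rw [hR]; ring
    have h5 := (mul_dvd_mul_iff_left hQ0).1 h4
    have hirr := (Ideal.prime_of_isPrime hQp0 hQp).irreducible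
    obtain ⟨S, hS⟩ := h5
    rcases hirr.isUnit_or_isUnit (a := Q) (b := R * R * S) (by rw [hS]; ring) with h6 | h6
    · exact hQ.ne_top (Ideal.isUnit_iff.1 h6)
    · exact hRu (isUnit_of_dvd_unit ⟨R * S, by ring⟩ h6)
  have hPQ' : P = Q := by
    rw [hR, Ideal.isUnit_iff.1 hR1, Ideal.mul_top]
  exact ⟨P, hPQ' ▸ hQ.isPrime, hP0, hPc, hP2⟩

end IsQuadExt

namespace IsQuadExt

section

variable {K : Type*} [Field K] [NumberField K]

lemma exists_eq_ofIdeal_div (I : FracIdeals K) :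
    ∃ (J : Ideal (𝓞 K)) (hJ : J ≠ ⊥) (a : 𝓞 K) (ha : a ≠ 0),
      I * ofIdeal (Ideal.span {a}) (by simpa using ha) = ofIdeal J hJ := by
  obtain ⟨a, J, ha, hI⟩ := FractionalIdeal.exists_eq_spanSingleton_mul (I : FractionalIdeal (𝓞 K)⁰ K)
  have hJ : J ≠ ⊥ := by
    rintro rfl
    apply I.ne_zero
    rw [hI]
    simp
  refine ⟨J, hJ, a, ha, ?_⟩
  have ha' : algebraMap (𝓞 K) K a ≠ 0 := by simpa using ha
  ext1
  rw [Units.val_mul, hI, coe_ofIdeal, coe_ofIdeal, coeIdeal_span_singleton, mul_right_comm,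
    spanSingleton_mul_spanSingleton, inv_mul_cancel₀ ha']
  simp

lemma ofIdeal_congr {J J' : Ideal (𝓞 K)} (h : J = J') (hJ : J ≠ ⊥) :
    ofIdeal J hJ = ofIdeal J' (h ▸ hJ) := by
  subst h; rfl

lemma ofIdeal_pow (J : Ideal (𝓞 K)) (hJ : J ≠ ⊥) (n : ℕ) :
    ofIdeal J hJ ^ n = ofIdeal (J ^ n) (pow_ne_zero n hJ) := by
  ext1
  simp [coeIdeal_pow]

/-- The parity of the exponent of a prime in a fractional ideal. -/
noncomputable def parity (v : HeightOneSpectrum (𝓞 K)) :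
    FracIdeals K →* Multiplicative (ZMod 2) where
  toFun I := Multiplicative.ofAdd ((count K v (I : FractionalIdeal (𝓞 K)⁰ K) : ℤ) : ZMod 2)
  map_one' := by simp [count_one]
  map_mul' I J := by
    rw [Units.val_mul, count_mul K v I.ne_zero J.ne_zero, Int.cast_add, ofAdd_add]

lemma parity_self (v : HeightOneSpectrum (𝓞 K)) :
    parity v (ofIdeal v.asIdeal v.ne_bot) = Multiplicative.ofAdd 1 := by
  simp [parity, count_self]

lemma parity_eq_one_of_not_dvd (v : HeightOneSpectrum (𝓞 K)) (J : Ideal (𝓞 K)) (hJ : J ≠ ⊥)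
    (h : ¬ v.asIdeal ∣ J) : parity v (ofIdeal J hJ) = 1 := by
  induction J using UniqueFactorizationMonoid.induction_on_prime with
  | h₁ => exact absurd rfl hJ
  | h₂ J hu =>
    have : ofIdeal J hJ = 1 := by
      ext1
      simp [Ideal.isUnit_iff.1 hu]
    rw [this, map_one]
  | h₃ J P hJ0 hP ih =>
    rw [ofIdeal_mul P J hP.ne_zero hJ0, map_mul, ih hJ0 fun h1 => h (h1.mul_left _), mul_one]
    have hw : (⟨P, Ideal.isPrime_of_prime hP, hP.ne_zero⟩ : HeightOneSpectrum (𝓞 K)) ≠ v := by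
      rintro rfl
      exact h (dvd_mul_right _ _)
    have := count_maximal_coprime K v hw
    simp only [parity, MonoidHom.coe_mk, OneHom.coe_mk, coe_ofIdeal]
    rw [this]
    simp

lemma mul_self_eq_one_zmod (x : Multiplicative (ZMod 2)) : x * x = 1 := by
  apply Multiplicative.toAdd.injective
  exact CharTwo.add_self_eq_zero x.toAdd

end

variable {k K : Type*} [Field k] [NumberField k] [Field K] [NumberField K] [Algebra k K]
  {δ : 𝓞 k} {d : K} {τ : K ≃ₐ[k] K} {ι : Type*} [Fintype ι]
  {𝔭 : ι → Ideal (𝓞 k)}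

lemma parity_extFrac (v : HeightOneSpectrum (𝓞 K)) {Q : Ideal (𝓞 k)} (hQ : Q.IsMaximal)
    (hv : v.asIdeal ^ 2 = Q.map (algebraMap (𝓞 k) (𝓞 K))) (I : FracIdeals k) :
    parity v (extFrac k K I) = 1 := by
  have key : ∀ (J : Ideal (𝓞 k)) (hJ : J ≠ ⊥), parity v (extFrac k K (ofIdeal J hJ)) = 1 := by
    intro J hJ
    induction J using UniqueFactorizationMonoid.induction_on_prime with
    | h₁ => exact absurd rfl hJ
    | h₂ J hu =>
      have : ofIdeal J hJ = 1 := by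
        ext1
        simp [Ideal.isUnit_iff.1 hu]
      rw [this, map_one, map_one]
    | h₃ J P hJ0 hP ih =>
      rw [ofIdeal_mul P J hP.ne_zero hJ0, map_mul, map_mul, ih hJ0, mul_one, extFrac_ofIdeal]
      by_cases hPQ : P = Q
      · subst hPQ
        rw [ofIdeal_congr hv.symm, ← ofIdeal_pow _ v.ne_bot, map_pow, sq, mul_self_eq_one_zmod]
      · refine parity_eq_one_of_not_dvd v _ _ fun hd => hPQ ?_
        have hPm := (Ideal.isPrime_of_prime hP).isMaximal hP.ne_zero
        rw [map_le_iff_comap] at hd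
        have h1 : Q ≤ v.asIdeal.comap (algebraMap (𝓞 k) (𝓞 K)) := by
          rw [← map_le_iff_comap, ← hv]
          exact dvd_pow_self _ two_ne_zero
        have hne := Ideal.comap_ne_top (algebraMap (𝓞 k) (𝓞 K)) v.isPrime.ne_top
        rw [hPm.eq_of_le hne hd, hQ.eq_of_le hne h1]
  obtain ⟨J, hJ, a, ha, h⟩ := exists_eq_ofIdeal_div I
  have h1 := key J hJ
  rw [← h, map_mul, map_mul, key, mul_one] at h1
  exact h1

lemma mem_closure_of_conj_eq (h : IsQuadExt δ d τ) (hr : RamData δ 𝔭)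
    (v : ι → HeightOneSpectrum (𝓞 K)) (hvc : ∀ i, (v i).asIdeal.map (conjInt τ) = (v i).asIdeal)
    (hv : ∀ i, (v i).asIdeal ^ 2 = (𝔭 i).map (algebraMap (𝓞 k) (𝓞 K)))
    (J : Ideal (𝓞 K)) (hJ : J ≠ ⊥) (hJc : J.map (conjInt τ) = J) :
    ∃ n : ι → ℕ, ofIdeal J hJ * ∏ i, ofIdeal (v i).asIdeal (v i).ne_bot ^ n i ∈
      (extFrac k K).range := by
  classical
  induction J using IsWellFounded.induction (fun I J : Ideal (𝓞 K) => J < I) with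
  | ind J ih =>
  by_cases hJ1 : J = ⊤
  · refine ⟨0, ?_⟩
    have : ofIdeal J hJ = 1 := by ext1; simp [hJ1]
    simp [this, one_mem]
  · obtain ⟨P, hPm, hPJ⟩ := Ideal.exists_le_maximal J hJ1
    have hP0 : P ≠ ⊥ := fun h0 => hJ (le_bot_iff.1 (h0 ▸ hPJ))
    have step : ∀ (A : Ideal (𝓞 K)), A ≠ ⊤ → A.map (conjInt τ) = A → A ∣ J →
        ∃ (hA : A ≠ ⊥) (R : Ideal (𝓞 K)) (hR : R ≠ ⊥),
          ofIdeal J hJ = ofIdeal A hA * ofIdeal R hR ∧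
          ∃ n : ι → ℕ, ofIdeal R hR * ∏ i, ofIdeal (v i).asIdeal (v i).ne_bot ^ n i ∈
            (extFrac k K).range := by
      rintro A hA1 hAc ⟨R, rfl⟩
      have hA0 : A ≠ ⊥ := by rintro rfl; simp at hJ
      have hR0 : R ≠ ⊥ := by rintro rfl; simp at hJ
      refine ⟨hA0, R, hR0, ofIdeal_mul A R hA0 hR0, ih R ?_ hR0 ?_⟩
      · refine lt_of_le_of_ne Ideal.mul_le_right fun he => hA1 ?_
        have h1 : A * R = 1 * R := by rw [he, one_mul]
        exact (mul_right_cancel₀ hR0 h1).trans Ideal.one_eq_top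
      · rw [Ideal.map_mul, hAc] at hJc
        exact mul_left_cancel₀ hA0 hJc
    by_cases hδ : algebraMap (𝓞 k) (𝓞 K) δ ∈ P
    · have : (P.comap (algebraMap (𝓞 k) (𝓞 K))).IsPrime := hPm.isPrime.comap _
      obtain ⟨i, hi⟩ := hr.exists_eq this (Ideal.mem_comap.2 hδ)
      have hvP : (v i).asIdeal = P := by
        refine ((v i).isMaximal).eq_of_le hPm.ne_top ?_
        refine (Ideal.IsPrime.pow_le_iff (hP := hPm.isPrime) two_ne_zero).1 ?_
        rw [hv i, Ideal.map_le_iff_le_comap, hi]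
      obtain ⟨hA, R, hR, hJR, n, hn⟩ := step _ (v i).isPrime.ne_top (hvc i)
        (hvP ▸ Ideal.dvd_iff_le.2 hPJ)
      refine ⟨n + Pi.single i 1, ?_⟩
      have h1 : ∏ j, ofIdeal (v j).asIdeal (v j).ne_bot ^ (n + Pi.single i 1 : ι → ℕ) j =
          (∏ j, ofIdeal (v j).asIdeal (v j).ne_bot ^ n j) * ofIdeal (v i).asIdeal (v i).ne_bot := by
        simp only [Pi.add_apply, pow_add, Finset.prod_mul_distrib]
        congr 1
        rw [Finset.prod_eq_single i]
        · simp
        · intro j _ hj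
          simp [hj]
        · simp
      have h2 : ofIdeal (v i).asIdeal (v i).ne_bot ^ 2 ∈ (extFrac k K).range := by
        rw [ofIdeal_pow, ofIdeal_congr (hv i), ← extFrac_ofIdeal _ (hr.ne_bot i)]
        exact ⟨_, rfl⟩
      rw [h1, hJR]
      have h3 := mul_mem h2 hn
      convert h3 using 1
      rw [sq]
      apply Additive.ofMul.injective
      simp only [ofMul_mul]
      module
    · have hd := h.map_comap_dvd_of_conj hr.two hPm.isPrime hP0 hδ hJc (Ideal.dvd_iff_le.2 hPJ)
      obtain ⟨hA, R, hR, hJR, n, hn⟩ := step _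
        (fun h0 => hPm.ne_top (top_le_iff.1 (h0 ▸ Ideal.map_comap_le))) (map_conjInt_map _) hd
      refine ⟨n, ?_⟩
      rw [hJR, mul_assoc]
      refine mul_mem ?_ hn
      have hb : P.comap (algebraMap (𝓞 k) (𝓞 K)) ≠ ⊥ := fun h0 => hA (by rw [h0, Ideal.map_bot])
      exact ⟨ofIdeal _ hb, extFrac_ofIdeal _ hb⟩

lemma relIndex_range_extFrac (h : IsQuadExt δ d τ) (hr : RamData δ 𝔭) :
    (extFrac k K).range.relIndex (fixedSub (conjFrac τ)) = 2 ^ Fintype.card ι := by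
  classical
  choose P hPp hP0 hPc hP2 using fun i => h.exists_ramified_prime hr i
  set v : ι → HeightOneSpectrum (𝓞 K) := fun i => ⟨P i, hPp i, hP0 i⟩ with hvdef
  have hvinj : Function.Injective v := by
    intro i j hij
    have h1 : P i = P j := congrArg HeightOneSpectrum.asIdeal hij
    have h2 : (𝔭 i).map (algebraMap (𝓞 k) (𝓞 K)) = (𝔭 j).map (algebraMap (𝓞 k) (𝓞 K)) := by
      rw [← hP2, ← hP2, h1]
    apply hr.inj
    have key : ∀ i j, (𝔭 i).map (algebraMap (𝓞 k) (𝓞 K)) = (𝔭 j).map (algebraMap (𝓞 k) (𝓞 K)) →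
        (P i).comap (algebraMap (𝓞 k) (𝓞 K)) = 𝔭 j := by
      intro i j h2
      refine ((hr.isMaximal j).eq_of_le (Ideal.comap_ne_top _ (hPp i).ne_top) ?_).symm
      rw [← Ideal.map_le_iff_le_comap, ← h2, ← hP2]
      exact Ideal.pow_le_self two_ne_zero
    rw [← key i i rfl, key i j h2]
  let Θ : FracIdeals K →* (ι → Multiplicative (ZMod 2)) := MonoidHom.pi fun i => parity (v i)
  have hΘv : ∀ i, Θ (ofIdeal (P i) (hP0 i)) = Pi.mulSingle i (Multiplicative.ofAdd 1) := by
    intro i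
    funext j
    by_cases hij : i = j
    · subst hij
      rw [Pi.mulSingle_eq_same]
      exact parity_self (v i)
    · rw [Pi.mulSingle_eq_of_ne (Ne.symm hij)]
      refine parity_eq_one_of_not_dvd (v j) (P i) (hP0 i) fun hd => hij (hvinj ?_)
      ext1
      exact ((hPp i).isMaximal (hP0 i)).eq_of_le (hPp j).ne_top (Ideal.dvd_iff_le.1 hd)
  have hΘD : ∀ I, Θ (extFrac k K I) = 1 := by
    intro I
    funext i
    exact parity_extFrac (v i) (hr.isMaximal i) (hP2 i) I
  have hPsq : ∀ i, ofIdeal (P i) (hP0 i) ^ 2 ∈ (extFrac k K).range := fun i => by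
    rw [ofIdeal_pow, ofIdeal_congr (hP2 i), ← extFrac_ofIdeal _ (hr.ne_bot i)]
    exact ⟨_, rfl⟩
  have hker : (extFrac k K).range.subgroupOf (fixedSub (conjFrac τ)) =
      (Θ.comp (fixedSub (conjFrac τ)).subtype).ker := by
    ext ⟨I, hI⟩
    rw [Subgroup.mem_subgroupOf, MonoidHom.mem_ker]
    change I ∈ (extFrac k K).range ↔ Θ I = 1
    constructor
    · rintro ⟨b, rfl⟩
      exact hΘD b
    · intro hΘ
      obtain ⟨J, hJ, a, ha, hIJ⟩ := exists_eq_ofIdeal_div I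
      have ha' : ofIdeal (Ideal.span {a}) (by simpa using ha) *
          conjFrac τ (ofIdeal (Ideal.span {a}) (by simpa using ha)) ∈ (extFrac k K).range :=
        h.mul_conjFrac_mem_range _
      have hc0 : conjInt τ a ≠ 0 := fun h0 => ha (by rw [← h.conjInt_conjInt a, h0, map_zero])
      set M : Ideal (𝓞 K) := J * (Ideal.span {a}).map (conjInt τ)
      have hM0 : M ≠ ⊥ := mul_ne_zero hJ (h.map_conjInt_ne_bot (by simpa using ha))
      have hM : I * (ofIdeal (Ideal.span {a}) (by simpa using ha) *
          conjFrac τ (ofIdeal (Ideal.span {a}) (by simpa using ha))) = ofIdeal M hM0 := by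
        rw [← mul_assoc, hIJ, h.conjFrac_ofIdeal, ← ofIdeal_mul]
      have hMc : M.map (conjInt τ) = M := by
        have h1 : conjFrac τ (ofIdeal M hM0) = ofIdeal M hM0 := by
          rw [← hM, map_mul, map_mul, h.conjFrac_conjFrac, mem_fixedSub.1 hI]
          congr 1
          exact mul_comm _ _
        rw [h.conjFrac_ofIdeal] at h1
        exact coeIdeal_injective (congrArg Units.val h1)
      obtain ⟨n, hn⟩ := h.mem_closure_of_conj_eq hr v hPc hP2 M hM0 hMc
      have h2 : Θ (∏ i, ofIdeal (P i) (hP0 i) ^ n i) = 1 := by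
        obtain ⟨b, hb⟩ := hn
        obtain ⟨b', hb'⟩ := ha'
        have h3 := hΘD b
        rw [hb, ← hM, ← hb', map_mul, map_mul, hΘ, hΘD, one_mul, one_mul] at h3
        exact h3
      have heven : ∀ i, Even (n i) := by
        intro i
        have h3 := congrFun h2 i
        rw [map_prod] at h3
        simp only [map_pow, hΘv, Finset.prod_apply, Pi.pow_apply] at h3
        rw [Finset.prod_eq_single i] at h3
        · rw [Pi.mulSingle_eq_same, ← ofAdd_nsmul, Pi.one_apply, ofAdd_eq_one, nsmul_one,
            ZMod.natCast_eq_zero_iff] at h3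
          exact even_iff_two_dvd.2 h3
        · intro j _ hj
          rw [Pi.mulSingle_eq_of_ne hj.symm, one_pow]
        · simp
      have h4 : ∏ i, ofIdeal (P i) (hP0 i) ^ n i ∈ (extFrac k K).range := by
        refine prod_mem fun i _ => ?_
        obtain ⟨m, hm⟩ := heven i
        rw [hm, ← two_mul, pow_mul]
        exact pow_mem (hPsq i) m
      have h5 : ofIdeal M hM0 ∈ (extFrac k K).range := (Subgroup.mul_mem_cancel_right _ h4).1 hn
      rw [← hM] at h5
      exact (Subgroup.mul_mem_cancel_right _ ha').1 h5
  have hsurj : (Θ.comp (fixedSub (conjFrac τ)).subtype).range = ⊤ := by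
    rw [eq_top_iff]
    intro f _
    have hmem : ∏ i, ofIdeal (P i) (hP0 i) ^ (f i).toAdd.val ∈ fixedSub (conjFrac τ) := by
      refine prod_mem fun i _ => pow_mem ?_ _
      rw [mem_fixedSub, h.conjFrac_ofIdeal]
      exact (ofIdeal_congr (hPc i) _)
    refine ⟨⟨_, hmem⟩, ?_⟩
    change Θ (∏ i, ofIdeal (P i) (hP0 i) ^ (f i).toAdd.val) = f
    funext i
    rw [map_prod]
    simp only [map_pow, hΘv, Finset.prod_apply, Pi.pow_apply]
    rw [Finset.prod_eq_single i]
    · rw [Pi.mulSingle_eq_same, ← ofAdd_nsmul, nsmul_one, ZMod.natCast_val, ZMod.cast_id]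
      rfl
    · intro j _ hj
      rw [Pi.mulSingle_eq_of_ne hj.symm, one_pow]
    · simp
  rw [Subgroup.relIndex, hker, Subgroup.index_ker, hsurj, Subgroup.card_top, Nat.card_pi]
  simp

end IsQuadExt

/-- The nonzero values of the form `x² - b y²`. -/
def normGroup {F : Type*} [Field F] (b : F) : Subgroup Fˣ where
  carrier := {u | ∃ x y : F, (u : F) = x ^ 2 - b * y ^ 2}
  one_mem' := ⟨1, 0, by simp⟩
  mul_mem' := by
    rintro u v ⟨x, y, h⟩ ⟨z, w, h'⟩
    exact ⟨x * z + b * y * w, x * w + y * z, by rw [Units.val_mul, h, h']; ring⟩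
  inv_mem' := by
    rintro u ⟨x, y, h⟩
    refine ⟨x / u, y / u, ?_⟩
    have := u.ne_zero
    rw [Units.val_inv_eq_inv_val]
    field_simp
    rw [← h]

/-- The units of `k` that are norms from `k(√δ)`. -/
noncomputable def normUnits {k : Type*} [Field k] [NumberField k] (δ : 𝓞 k) : Subgroup (𝓞 k)ˣ :=
  (normGroup (δ : k)).comap (Units.map (algebraMap (𝓞 k) k : 𝓞 k →* k))

lemma mem_normUnits {k : Type*} [Field k] [NumberField k] {δ : 𝓞 k} {u : (𝓞 k)ˣ} :
    u ∈ normUnits δ ↔ ∃ x y : k, ((u : 𝓞 k) : k) = x ^ 2 - δ * y ^ 2 := Iff.rfl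

namespace IsQuadExt

section

variable (K : Type*) [Field K] [NumberField K]

/-- The units of the ring of integers inside the multiplicative group of the field. -/
noncomputable def unitsHom : (𝓞 K)ˣ →* Kˣ := Units.map (algebraMap (𝓞 K) K : 𝓞 K →* K)

lemma unitsHom_injective : Function.Injective (unitsHom K) :=
  Units.map_injective (RingOfIntegers.coe_injective)

lemma ker_toPrincipalIdeal : (toPrincipalIdeal (𝓞 K) K).ker = (unitsHom K).range := by
  ext x
  rw [MonoidHom.mem_ker, toPrincipalIdeal_eq_iff, Units.val_one]
  constructor
  · intro h
    have h1 : (x : K) ∈ (1 : FractionalIdeal (𝓞 K)⁰ K) := h ▸ mem_spanSingleton_self _ _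
    have h2 : ((x⁻¹ : Kˣ) : K) ∈ (1 : FractionalIdeal (𝓞 K)⁰ K) := by
      have h3 : spanSingleton (𝓞 K)⁰ ((x⁻¹ : Kˣ) : K) = 1 := by
        rw [← mul_one (spanSingleton _ _), ← h, spanSingleton_mul_spanSingleton, Units.inv_mul,
          spanSingleton_one, h]
      exact h3 ▸ mem_spanSingleton_self _ _
    obtain ⟨a, ha⟩ := (mem_one_iff _).1 h1
    obtain ⟨b, hb⟩ := (mem_one_iff _).1 h2
    refine ⟨⟨a, b, ?_, ?_⟩, Units.ext ha⟩
    · ext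
      change algebraMap (𝓞 K) K (a * b) = 1
      rw [map_mul, ha, hb, Units.mul_inv]
    · ext
      change algebraMap (𝓞 K) K (b * a) = 1
      rw [map_mul, ha, hb, Units.inv_mul]
  · rintro ⟨u, rfl⟩
    have h : Ideal.span {(u : 𝓞 K)} = ⊤ := Ideal.span_singleton_eq_top.2 u.isUnit
    change spanSingleton (𝓞 K)⁰ (algebraMap (𝓞 K) K u) = 1
    rw [← coeIdeal_span_singleton, h, coeIdeal_top]

lemma squaresOf_map {X Y : Type*} [CommGroup X] [CommGroup Y] (f : X →* Y) (H : Subgroup X) :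
    squaresOf (H.map f) = (squaresOf H).map f := by
  rw [squaresOf, squaresOf, Subgroup.map_map, Subgroup.map_map]
  congr 1
  ext x
  simp

lemma relIndex_squaresOf_units [IsTotallyReal K] {Y : Type*} [CommGroup Y] (f : (𝓞 K)ˣ →* Y)
    (hf : Function.Injective f) :
    (squaresOf f.range).relIndex f.range = 2 ^ Module.finrank ℚ K := by
  rw [← index_unit_squares, MonoidHom.range_eq_map, squaresOf_map,
    Subgroup.relIndex_map_map_of_injective _ _ hf, Subgroup.relIndex_top_right, squaresOf,
    MonoidHom.range_eq_map]

end

variable {k K : Type*} [Field k] [NumberField k] [Field K] [NumberField K] [Algebra k K]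
  {δ : 𝓞 k} {d : K} {τ : K ≃ₐ[k] K} {ι : Type*} [Fintype ι]
  {𝔭 : ι → Ideal (𝓞 k)}

lemma ker_inf_fixedSub (h : IsQuadExt δ d τ) :
    (toPrincipalIdeal (𝓞 K) K).ker ⊓ fixedSub (Units.map (τ : K →* K)) =
      ((Units.map (algebraMap k K : k →* K)).comp (unitsHom k)).range := by
  rw [ker_toPrincipalIdeal]
  ext x
  rw [Subgroup.mem_inf, mem_fixedSub]
  constructor
  · rintro ⟨⟨u, rfl⟩, hx⟩
    have h1 : conjInt τ u = u := by
      ext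
      exact congrArg Units.val hx
    have h2 : conjInt τ (u⁻¹ : (𝓞 K)ˣ) = (u⁻¹ : (𝓞 K)ˣ) := by
      have : (Units.map (conjInt τ : 𝓞 K →* 𝓞 K)) u = u := Units.ext h1
      have := congrArg (·⁻¹) this
      simp only [← map_inv] at this
      exact congrArg Units.val this
    obtain ⟨a, ha⟩ := h.exists_int_of_conjInt_eq h1
    obtain ⟨b, hb⟩ := h.exists_int_of_conjInt_eq h2
    have hinj : Function.Injective (algebraMap (𝓞 k) (𝓞 K)) := FaithfulSMul.algebraMap_injective _ _
    refine ⟨⟨a, b, hinj ?_, hinj ?_⟩, ?_⟩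
    · rw [map_mul, ha, hb, Units.mul_inv, map_one]
    · rw [map_mul, ha, hb, Units.inv_mul, map_one]
    · ext1
      exact congrArg (algebraMap (𝓞 K) K) ha
  · rintro ⟨u, rfl⟩
    refine ⟨⟨Units.map (algebraMap (𝓞 k) (𝓞 K) : 𝓞 k →* 𝓞 K) u, ?_⟩, ?_⟩
    · ext1; rfl
    · ext1
      simp

lemma mem_range_sigmaNorm (h : IsQuadExt δ d τ) (u : kˣ) :
    Units.map (algebraMap k K : k →* K) u ∈ (sigmaNorm (Units.map (τ : K →* K))).range ↔
      u ∈ normGroup (δ : k) := by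
  constructor
  · rintro ⟨x, hx⟩
    obtain ⟨a, b, hab⟩ := h.rep (x : K)
    refine ⟨a, b, (algebraMap k K).injective ?_⟩
    rw [← h.norm_rep, ← hab]
    exact (congrArg Units.val hx).symm
  · rintro ⟨a, b, hab⟩
    have h1 := h.norm_rep a b
    rw [← hab] at h1
    have h0 : algebraMap k K a + algebraMap k K b * d ≠ 0 := by
      intro h0
      rw [h0, zero_mul] at h1
      simpa using h1.symm
    exact ⟨Units.mk0 _ h0, Units.ext h1⟩

/-- The genus theory of a totally real quadratic extension of a field with odd class number. -/
theorem card_twoTorsion [IsTotallyReal k] [IsTotallyReal K] (h : IsQuadExt δ d τ)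
    (hfin : Module.finrank k K = 2) (hr : RamData δ 𝔭) (hodd : Odd (classNumber k)) :
    Nat.card {c : ClassGroup (𝓞 K) // c ^ 2 = 1} * 2 * (normUnits δ).index =
      2 ^ Fintype.card ι := by
  set σ : Kˣ →* Kˣ := Units.map (τ : K →* K) with hσdef
  set div := toPrincipalIdeal (𝓞 K) K
  have hσσ : ∀ x, σ (σ x) = x := fun x => Units.ext (h.conj_conj x)
  have h1 := ambiguous_class_formula div σ (conjFrac τ)
    (((ClassGroup.equiv (R := 𝓞 K) K).symm : _ →* ClassGroup (𝓞 K)).comp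
      (QuotientGroup.mk' div.range))
    ((ClassGroup.equiv (R := 𝓞 K) K).symm.surjective.comp (QuotientGroup.mk'_surjective _))
    (by
      ext x
      rw [MonoidHom.mem_ker, ← QuotientGroup.eq_one_iff]
      simp)
    hσσ h.conjFrac_conjFrac conjFrac_toPrincipalIdeal (extFrac k K).range
    (by
      rintro _ ⟨b, rfl⟩
      exact mem_fixedSub.2 (h.conjFrac_extFrac b))
    h.mul_conjFrac_mem_range
    (by
      intro x hx
      obtain ⟨a, ha⟩ := h.eq_algebraMap_of_conj_eq (x := (x : K)) (congrArg Units.val hx)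
      have ha0 : a ≠ 0 := by
        rintro rfl
        rw [map_zero] at ha
        exact x.ne_zero ha.symm
      refine ⟨toPrincipalIdeal _ _ (Units.mk0 a ha0), ?_⟩
      rw [extFrac_toPrincipalIdeal]
      congr 1
      exact Units.ext ha)
    h.hilbert90 hilbert90_ideal (classNumber k) hodd
    (by
      rintro _ ⟨b, rfl⟩
      have : b ^ classNumber k ∈ (toPrincipalIdeal (𝓞 k) k).range := by
        rw [← QuotientGroup.eq_one_iff, QuotientGroup.mk_pow]
        apply (ClassGroup.equiv (R := 𝓞 k) k).symm.injective
        rw [map_pow, map_one]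
        exact pow_card_eq_one
      obtain ⟨x, hx⟩ := this
      refine ⟨Units.map (algebraMap k K : k →* K) x, ?_, ?_⟩
      · ext1; simp [hσdef]
      · rw [← map_pow, ← hx, extFrac_toPrincipalIdeal])
  have hE0 := h.ker_inf_fixedSub
  have h2 := unit_index_formula σ hσσ div.ker
    (by
      intro x hx
      rw [MonoidHom.mem_ker] at hx ⊢
      rw [← conjFrac_toPrincipalIdeal, hx, map_one])
    (2 ^ Module.finrank ℚ k) (by positivity)
    (by
      rw [ker_toPrincipalIdeal, relIndex_squaresOf_units K _ (unitsHom_injective K), ← pow_mul,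
        ← hfin, Module.finrank_mul_finrank])
    (by
      rw [hE0, relIndex_squaresOf_units k]
      exact (Units.map_injective (algebraMap k K).injective).comp (unitsHom_injective k))
    (-1)
    (by
      intro h0
      have := congrArg Units.val h0
      norm_num at this)
    (by
      rw [ker_toPrincipalIdeal]
      exact ⟨-1, by ext1; simp [unitsHom]⟩)
    (by simp)
    (by ext1; simp [hσdef])
    (by
      intro x _ hx
      have h3 : (x : K) ^ 2 = 1 := congrArg Units.val hx
      rcases sq_eq_sq_iff_eq_or_eq_neg.1 (h3.trans (one_pow 2).symm) with h4 | h4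
      · exact Or.inl (Units.ext h4)
      · exact Or.inr (Units.ext h4))
    (by
      intro x _ hx
      exact sq_ne_neg_one (x : K) (congrArg Units.val hx))
  have hle : div.ker.map (sigmaNorm σ) ≤ div.ker ⊓ fixedSub σ ⊓ (sigmaNorm σ).range := by
    rintro _ ⟨x, hx, rfl⟩
    have hx' : div x = 1 := hx
    refine ⟨⟨?_, ?_⟩, ⟨x, rfl⟩⟩
    · change div (x * σ x) = 1
      rw [map_mul, hx', one_mul, ← conjFrac_toPrincipalIdeal, hx', map_one]
    · refine mem_fixedSub.2 ?_
      change σ (x * σ x) = x * σ x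
      rw [map_mul, hσσ, mul_comm]
  have h3 := Subgroup.relIndex_mul_relIndex _ _ (div.ker ⊓ fixedSub σ) hle inf_le_left
  rw [Subgroup.inf_relIndex_left] at h3
  have h4 : (normUnits δ).index = (sigmaNorm σ).range.relIndex (div.ker ⊓ fixedSub σ) := by
    rw [hE0, ← Subgroup.index_comap]
    congr 1
    ext u
    exact (h.mem_range_sigmaNorm _).symm
  have h5 : (div.ker.map (sigmaNorm σ)).relIndex
      (div.ker ⊓ fixedSub σ ⊓ (sigmaNorm σ).range) ≠ 0 := by
    have h6 : (squaresOf (div.ker ⊓ fixedSub σ)).relIndex (div.ker ⊓ fixedSub σ) ≠ 0 := by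
      rw [hE0, relIndex_squaresOf_units k]
      · positivity
      · exact (Units.map_injective (algebraMap k K).injective).comp (unitsHom_injective k)
    have h7 : squaresOf (div.ker ⊓ fixedSub σ) ≤ div.ker.map (sigmaNorm σ) := by
      intro x hx
      obtain ⟨y, hy, rfl⟩ := mem_squaresOf.1 hx
      refine ⟨y, hy.1, ?_⟩
      rw [sigmaNorm_apply, mem_fixedSub.1 hy.2, sq]
    have h8 := Subgroup.relIndex_mul_relIndex _ _ (div.ker ⊓ fixedSub σ) h7 (hle.trans inf_le_left)
    have h9 : (div.ker.map (sigmaNorm σ)).relIndex (div.ker ⊓ fixedSub σ) ≠ 0 := by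
      intro h0
      rw [h0, mul_zero] at h8
      exact h6 h8.symm
    intro h0
    rw [h0, zero_mul] at h3
    exact h9 h3.symm
  rw [h2, ← h3, h.relIndex_range_extFrac hr] at h1
  rw [h4]
  refine mul_right_cancel₀ h5 ?_
  rw [← h1]
  ring

end IsQuadExt

section QuadraticExtension

variable {k K : Type*} [Field k] [Field K] [Algebra k K] {δ : 𝓞 k} {d : K}

lemma linearIndependent_one_sqrt (hd : d ^ 2 = algebraMap k K δ) (hδ : ¬ IsSquare (δ : k)) {a b : k}
    (hab : algebraMap k K a + algebraMap k K b * d = 0) : a = 0 ∧ b = 0 := by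
  have hb : b = 0 := by
    by_contra hb
    refine hδ ⟨a / b, ?_⟩
    apply (algebraMap k K).injective
    have hb' : algebraMap k K b ≠ 0 := (_root_.map_ne_zero _).2 hb
    rw [← hd, map_mul, map_div₀]
    have : algebraMap k K a = - (algebraMap k K b * d) := eq_neg_of_add_eq_zero_left hab
    rw [this]
    field_simp
  subst hb
  simpa using hab

lemma finrank_eq_two_of_rep (hd : d ^ 2 = algebraMap k K δ) (hδ : ¬ IsSquare (δ : k))
    (rep : ∀ x : K, ∃ a b : k, x = algebraMap k K a + algebraMap k K b * d) :
    Module.finrank k K = 2 := by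
  have hli : LinearIndependent k ![(1 : K), d] := by
    rw [LinearIndependent.pair_iff]
    intro a b hab
    exact linearIndependent_one_sqrt hd hδ (by simpa [Algebra.smul_def] using hab)
  have hsp : ⊤ ≤ Submodule.span k (Set.range ![(1 : K), d]) := by
    rintro x -
    obtain ⟨a, b, rfl⟩ := rep x
    simp only [Matrix.range_cons, Matrix.range_empty, Set.union_empty, Set.singleton_union]
    exact Submodule.mem_span_pair.2 ⟨a, b, by simp [Algebra.smul_def]⟩
  simpa using Module.finrank_eq_card_basis (Module.Basis.mk hli hsp)

lemma exists_isQuadExt [CharZero k] (hd : d ^ 2 = algebraMap k K δ) (hδ : ¬ IsSquare (δ : k))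
    (rep : ∀ x : K, ∃ a b : k, x = algebraMap k K a + algebraMap k K b * d) :
    ∃ τ : K ≃ₐ[k] K, IsQuadExt δ d τ := by
  have hfin := finrank_eq_two_of_rep hd hδ rep
  have : Algebra.IsQuadraticExtension k K := { finrank_eq_two' := hfin }
  have : FiniteDimensional k K := Module.finite_of_finrank_eq_succ hfin
  have hcard : Nat.card (K ≃ₐ[k] K) = 2 := by rw [IsGalois.card_aut_eq_finrank, hfin]
  have : Nontrivial (K ≃ₐ[k] K) := Finite.one_lt_card_iff_nontrivial.1 (by omega)
  obtain ⟨τ, hτ⟩ := exists_ne (1 : K ≃ₐ[k] K)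
  have h2 : (τ d) ^ 2 = d ^ 2 := by rw [← map_pow, hd, AlgEquiv.commutes]
  refine ⟨τ, hd, ?_, ?_, rep⟩
  · rintro rfl
    refine hδ ⟨0, (algebraMap k K).injective ?_⟩
    rw [← hd]
    simp
  · rcases sq_eq_sq_iff_eq_or_eq_neg.1 h2 with h | h
    · refine absurd (AlgEquiv.ext fun x => ?_) hτ
      obtain ⟨a, b, rfl⟩ := rep x
      simp [h]
    · exact h

lemma IsQuadExt.isTotallyReal {τ : K ≃ₐ[k] K} (h : IsQuadExt δ d τ) [NumberField k]
    [IsTotallyReal k] [NumberField K] (hpos : ∀ φ : k →+* ℝ, 0 < φ δ) : IsTotallyReal K := by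
  refine ⟨fun w => ?_⟩
  rw [InfinitePlace.isReal_iff]
  set ψ := w.embedding
  have hr : ComplexEmbedding.IsReal (ψ.comp (algebraMap k K)) :=
    IsTotallyReal.complexEmbedding_isReal _
  have hk : ∀ a : k, starRingEnd ℂ (ψ (algebraMap k K a)) = ψ (algebraMap k K a) := fun a =>
    RingHom.congr_fun hr a
  have hd : ∃ r : ℝ, ψ d = r := by
    have h1 : (ψ d) ^ 2 = ((hr.embedding δ : ℝ) : ℂ) := by
      rw [ComplexEmbedding.IsReal.coe_embedding_apply, ← map_pow, h.sq_eq]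
      rfl
    have h2 : ((Real.sqrt (hr.embedding δ) : ℝ) : ℂ) ^ 2 = ((hr.embedding δ : ℝ) : ℂ) := by
      rw [← Complex.ofReal_pow, Real.sq_sqrt (hpos _).le]
    rcases sq_eq_sq_iff_eq_or_eq_neg.1 (h1.trans h2.symm) with h | h
    · exact ⟨_, h⟩
    · exact ⟨-Real.sqrt (hr.embedding δ), by rw [h]; simp⟩
  obtain ⟨r, hdr⟩ := hd
  ext x
  obtain ⟨a, b, rfl⟩ := h.rep x
  simp only [ComplexEmbedding.conjugate_coe_eq, map_add, map_mul, hk, hdr, Complex.conj_ofReal]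

end QuadraticExtension

universe u

/-- Adjoining the square root of a totally positive nonsquare to a totally real field. -/
theorem exists_totallyReal_quadExt {k : Type u} [Field k] [NumberField k] [IsTotallyReal k]
    {δ : 𝓞 k} (hδ : ¬ IsSquare (δ : k)) (hpos : ∀ φ : k →+* ℝ, 0 < φ δ) :
    ∃ (K : Type u) (_ : Field K) (_ : NumberField K) (_ : Algebra k K) (d : K) (τ : K ≃ₐ[k] K),
      IsTotallyReal K ∧ Module.finrank k K = 2 ∧ IsQuadExt δ d τ := by
  let f : Polynomial k := Polynomial.X ^ 2 - Polynomial.C (δ : k)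
  have hmonic : f.Monic := Polynomial.monic_X_pow_sub_C _ two_ne_zero
  have hdeg : f.natDegree = 2 := Polynomial.natDegree_X_pow_sub_C
  have hirr : Irreducible f := by
    rw [hmonic.irreducible_iff_roots_eq_zero_of_degree_le_three (by omega) (by omega)]
    refine Multiset.eq_zero_of_forall_notMem fun x hx => hδ ⟨x, ?_⟩
    have := (Polynomial.mem_roots'.1 hx).2
    simp only [f, Polynomial.IsRoot.def, Polynomial.eval_sub, Polynomial.eval_pow,
      Polynomial.eval_X, Polynomial.eval_C] at this
    linear_combination -this
  have : Fact (Irreducible f) := ⟨hirr⟩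
  have hd : (AdjoinRoot.root f) ^ 2 = algebraMap k (AdjoinRoot f) δ := by
    have := AdjoinRoot.eval₂_root f
    simp only [f, Polynomial.eval₂_sub, Polynomial.eval₂_pow, Polynomial.eval₂_X,
      Polynomial.eval₂_C] at this
    exact sub_eq_zero.1 this
  have hrep : ∀ x : AdjoinRoot f, ∃ a b : k,
      x = algebraMap k _ a + algebraMap k _ b * AdjoinRoot.root f := by
    intro x
    obtain ⟨g, rfl⟩ := AdjoinRoot.mk_surjective x
    have h1 : AdjoinRoot.mk f g = AdjoinRoot.mk f (g %ₘ f) := by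
      rw [AdjoinRoot.mk_eq_mk]
      exact ⟨g /ₘ f, by linear_combination -Polynomial.modByMonic_add_div g f⟩
    have h2 : (g %ₘ f).natDegree ≤ 1 := by
      have := Polynomial.natDegree_modByMonic_lt g hmonic (by
        intro h; rw [h] at hdeg; simp at hdeg)
      omega
    refine ⟨(g %ₘ f).coeff 0, (g %ₘ f).coeff 1, ?_⟩
    rw [h1]
    conv_lhs => rw [Polynomial.eq_X_add_C_of_natDegree_le_one h2]
    simp [AdjoinRoot.algebraMap_eq, add_comm]
  have hfin := finrank_eq_two_of_rep hd hδ hrep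
  have : FiniteDimensional k (AdjoinRoot f) := Module.finite_of_finrank_eq_succ hfin
  have : NumberField (AdjoinRoot f) := NumberField.of_module_finite k _
  obtain ⟨τ, hτ⟩ := exists_isQuadExt hd hδ hrep
  exact ⟨AdjoinRoot f, inferInstance, inferInstance, inferInstance, AdjoinRoot.root f, τ,
    hτ.isTotallyReal hpos, hfin, hτ⟩

namespace RamData

variable {k : Type*} [Field k] [NumberField k] {δ : 𝓞 k} {ι : Type*} [Fintype ι]
  {𝔭 : ι → Ideal (𝓞 k)}

lemma not_isSquare (h : RamData δ 𝔭) [Nonempty ι] : ¬ IsSquare (δ : k) := by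
  rintro ⟨x, hx⟩
  obtain ⟨i⟩ := ‹Nonempty ι›
  have hint : IsIntegral ℤ x := by
    refine IsIntegral.of_pow (n := 2) two_pos ?_
    rw [sq, ← hx]
    exact RingOfIntegers.isIntegral_coe δ
  set X : 𝓞 k := ⟨x, hint⟩
  have hX : δ = X * X := by ext; exact hx
  have hmem : X ∈ 𝔭 i := by
    have := h.mem i
    rw [hX] at this
    exact ((h.prime i).mem_or_mem this).elim id id
  obtain ⟨c, hc, hc'⟩ := h.exists_cofactor i
  obtain ⟨A, hA⟩ := Ideal.dvd_iff_le.2 ((Ideal.span_singleton_le_iff_mem _).2 hmem)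
  have h1 : 𝔭 i * c = 𝔭 i * (𝔭 i * (A * A)) := by
    rw [← hc, hX, ← Ideal.span_singleton_mul_span_singleton, hA]
    ring
  have h2 := mul_left_cancel₀ (h.ne_bot i) h1
  rw [h2, sup_eq_left.2 Ideal.mul_le_left] at hc'
  exact (h.prime i).ne_top hc'

theorem exists_ext {k : Type u} [Field k] [NumberField k] [IsTotallyReal k] {δ : 𝓞 k}
    {𝔭 : ι → Ideal (𝓞 k)} [Nonempty ι] (h : RamData δ 𝔭)
    (hpos : ∀ φ : k →+* ℝ, 0 < φ δ) (hodd : Odd (classNumber k)) :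
    ∃ (K : Type u) (_ : Field K) (_ : NumberField K) (_ : Algebra k K) (d : K) (τ : K ≃ₐ[k] K),
      IsTotallyReal K ∧ Module.finrank k K = 2 ∧ IsQuadExt δ d τ ∧
      Nat.card {c : ClassGroup (𝓞 K) // c ^ 2 = 1} * 2 * (normUnits δ).index =
        2 ^ Fintype.card ι := by
  obtain ⟨K, _, _, _, d, τ, hK, hfin, hτ⟩ := exists_totallyReal_quadExt h.not_isSquare hpos
  exact ⟨K, inferInstance, inferInstance, inferInstance, d, τ, hK, hfin, hτ, hτ.card_twoTorsion hfin h hodd⟩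

lemma normUnits_eq_top {k : Type u} [Field k] [NumberField k] [IsTotallyReal k] {δ : 𝓞 k}
    {𝔭 : ι → Ideal (𝓞 k)} (h : RamData δ 𝔭) (hι : Fintype.card ι = 1)
    (hpos : ∀ φ : k →+* ℝ, 0 < φ δ) (hodd : Odd (classNumber k)) : normUnits δ = ⊤ := by
  have : Nonempty ι := Fintype.card_pos_iff.1 (by omega)
  obtain ⟨K, _, _, _, d, τ, -, -, -, hcard⟩ := h.exists_ext hpos hodd
  rw [hι, pow_one, mul_right_comm] at hcard
  rw [← Subgroup.index_eq_one]
  exact Nat.eq_one_of_mul_eq_one_left (Nat.eq_of_mul_eq_mul_right two_pos (hcard.trans (one_mul 2).symm))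

end RamData

lemma odd_classNumber_of_card_twoTorsion {K : Type*} [Field K] [NumberField K]
    (h : Nat.card {c : ClassGroup (𝓞 K) // c ^ 2 = 1} = 1) : Odd (classNumber K) := by
  by_contra hodd
  rw [Nat.not_odd_iff_even, even_iff_two_dvd] at hodd
  have : Fact (Nat.Prime 2) := ⟨Nat.prime_two⟩
  obtain ⟨x, hx⟩ := exists_prime_orderOf_dvd_card 2 hodd
  obtain ⟨_, hsub⟩ := (Nat.card_eq_one_iff_unique).1 h
  have h1 : (⟨x, by rw [← hx, pow_orderOf_eq_one]⟩ : {c : ClassGroup (𝓞 K) // c ^ 2 = 1}) =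
    ⟨1, one_pow 2⟩ := Subsingleton.elim _ _
  rw [show x = 1 from congrArg Subtype.val h1, orderOf_one] at hx
  omega

namespace IsQuadExt

variable {k K : Type*} [Field k] [Field K] [Algebra k K] {δ : 𝓞 k} {d : K} {τ : K ≃ₐ[k] K}

lemma coeff_unique [CharZero K] (h : IsQuadExt δ d τ) {a b a' b' : k}
    (hab : algebraMap k K a + algebraMap k K b * d = algebraMap k K a' + algebraMap k K b' * d) :
    a = a' ∧ b = b' := by
  have h1 := congrArg τ hab
  rw [h.conj_rep, h.conj_rep] at h1
  have h2 : algebraMap k K a = algebraMap k K a' := by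
    have : (2 : K) * algebraMap k K a = 2 * algebraMap k K a' := by linear_combination hab + h1
    exact mul_left_cancel₀ two_ne_zero this
  refine ⟨(algebraMap k K).injective h2, (algebraMap k K).injective ?_⟩
  rw [h2, add_right_inj] at hab
  exact mul_right_cancel₀ h.ne hab

/-- An embedding of the base extends once the square root has an image. -/
lemma exists_lift [CharZero K] (h : IsQuadExt δ d τ) {L : Type*} [Field L] (f : k →+* L) {e : L}
    (he : e ^ 2 = f δ) : ∃ g : K →+* L, (∀ a, g (algebraMap k K a) = f a) ∧ g d = e := by
  choose A B hAB using h.rep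
  have key : ∀ x a b, x = algebraMap k K a + algebraMap k K b * d →
      f (A x) + f (B x) * e = f a + f b * e := by
    intro x a b hx
    obtain ⟨h1, h2⟩ := h.coeff_unique ((hAB x).symm.trans hx)
    rw [h1, h2]
  refine ⟨{ toFun := fun x => f (A x) + f (B x) * e, map_one' := ?_, map_mul' := fun x y => ?_,
            map_zero' := ?_, map_add' := fun x y => ?_ }, fun a => ?_, ?_⟩
  · rw [key 1 1 0 (by simp)]; simp
  · rw [key (x * y) (A x * A y + δ * (B x * B y)) (A x * B y + B x * A y)]
    · simp only [map_add, map_mul, ← he]; ring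
    · conv_lhs => rw [hAB x, hAB y]
      simp only [map_add, map_mul, ← h.sq_eq]; ring
  · rw [key 0 0 0 (by simp)]; simp
  · rw [key (x + y) (A x + A y) (B x + B y)]
    · simp only [map_add]; ring
    · conv_lhs => rw [hAB x, hAB y]
      simp only [map_add]; ring
  · change f (A _) + f (B _) * e = _
    rw [key _ a 0 (by simp)]; simp
  · change f (A _) + f (B _) * e = _
    rw [key _ 0 1 (by simp)]; simp

end IsQuadExt

/-- `k = ℚ(√l)` with `s = √l`, where `ε = u + v√l` is a unit of norm `-1`. -/
structure IsBaseField (l u v : ℕ) {k : Type*} [Field k] [NumberField k] (s : 𝓞 k) (ε : (𝓞 k)ˣ)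
    (τ : k ≃ₐ[ℚ] k) : Prop where
  prime : l.Prime
  mod_eight : l % 8 = 1
  sq_add_one : u ^ 2 + 1 = v ^ 2 * l
  four_dvd : 4 ∣ u
  odd : v % 2 = 1
  ext : IsQuadExt (l : 𝓞 ℚ) (s : k) τ
  coe_unit : (ε : 𝓞 k) = u + v * s
  isTotallyReal : IsTotallyReal k
  odd_classNumber : Odd (classNumber k)
  finrank : Module.finrank ℚ k = 2

theorem exists_isBaseField {l u v : ℕ} (hl : l.Prime) (hl8 : l % 8 = 1)
    (huv : u ^ 2 + 1 = v ^ 2 * l) (hu : 4 ∣ u) (hv : v % 2 = 1) :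
    ∃ (k : Type) (_ : Field k) (_ : NumberField k) (s : 𝓞 k) (ε : (𝓞 k)ˣ) (τ : k ≃ₐ[ℚ] k),
      IsBaseField l u v s ε τ := by
  have hr : RamData (l : 𝓞 ℚ) (fun _ : Unit => Ideal.span {(l : 𝓞 ℚ)}) := by
    refine ⟨by exact_mod_cast hl.ne_zero, fun _ => ?_, fun _ _ _ => Subsingleton.elim _ _, by simp,
      Or.inl ⟨(l / 4 : ℕ), ?_⟩⟩
    · rw [Ideal.span_singleton_prime (by exact_mod_cast hl.ne_zero),
        ← MulEquiv.prime_iff Rat.ringOfIntegersEquiv]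
      simpa using Nat.prime_iff_prime_int.1 hl
    · exact_mod_cast (by omega : l = 1 + 4 * (l / 4))
  have hcoe : (((l : 𝓞 ℚ) : 𝓞 ℚ) : ℚ) = l := map_natCast _ l
  obtain ⟨k, _, _, hAlg, d, τ, hK, hfin, hτ, hcard⟩ := hr.exists_ext (fun φ => by
    rw [hcoe, map_natCast]; exact_mod_cast hl.pos) (by rw [Rat.classNumber_eq]; exact odd_one)
  obtain rfl : hAlg = DivisionRing.toRatAlgebra := Subsingleton.elim _ _
  obtain ⟨D, rfl, hD2, -⟩ := hτ.exists_sqrt_int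
  have hD2' : D ^ 2 = l := by simpa using hD2
  have huv' : (u : 𝓞 k) ^ 2 + 1 = v ^ 2 * l := by exact_mod_cast huv
  refine ⟨k, inferInstance, inferInstance, D, ⟨u + v * D, -u + v * D, ?_, ?_⟩, τ,
    hl, hl8, huv, hu, hv, hτ, rfl, hK, ?_, hfin⟩
  · linear_combination (v : 𝓞 k) ^ 2 * hD2' - huv'
  · linear_combination (v : 𝓞 k) ^ 2 * hD2' - huv'
  · refine odd_classNumber_of_card_twoTorsion ?_
    rw [Fintype.card_unit, pow_one, mul_right_comm] at hcard
    exact Nat.eq_one_of_mul_eq_one_right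
      (Nat.eq_of_mul_eq_mul_right two_pos (hcard.trans (one_mul 2).symm))

namespace IsBaseField

variable {l u v : ℕ} {k : Type*} [Field k] [NumberField k] {s : 𝓞 k} {ε : (𝓞 k)ˣ}
  {τ : k ≃ₐ[ℚ] k}

lemma four_mod (h : IsBaseField l u v s ε τ) : v % 4 = 1 :=
  mod_four_eq_one_of_sq_add_one h.odd h.sq_add_one

lemma pos_u (h : IsBaseField l u v s ε τ) : 0 < u := by
  rcases Nat.eq_zero_or_pos u with h0 | h0
  · have h1 := h.sq_add_one
    rw [h0] at h1
    have := Nat.eq_one_of_mul_eq_one_left (by simpa using h1.symm : v ^ 2 * l = 1)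
    exact absurd (this ▸ h.prime) Nat.not_prime_one
  · exact h0

lemma pos_v (h : IsBaseField l u v s ε τ) : 0 < v := by have := h.odd; omega

lemma sq_s (h : IsBaseField l u v s ε τ) : s ^ 2 = l := by
  ext
  have := h.ext.sq_eq
  simpa using this

lemma sq_s' (h : IsBaseField l u v s ε τ) : (s : k) ^ 2 = l := by
  have := congrArg (algebraMap (𝓞 k) k) h.sq_s
  simpa using this

lemma coe_unit' (h : IsBaseField l u v s ε τ) : ((ε : 𝓞 k) : k) = u + v * s := by
  rw [h.coe_unit]; simp

lemma rep (h : IsBaseField l u v s ε τ) (x : k) : ∃ a b : ℚ, x = a + b * s := by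
  simpa using h.ext.rep x

lemma conj_s (h : IsBaseField l u v s ε τ) : τ s = - (s : k) := h.ext.conj

lemma exists_hom (h : IsBaseField l u v s ε τ) {L : Type*} [Field L] [CharZero L] {c : L}
    (hc : c ^ 2 = l) : ∃ φ : k →+* L, φ s = c := by
  obtain ⟨φ, -, hφ⟩ := h.ext.exists_lift (algebraMap ℚ L) (e := c) (by rw [hc]; simp)
  exact ⟨φ, hφ⟩

lemma conj_unit_mul (h : IsBaseField l u v s ε τ) :
    ((ε : 𝓞 k) : k) * τ ((ε : 𝓞 k) : k) = -1 := by
  have h1 := congrArg (Nat.cast : ℕ → k) h.sq_add_one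
  push_cast at h1
  rw [h.coe_unit', map_add, map_mul, map_natCast, map_natCast, h.conj_s]
  linear_combination h1 - (v : k) ^ 2 * h.sq_s'

/-- The units of `k` up to squares. -/
lemma unit_cases (h : IsBaseField l u v s ε τ) (η : (𝓞 k)ˣ) :
    ∃ θ : (𝓞 k)ˣ, η = θ ^ 2 ∨ η = -1 * θ ^ 2 ∨ η = ε * θ ^ 2 ∨ η = -1 * ε * θ ^ 2 := by
  have := h.isTotallyReal
  set S := (powMonoidHom 2 : (𝓞 k)ˣ →* (𝓞 k)ˣ).range with hS
  have hindex : S.index = 4 := by rw [index_unit_squares, h.finrank]; norm_num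
  have hone : (-1 : (𝓞 k)ˣ) ∉ S := by
    rintro ⟨y, hy⟩
    refine sq_ne_neg_one ((y : 𝓞 k) : k) ?_
    have := congrArg (fun z : (𝓞 k)ˣ => ((z : 𝓞 k) : k)) hy
    simpa using this
  have hnorm : ∀ x : (𝓞 k)ˣ, ((x : 𝓞 k) : k) * τ ((x : 𝓞 k) : k) = -1 → x ∉ S := by
    rintro _ hx ⟨y, rfl⟩
    refine sq_ne_neg_one (((y : 𝓞 k) : k) * τ ((y : 𝓞 k) : k)) ?_
    rw [← hx]
    simp [mul_pow]
  have hε := hnorm ε h.conj_unit_mul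
  have hε' := hnorm (-ε) (by simpa using h.conj_unit_mul)
  have hfin : S.FiniteIndex := ⟨by omega⟩
  have : Finite ((𝓞 k)ˣ ⧸ S) := S.finite_quotient_of_finiteIndex
  have : Fintype ((𝓞 k)ˣ ⧸ S) := Fintype.ofFinite _
  have hSneg : ∀ x : (𝓞 k)ˣ, x⁻¹ ∈ S ↔ x ∈ S := fun x => inv_mem_iff
  let f : Fin 4 → (𝓞 k)ˣ ⧸ S := ![((1 : (𝓞 k)ˣ) : (𝓞 k)ˣ ⧸ S), ((-1 : (𝓞 k)ˣ) : (𝓞 k)ˣ ⧸ S),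
    ((ε : (𝓞 k)ˣ) : (𝓞 k)ˣ ⧸ S), ((-1 * ε : (𝓞 k)ˣ) : (𝓞 k)ˣ ⧸ S)]
  have hinj : Function.Injective f := by
    have hε1 := (hSneg ε).not.2 hε
    have hε2 := (hSneg (-ε)).not.2 hε'
    have hne : ∀ {x y : (𝓞 k)ˣ}, x⁻¹ * y ∉ S →
        ((x : (𝓞 k)ˣ ⧸ S)) ≠ (y : (𝓞 k)ˣ ⧸ S) := fun hx hxy => hx (QuotientGroup.eq.1 hxy)
    intro i j hij
    fin_cases i <;> fin_cases j <;> first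
      | rfl
      | exact absurd hij (hne (by simpa using hone))
      | exact absurd hij (hne (by simpa using hε))
      | exact absurd hij (hne (by simpa using hε'))
      | exact absurd hij (hne (by simpa using hε1))
      | exact absurd hij (hne (by simpa using hε2))
  have hbij : Function.Bijective f := by
    rw [Fintype.bijective_iff_injective_and_card]
    refine ⟨hinj, ?_⟩
    rw [← Nat.card_eq_fintype_card (α := (𝓞 k)ˣ ⧸ S)]
    exact hindex.symm
  obtain ⟨i, hi⟩ := hbij.2 (η : (𝓞 k)ˣ ⧸ S)
  have key : ∀ x : (𝓞 k)ˣ, (x : (𝓞 k)ˣ ⧸ S) = η → ∃ θ : (𝓞 k)ˣ, η = x * θ ^ 2 := by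
    intro x hx
    obtain ⟨θ, hθ⟩ := QuotientGroup.eq.1 hx
    exact ⟨θ, by rw [← powMonoidHom_apply, hθ, mul_inv_cancel_left]⟩
  fin_cases i
  · obtain ⟨θ, hθ⟩ := key _ hi
    exact ⟨θ, Or.inl (by simpa using hθ)⟩
  · obtain ⟨θ, hθ⟩ := key _ hi
    exact ⟨θ, Or.inr (Or.inl hθ)⟩
  · obtain ⟨θ, hθ⟩ := key _ hi
    exact ⟨θ, Or.inr (Or.inr (Or.inl hθ))⟩
  · obtain ⟨θ, hθ⟩ := key _ hi
    exact ⟨θ, Or.inr (Or.inr (Or.inr hθ))⟩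

lemma sq_mem_normUnits {δ : 𝓞 k} (θ : (𝓞 k)ˣ) : θ ^ 2 ∈ normUnits δ :=
  mem_normUnits.2 ⟨((θ : 𝓞 k) : k), 0, by simp⟩

/-- The index of the norm group is controlled by `ε` as soon as `-1` is a norm. -/
lemma index_normUnits_eq_one (h : IsBaseField l u v s ε τ) {δ : 𝓞 k} (h1 : -1 ∈ normUnits δ)
    (hε : ε ∈ normUnits δ) : (normUnits δ).index = 1 := by
  rw [Subgroup.index_eq_one, eq_top_iff]
  rintro η -
  obtain ⟨θ, rfl | rfl | rfl | rfl⟩ := h.unit_cases η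
  · exact sq_mem_normUnits θ
  · exact mul_mem h1 (sq_mem_normUnits θ)
  · exact mul_mem hε (sq_mem_normUnits θ)
  · exact mul_mem (mul_mem h1 hε) (sq_mem_normUnits θ)

lemma index_normUnits_eq_two (h : IsBaseField l u v s ε τ) {δ : 𝓞 k} (h1 : -1 ∈ normUnits δ)
    (hε : ε ∉ normUnits δ) : (normUnits δ).index = 2 := by
  rw [Subgroup.index_eq_two_iff]
  refine ⟨ε, fun η => ?_⟩
  have h2 : ∀ θ : (𝓞 k)ˣ, θ ^ 2 ∈ normUnits δ := sq_mem_normUnits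
  have hεε : ε * ε ∈ normUnits δ := by rw [← sq]; exact h2 ε
  have hiff : ∀ x ∈ normUnits δ, Xor (x * ε ∈ normUnits δ) (x ∈ normUnits δ) := fun x hx =>
    Or.inr ⟨hx, fun hxε => hε ((Subgroup.mul_mem_cancel_left _ hx).1 hxε)⟩
  have hiff' : ∀ x ∈ normUnits δ, Xor (ε * x * ε ∈ normUnits δ) (ε * x ∈ normUnits δ) :=
    fun x hx => Or.inl ⟨by rw [mul_right_comm]; exact mul_mem hεε hx,
      fun hxε => hε ((Subgroup.mul_mem_cancel_right _ hx).1 hxε)⟩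
  obtain ⟨θ, rfl | rfl | rfl | rfl⟩ := h.unit_cases η
  · exact hiff _ (h2 θ)
  · exact hiff _ (mul_mem h1 (h2 θ))
  · exact hiff' _ (h2 θ)
  · rw [show -1 * ε * θ ^ 2 = ε * (-1 * θ ^ 2) by rw [mul_comm (-1) ε, mul_assoc]]
    exact hiff' _ (mul_mem h1 (h2 θ))

end IsBaseField

/-- `a` is represented by the norm form `x² - b y²`. -/
def IsNormForm {F : Type*} [Field F] (a b : F) : Prop := ∃ x y : F, a = x ^ 2 - b * y ^ 2

namespace IsNormForm

variable {F : Type*} [Field F] {a a' b : F}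

lemma one : IsNormForm 1 b := ⟨1, 0, by simp⟩

lemma of_sq (x : F) : IsNormForm (x ^ 2) b := ⟨x, 0, by simp⟩

lemma mul (h : IsNormForm a b) (h' : IsNormForm a' b) : IsNormForm (a * a') b := by
  obtain ⟨x, y, rfl⟩ := h
  obtain ⟨z, w, rfl⟩ := h'
  exact ⟨x * z + b * y * w, x * w + y * z, by ring⟩

lemma prod {ι : Type*} {t : Finset ι} {f : ι → F} (h : ∀ i ∈ t, IsNormForm (f i) b) :
    IsNormForm (∏ i ∈ t, f i) b := by
  classical
  induction t using Finset.induction_on with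
  | empty => simpa using one
  | insert i t hi ih =>
    rw [Finset.prod_insert hi]
    exact (h i (Finset.mem_insert_self _ _)).mul
      (ih fun j hj => h j (Finset.mem_insert_of_mem hj))

lemma div (h : IsNormForm a b) (h' : IsNormForm a' b) : IsNormForm (a / a') b := by
  rcases eq_or_ne a' 0 with rfl | h0
  · simpa using ⟨0, 0, by simp⟩
  · have : a / a' = a * a' * (1 / a') ^ 2 := by field_simp
    rw [this]
    exact (h.mul h').mul (of_sq _)

lemma symm [CharZero F] (h : IsNormForm a b) (ha : a ≠ 0) : IsNormForm b a := by
  obtain ⟨x, y, hxy⟩ := h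
  rcases eq_or_ne y 0 with rfl | hy
  · have hx : x ≠ 0 := by rintro rfl; simp at hxy; exact ha hxy
    refine ⟨(b + 1) / 2, (b - 1) / (2 * x), ?_⟩
    rw [hxy]
    field_simp
    ring
  · refine ⟨x / y, 1 / y, ?_⟩
    rw [hxy]
    field_simp
    ring

lemma map {F' : Type*} [Field F'] (φ : F →+* F') (h : IsNormForm a b) :
    IsNormForm (φ a) (φ b) := by
  obtain ⟨x, y, rfl⟩ := h
  exact ⟨φ x, φ y, by simp⟩

lemma of_nat_sq_add_sq {m : ℕ} (h : ∃ x y, m = x ^ 2 + y ^ 2) : IsNormForm (m : F) (-1) := by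
  obtain ⟨x, y, rfl⟩ := h
  exact ⟨x, y, by push_cast; ring⟩

lemma of_prime {p : ℕ} (hp : p.Prime) (h4 : p % 4 ≠ 3) : IsNormForm (p : F) (-1) := by
  have : Fact p.Prime := ⟨hp⟩
  obtain ⟨x, y, h⟩ := Nat.Prime.sq_add_sq h4
  exact of_nat_sq_add_sq ⟨x, y, h.symm⟩

end IsNormForm

lemma mem_normUnits_iff {k : Type*} [Field k] [NumberField k] {δ : 𝓞 k} {u : (𝓞 k)ˣ} :
    u ∈ normUnits δ ↔ IsNormForm ((u : 𝓞 k) : k) (δ : k) := Iff.rfl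

namespace IsBaseField

variable {l u v : ℕ} {k : Type*} [Field k] [NumberField k] {s : 𝓞 k} {ε : (𝓞 k)ˣ}
  {τ : k ≃ₐ[ℚ] k}

lemma isNormForm_unit_mul (h : IsBaseField l u v s ε τ) :
    IsNormForm ((ε : 𝓞 k) * s : k) (-1) := by
  have hv0 : (v : k) ≠ 0 := by exact_mod_cast h.pos_v.ne'
  have h1 := congrArg (Nat.cast : ℕ → k) h.sq_add_one
  push_cast at h1
  have h2 : ((ε : 𝓞 k) * s : k) = (((ε : 𝓞 k) : k) ^ 2 + 1) / ((2 : ℕ) * (v : k)) := by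
    rw [h.coe_unit']
    field_simp
    push_cast
    linear_combination (2 * v ^ 2 - (v : k) ^ 2) * h.sq_s' - h1
  rw [h2]
  refine IsNormForm.div ⟨((ε : 𝓞 k) : k), 1, by ring⟩
    ((IsNormForm.of_prime Nat.prime_two (by norm_num)).mul (IsNormForm.of_nat_sq_add_sq ?_))
  obtain ⟨x, y, hxy⟩ := Nat.eq_sq_add_sq_of_isSquare_mod_neg_one (n := v) (by
    refine ⟨(u : ZMod v), ?_⟩
    have := congrArg (Nat.cast : ℕ → ZMod v) h.sq_add_one
    push_cast at this
    rw [CharP.cast_eq_zero (ZMod v) v] at this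
    linear_combination -this)
  exact ⟨x, y, hxy⟩

lemma unit_mul_pos (h : IsBaseField l u v s ε τ) (φ : k →+* ℝ) :
    0 < φ ((ε : 𝓞 k) * s) := by
  have h1 := congrArg φ h.sq_s'
  rw [map_pow, map_natCast] at h1
  have h2 := congrArg (Nat.cast : ℕ → ℝ) h.sq_add_one
  push_cast at h2
  rw [h.coe_unit']
  simp only [map_mul, map_add, map_natCast]
  generalize φ s = t at *
  have hl : (0 : ℝ) < l := by exact_mod_cast h.prime.pos
  have hv : (0 : ℝ) < v := by exact_mod_cast h.pos_v
  have hu : (0 : ℝ) < u := by exact_mod_cast h.pos_u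
  have h3 : ((u : ℝ) + v * t) * t = u * t + v * l := by rw [← h1]; ring
  rw [h3]
  by_contra hcon
  push Not at hcon
  have h4 : (v * l : ℝ) ^ 2 ≤ (u * -t) ^ 2 := pow_le_pow_left₀ (by positivity) (by linarith) 2
  have h5 : (u * -t : ℝ) ^ 2 = u ^ 2 * l := by rw [← h1]; ring
  rw [h5] at h4
  have h6 : (v * l : ℝ) ^ 2 = (u ^ 2 + 1) * l := by rw [h2]; ring
  nlinarith

lemma span_s_prime (h : IsBaseField l u v s ε τ) : (Ideal.span {s}).IsPrime := by
  refine Ideal.isPrime_of_irreducible_absNorm ?_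
  have h1 : Ideal.absNorm (Ideal.span {s}) ^ 2 = l ^ 2 := by
    rw [← map_pow, Ideal.span_singleton_pow, h.sq_s, Ideal.absNorm_span_natCast, ]
    rw [RingOfIntegers.rank, h.finrank]
  rw [Nat.pow_left_injective two_ne_zero h1]
  exact h.prime

lemma ramData_unit_mul (h : IsBaseField l u v s ε τ) :
    RamData ((ε : 𝓞 k) * s) (fun _ : Unit => Ideal.span {s}) := by
  obtain ⟨a, ha⟩ := h.four_dvd
  have hv4 := h.four_mod
  have hl8 := h.mod_eight
  have hs0 : s ≠ 0 := by
    rintro rfl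
    have := h.sq_s
    rw [zero_pow two_ne_zero] at this
    exact h.prime.ne_zero (by exact_mod_cast this.symm)
  refine ⟨mul_ne_zero ε.ne_zero hs0, fun _ => h.span_s_prime, fun _ _ _ => Subsingleton.elim _ _,
    ?_, Or.inl ⟨a * s + (v * l / 4 : ℕ), ?_⟩⟩
  · simp [Ideal.span_singleton_mul_left_unit ε.isUnit]
  · have h3 : v * l = 1 + 4 * (v * l / 4) := by
      have : (v * l) % 4 = 1 := by rw [Nat.mul_mod, hv4, show l % 4 = 1 by omega]
      omega
    have h4 := congrArg (Nat.cast : ℕ → 𝓞 k) h3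
    have h5 := congrArg (Nat.cast : ℕ → 𝓞 k) ha
    push_cast at h4 h5 ⊢
    rw [h.coe_unit, h5]
    linear_combination (v : 𝓞 k) * h.sq_s + h4

lemma isNormForm_unit_unit_mul (h : IsBaseField l u v s ε τ) :
    IsNormForm ((ε : 𝓞 k) : k) ((ε : 𝓞 k) * s) := by
  have := h.isTotallyReal
  have h1 := h.ramData_unit_mul.normUnits_eq_top Fintype.card_unit
    (fun φ => by simpa using h.unit_mul_pos φ) h.odd_classNumber
  have h2 : ε ∈ normUnits ((ε : 𝓞 k) * s) := h1 ▸ Subgroup.mem_top _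
  simpa using mem_normUnits_iff.1 h2

end IsBaseField

lemma span_pair_mul_span_pair_eq {R : Type*} [CommRing R] {r w w' : R} (hr : r ∣ w * w')
    (hc : IsCoprime (w + w') r) :
    Ideal.span {r, w} * Ideal.span {r, w'} = Ideal.span {r} := by
  rw [Ideal.span_pair_mul_span_pair]
  apply le_antisymm
  · rw [Ideal.span_le]
    rintro x (rfl | rfl | rfl | rfl)
    · exact Ideal.mem_span_singleton.2 (Dvd.intro _ rfl)
    · exact Ideal.mem_span_singleton.2 (Dvd.intro _ rfl)
    · exact Ideal.mem_span_singleton.2 (Dvd.intro_left _ rfl)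
    · exact Ideal.mem_span_singleton.2 hr
  · rw [Ideal.span_singleton_le_iff_mem]
    obtain ⟨a, b, hab⟩ := hc
    have h1 : r = a * (r * w') + a * (w * r) + b * (r * r) := by
      linear_combination -r * hab
    have key : a * (r * w') + a * (w * r) + b * (r * r) ∈
        Ideal.span ({r * r, r * w', w * r, w * w'} : Set R) := by
      refine add_mem (add_mem ?_ ?_) ?_ <;>
        refine Ideal.mul_mem_left _ _ (Ideal.subset_span ?_) <;> simp
    rwa [← h1] at key

/-- Halved coordinates of an element of odd integral norm are integral. -/
lemma exists_int_coords {l : ℕ} (hl : l.Prime) (hl8 : l % 8 = 1) {a b : ℚ} {X M : ℤ}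
    (hX : 2 * a = X) (hM : a ^ 2 - l * b ^ 2 = M) (hodd : M % 2 = 1) :
    ∃ x y : ℤ, a = x ∧ b = y := by
  have hl0 : (l : ℚ) ≠ 0 := by exact_mod_cast hl.ne_zero
  have h1 : IsIntegral ℤ (2 * b * l) := by
    refine IsIntegral.of_pow (n := 2) two_pos ?_
    have : (2 * b * l) ^ 2 = ((l * (X ^ 2 - 4 * M) : ℤ) : ℚ) := by
      push_cast
      rw [← hX, ← hM]
      ring
    rw [this]
    exact isIntegral_algebraMap (R := ℤ) (A := ℚ)
  obtain ⟨w, hw⟩ := IsIntegrallyClosed.isIntegral_iff.1 h1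
  have hw' : (w : ℚ) = 2 * b * l := hw
  have h2 : w ^ 2 = l * (X ^ 2 - 4 * M) := by
    have : (w : ℚ) ^ 2 = l * (X ^ 2 - 4 * M) := by
      rw [hw', ← hX, ← hM]
      ring
    exact_mod_cast this
  obtain ⟨Y, rfl⟩ := (Nat.prime_iff_prime_int.1 hl).dvd_of_dvd_pow (Dvd.intro _ h2.symm)
  have hY : (Y : ℚ) = 2 * b := by
    push_cast at hw'
    exact mul_left_cancel₀ hl0 (by rw [hw']; ring)
  have h3 : X ^ 2 - l * Y ^ 2 = 4 * M := by
    have : (X : ℚ) ^ 2 - l * Y ^ 2 = 4 * M := by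
      rw [hY, ← hX, ← hM]
      ring
    exact_mod_cast this
  have h4 : X % 2 = 0 ∧ Y % 2 = 0 := by
    obtain ⟨m, hm⟩ : ∃ m, l = 8 * m + 1 := ⟨l / 8, by omega⟩
    have h5 : X ^ 2 - Y ^ 2 = 4 * M + 8 * (m * Y ^ 2) := by
      rw [← h3, hm]; push_cast; ring
    rcases Int.even_or_odd' X with ⟨x, hx | hx⟩ <;> rcases Int.even_or_odd' Y with ⟨y, hy | hy⟩
    · omega
    · rw [hx, hy, show (2 * x) ^ 2 - (2 * y + 1) ^ 2 = 2 * (2 * x ^ 2 - 2 * y ^ 2 - 2 * y) - 1 by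
        ring] at h5
      omega
    · rw [hx, hy, show (2 * x + 1) ^ 2 - (2 * y) ^ 2 = 2 * (2 * x ^ 2 - 2 * y ^ 2 + 2 * x) + 1 by
        ring] at h5
      omega
    · have hx' := Int.even_mul_succ_self x
      have hy' := Int.even_mul_succ_self y
      obtain ⟨x', hx'⟩ := hx'
      obtain ⟨y', hy'⟩ := hy'
      rw [show X ^ 2 - Y ^ 2 = 4 * (x * (x + 1)) - 4 * (y * (y + 1)) by rw [hx, hy]; ring, hx',
        hy'] at h5
      omega
  obtain ⟨x, rfl⟩ := Int.dvd_of_emod_eq_zero h4.1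
  obtain ⟨y, rfl⟩ := Int.dvd_of_emod_eq_zero h4.2
  push_cast at hX hY
  exact ⟨x, y, by linarith, by linarith⟩

namespace IsBaseField

variable {l u v : ℕ} {k : Type*} [Field k] [NumberField k] {s : 𝓞 k} {ε : (𝓞 k)ˣ}
  {τ : k ≃ₐ[ℚ] k}

open IsQuadExt in
lemma exists_intCast (h : IsBaseField l u v s ε τ) {x : 𝓞 k} (hx : conjInt τ x = x) :
    ∃ m : ℤ, x = m := by
  obtain ⟨a, rfl⟩ := h.ext.exists_int_of_conjInt_eq hx
  exact ⟨Rat.ringOfIntegersEquiv a, by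
    rw [← map_intCast (algebraMap (𝓞 ℚ) (𝓞 k))]
    congr 1
    apply Rat.ringOfIntegersEquiv.injective
    simp⟩

lemma absNorm_span_natCast (h : IsBaseField l u v s ε τ) (r : ℕ) :
    Ideal.absNorm (Ideal.span {(r : 𝓞 k)}) = r ^ 2 := by
  rw [Ideal.absNorm_span_natCast, RingOfIntegers.rank, h.finrank]

lemma span_natCast_prime (h : IsBaseField l u v s ε τ) {p : ℕ} (hp : p.Prime)
    (hlp : ¬ IsSquare (l : ZMod p)) : (Ideal.span {(p : 𝓞 k)}).IsPrime := by
  have hne : Ideal.span {(p : 𝓞 k)} ≠ ⊤ := fun ht => by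
    have := h.absNorm_span_natCast p
    rw [ht, Ideal.absNorm_top] at this
    have := hp.one_lt
    nlinarith
  obtain ⟨P, hP, hle⟩ := Ideal.exists_le_maximal _ hne
  obtain ⟨A, hA⟩ := Ideal.dvd_iff_le.2 hle
  have hmul := congrArg Ideal.absNorm hA
  rw [h.absNorm_span_natCast, map_mul] at hmul
  obtain ⟨i, hi, hPi⟩ := (Nat.dvd_prime_pow hp).1 (Dvd.intro _ hmul.symm)
  interval_cases i
  · rw [pow_zero, Ideal.absNorm_eq_one_iff] at hPi
    exact absurd hPi hP.ne_top
  · exfalso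
    rw [pow_one] at hPi
    have : Finite (𝓞 k ⧸ P) := Ideal.finiteQuotientOfFreeOfNeBot P (by
      rintro rfl
      rw [Ideal.absNorm_bot] at hPi
      exact hp.ne_zero hPi.symm)
    have : Fintype (𝓞 k ⧸ P) := Fintype.ofFinite _
    have hcard : Fintype.card (𝓞 k ⧸ P) = p := by
      rw [← Nat.card_eq_fintype_card, ← hPi]; rfl
    have e := ZMod.ringEquivOfPrime (𝓞 k ⧸ P) hp hcard
    refine hlp ⟨e.symm (Ideal.Quotient.mk P s), ?_⟩
    rw [← map_mul, ← map_mul, ← sq, h.sq_s]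
    simp
  · have h1 : Ideal.absNorm A = 1 := by
      rw [hPi] at hmul
      exact Nat.eq_of_mul_eq_mul_left (pow_pos hp.pos 2) (by rw [← hmul, mul_one])
    rw [Ideal.absNorm_eq_one_iff] at h1
    rw [hA, h1, Ideal.mul_top]
    exact hP.isPrime

open IsQuadExt in
lemma split_of_dvd_mul_conj (h : IsBaseField l u v s ε τ) {r : ℕ} (hr : r.Prime) {w w' : 𝓞 k}
    (hw : conjInt τ w = w') (hdvd : (r : 𝓞 k) ∣ w * w') (hc : IsCoprime (w + w') (r : 𝓞 k)) :
    ∃ A B : Ideal (𝓞 k), A.IsPrime ∧ B.IsPrime ∧ A ≠ B ∧ B = A.map (conjInt τ) ∧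
      A * B = Ideal.span {(r : 𝓞 k)} := by
  have hAB := span_pair_mul_span_pair_eq hdvd hc
  set A := Ideal.span {(r : 𝓞 k), w}
  set B := Ideal.span {(r : 𝓞 k), w'}
  have hmap : A.map (conjInt τ) = B := by
    rw [Ideal.map_span, Set.image_pair, hw, map_natCast]
  have hnorm := congrArg Ideal.absNorm hAB
  rw [map_mul, h.absNorm_span_natCast] at hnorm
  have hBtop : B ≠ ⊤ := by
    intro ht
    have hAtop : A = ⊤ := by
      rw [← h.ext.map_map_conjInt A, hmap, ht, Ideal.map_top]
    rw [hAtop, ht, Ideal.absNorm_top] at hnorm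
    have := hr.one_lt
    nlinarith
  have hAtop : A ≠ ⊤ := by
    intro ht
    rw [ht, Ideal.map_top] at hmap
    exact hBtop hmap.symm
  obtain ⟨h1, h2⟩ := (Nat.Prime.mul_eq_prime_sq_iff hr (mt Ideal.absNorm_eq_one_iff.1 hAtop)
    (mt Ideal.absNorm_eq_one_iff.1 hBtop)).1 hnorm
  refine ⟨A, B, Ideal.isPrime_of_irreducible_absNorm (h1 ▸ hr),
    Ideal.isPrime_of_irreducible_absNorm (h2 ▸ hr), fun heq => hAtop ?_, hmap.symm, hAB⟩
  obtain ⟨a, b, hab⟩ := hc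
  rw [Ideal.eq_top_iff_one, ← hab]
  have hrA : (r : 𝓞 k) ∈ A := Ideal.subset_span (by simp)
  have hwA : w ∈ A := Ideal.subset_span (by simp)
  have hwA' : w' ∈ A := heq ▸ Ideal.subset_span (by simp)
  exact add_mem (Ideal.mul_mem_left _ _ (add_mem hwA hwA')) (Ideal.mul_mem_left _ _ hrA)

lemma intCast_isCoprime {R : Type*} [CommRing R] {a b : ℤ} (h : IsCoprime a b) :
    IsCoprime (a : R) (b : R) := by
  simpa using h.map (Int.castRingHom R)

open IsQuadExt in
lemma split_of_isSquare (h : IsBaseField l u v s ε τ) {r : ℕ} (hr : r.Prime) (hr2 : r ≠ 2)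
    (hrl : r ≠ l) (hsq : IsSquare (l : ZMod r)) :
    ∃ A B : Ideal (𝓞 k), A.IsPrime ∧ B.IsPrime ∧ A ≠ B ∧ B = A.map (conjInt τ) ∧
      A * B = Ideal.span {(r : 𝓞 k)} := by
  have : Fact r.Prime := ⟨hr⟩
  obtain ⟨c, hc⟩ := hsq
  obtain ⟨C, rfl⟩ := ZMod.intCast_surjective c
  have hdvd : (r : ℤ) ∣ C ^ 2 - l := by
    rw [← ZMod.intCast_zmod_eq_zero_iff_dvd]
    push_cast
    rw [hc]; ring
  have hrC : ¬ (r : ℤ) ∣ C := by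
    intro hd
    rw [← ZMod.intCast_zmod_eq_zero_iff_dvd] at hd
    rw [hd, mul_zero, CharP.cast_eq_zero_iff (ZMod r) r] at hc
    exact hrl ((Nat.prime_dvd_prime_iff_eq hr h.prime).1 hc)
  have hp := Nat.prime_iff_prime_int.1 hr
  have hcop : IsCoprime (-2 * C) (r : ℤ) := by
    refine IsCoprime.mul_left ?_ (hp.coprime_iff_not_dvd.2 hrC).symm
    exact (Nat.isCoprime_iff_coprime.2 ((Nat.coprime_primes Nat.prime_two hr).2 hr2.symm)).neg_left
  refine h.split_of_dvd_mul_conj hr (w := s - C) (w' := -s - C) ?_ ?_ ?_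
  · ext
    simp [h.conj_s]
  · obtain ⟨e, he⟩ := hdvd
    refine ⟨e, ?_⟩
    have := congrArg (Int.cast : ℤ → 𝓞 k) he
    push_cast at this
    linear_combination this - h.sq_s
  · have := intCast_isCoprime (R := 𝓞 k) hcop
    rw [show s - (C : 𝓞 k) + (-s - C) = ((-2 * C : ℤ) : 𝓞 k) by push_cast; ring]
    simpa using this

open IsQuadExt in
lemma split_two (h : IsBaseField l u v s ε τ) :
    ∃ A B : Ideal (𝓞 k), A.IsPrime ∧ B.IsPrime ∧ A ≠ B ∧ B = A.map (conjInt τ) ∧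
      A * B = Ideal.span {((2 : ℕ) : 𝓞 k)} := by
  obtain ⟨m, hm⟩ : ∃ m, l = 8 * m + 1 := ⟨l / 8, by have := h.mod_eight; omega⟩
  have hmk : (l : k) = 8 * m + 1 := by rw [hm]; push_cast; ring
  have hsq := h.sq_s'
  have hint : IsIntegral ℤ ((1 + s : k) / 2) := by
    refine ⟨Polynomial.X ^ 2 + (-Polynomial.X - Polynomial.C (2 * m : ℤ)), ?_, ?_⟩
    · refine Polynomial.monic_X_pow_add ?_
      refine (Polynomial.degree_sub_le _ _).trans_lt (max_lt ?_ ?_)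
      · rw [Polynomial.degree_neg]
        exact (Polynomial.degree_X_le).trans_lt (by norm_num)
      · exact Polynomial.degree_C_le.trans_lt (by norm_num)
    · simp only [Polynomial.eval₂_add, Polynomial.eval₂_sub, Polynomial.eval₂_neg,
        Polynomial.eval₂_pow, Polynomial.eval₂_X, Polynomial.eval₂_C]
      simp only [algebraMap_int_eq, eq_intCast]
      push_cast
      linear_combination (1 / 4 : k) * (hsq + hmk)
  set ω : 𝓞 k := ⟨(1 + s : k) / 2, hint⟩
  refine h.split_of_dvd_mul_conj Nat.prime_two (w := ω) (w' := 1 - ω) ?_ ⟨-m, ?_⟩ ⟨1, 0, by ring⟩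
  · ext
    change τ ((1 + s : k) / 2) = 1 - (1 + s : k) / 2
    rw [map_div₀, map_add, map_one, h.conj_s, map_ofNat]
    ring
  · ext
    change (1 + s : k) / 2 * (1 - (1 + s : k) / 2) = ((((2 : ℕ) : 𝓞 k) * -(m : 𝓞 k) : 𝓞 k) : k)
    simp only [map_mul, map_neg, map_natCast]
    push_cast
    linear_combination (-1 / 4 : k) * (hsq + hmk)

end IsBaseField

namespace IsQuadExt

variable {k K : Type*} [Field k] [NumberField k] [Field K] [NumberField K] [Algebra k K]
  {δ : 𝓞 k} {d : K} {τ : K ≃ₐ[k] K}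

/-- If an ideal has norm `(r)`, then `r ^ h` is a norm up to a unit of the base. -/
lemma exists_mul_conjInt_eq (h : IsQuadExt δ d τ) {R : Ideal (𝓞 K)} {r : 𝓞 k} (hr : r ≠ 0)
    (hR : R * R.map (conjInt τ) = Ideal.span {algebraMap (𝓞 k) (𝓞 K) r}) :
    ∃ (α : 𝓞 K) (η : (𝓞 k)ˣ),
      α * conjInt τ α = algebraMap (𝓞 k) (𝓞 K) (η * r ^ classNumber K) := by
  have hinj : Function.Injective (algebraMap (𝓞 k) (𝓞 K)) :=
    FaithfulSMul.algebraMap_injective _ _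
  have hr' : algebraMap (𝓞 k) (𝓞 K) r ≠ 0 := fun h0 => hr (hinj (by rw [h0, map_zero]))
  have hR0 : R ≠ ⊥ := by
    rintro rfl
    rw [Ideal.bot_mul, eq_comm, Ideal.span_singleton_eq_bot] at hR
    exact hr' hR
  have hR0' : R ∈ (Ideal (𝓞 K))⁰ := mem_nonZeroDivisors_of_ne_zero hR0
  have hprin : (R ^ classNumber K).IsPrincipal := by
    rw [← ClassGroup.mk0_eq_one_iff (pow_mem hR0' _)]
    have := pow_card_eq_one (x := ClassGroup.mk0 ⟨R, hR0'⟩)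
    rw [← map_pow] at this
    exact this
  obtain ⟨α, hα⟩ := hprin
  have hα' : R ^ classNumber K = Ideal.span {α} := hα
  have hspan : Ideal.span {α * conjInt τ α} =
      Ideal.span {algebraMap (𝓞 k) (𝓞 K) r ^ classNumber K} := by
    rw [← Ideal.span_singleton_pow, ← hR, mul_pow, ← Ideal.map_pow, hα', Ideal.map_span,
      Set.image_singleton, Ideal.span_singleton_mul_span_singleton]
  obtain ⟨U, hU⟩ := Ideal.span_singleton_eq_span_singleton.1 hspan.symm
  have hfix : conjInt τ (α * conjInt τ α) = α * conjInt τ α := by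
    rw [map_mul, h.conjInt_conjInt, mul_comm]
  have hUfix : conjInt τ (U : 𝓞 K) = U := by
    rw [← hU, map_mul, map_pow, conjInt_algebraMap] at hfix
    exact mul_left_cancel₀ (pow_ne_zero _ hr') hfix
  have hUfix' : conjInt τ ((U⁻¹ : (𝓞 K)ˣ) : 𝓞 K) = (U⁻¹ : (𝓞 K)ˣ) := by
    have : conjInt τ (U : 𝓞 K) * conjInt τ ((U⁻¹ : (𝓞 K)ˣ) : 𝓞 K) = 1 := by
      rw [← map_mul, Units.mul_inv, map_one]
    rw [hUfix] at this
    exact Units.eq_inv_of_mul_eq_one_left this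
  obtain ⟨η, hη⟩ := h.exists_int_of_conjInt_eq hUfix
  obtain ⟨η', hη'⟩ := h.exists_int_of_conjInt_eq hUfix'
  have h1 : η * η' = 1 := hinj (by rw [map_mul, hη, hη', Units.mul_inv, map_one])
  refine ⟨α, ⟨η, η', h1, by rw [mul_comm, h1]⟩, ?_⟩
  rw [← hU, map_mul, map_pow, hη, mul_comm]

lemma isNormForm_of_mul_conjInt (h : IsQuadExt δ d τ) {α : 𝓞 K} {a : 𝓞 k}
    (hα : α * conjInt τ α = algebraMap (𝓞 k) (𝓞 K) a) : IsNormForm (a : k) (δ : k) := by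
  obtain ⟨x, y, hxy⟩ := h.rep α
  refine ⟨x, y, (algebraMap k K).injective ?_⟩
  have h1 := congrArg (algebraMap (𝓞 K) K) hα
  rw [map_mul] at h1
  change (α : K) * τ α = algebraMap k K a at h1
  rw [← h1, hxy, h.norm_rep]

end IsQuadExt

namespace IsBaseField

variable {l u v : ℕ} {k : Type*} [Field k] [NumberField k] {s : 𝓞 k} {ε : (𝓞 k)ˣ}
  {τ : k ≃ₐ[ℚ] k}

lemma isNormForm_of_inert (h : IsBaseField l u v s ε τ) {p : ℕ} (hp : p.Prime) (hp4 : p % 4 = 1)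
    (hlp : ¬ IsSquare (l : ZMod p)) : IsNormForm ((ε : 𝓞 k) : k) (p : k) := by
  have := h.isTotallyReal
  have hr : RamData (p : 𝓞 k) (fun _ : Unit => Ideal.span {(p : 𝓞 k)}) := by
    refine ⟨by exact_mod_cast hp.ne_zero, fun _ => h.span_natCast_prime hp hlp,
      fun _ _ _ => Subsingleton.elim _ _, by simp, Or.inl ⟨(p / 4 : ℕ), ?_⟩⟩
    have : p = 1 + 4 * (p / 4) := by omega
    conv_lhs => rw [this]
    push_cast
    rfl
  have h1 := hr.normUnits_eq_top Fintype.card_unit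
    (fun φ => by simpa using hp.pos) h.odd_classNumber
  have h2 : ε ∈ normUnits (p : 𝓞 k) := h1 ▸ Subgroup.mem_top _
  simpa using mem_normUnits_iff.1 h2

/-- If `ε` is not a norm from `k(√m)`, where `m` splits in `k`, then an odd power of a suitable
auxiliary prime is a norm up to a power of `ε`. -/
lemma exists_isNormForm_pow (h : IsBaseField l u v s ε τ) {m : ℕ} (hm0 : 0 < m)
    {𝔭 : Bool → Ideal (𝓞 k)} (hr : RamData (m : 𝓞 k) 𝔭) (hm : IsNormForm (m : k) (-1))
    (hε : ¬ IsNormForm ((ε : 𝓞 k) : k) (m : k)) {r : ℕ} (hrp : r.Prime) (hr2 : r ≠ 2)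
    (hrm : ¬ r ∣ m) (hrl : ¬ IsSquare (l : ZMod r)) (hsq : IsSquare ((l * m : ℕ) : ZMod r)) :
    ∃ j, Odd j ∧ (IsNormForm ((r : k) ^ j) (m : k) ∨
      IsNormForm ((ε : 𝓞 k) * (r : k) ^ j) (m : k)) := by
  have := h.isTotallyReal
  have : Fact r.Prime := ⟨hrp⟩
  obtain ⟨K, _, _, _, d, τ', hK, hfin, hτ, hcard⟩ :=
    hr.exists_ext (fun φ => by simpa using hm0) h.odd_classNumber
  have hneg : IsNormForm (-1 : k) (m : k) := hm.symm (by exact_mod_cast hm0.ne')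
  rw [h.index_normUnits_eq_two (mem_normUnits_iff.2 (by simpa using hneg))
    (fun h' => hε (by simpa using mem_normUnits_iff.1 h')), Fintype.card_bool] at hcard
  have hoddK := odd_classNumber_of_card_twoTorsion (K := K) (by omega)
  obtain ⟨c, hc⟩ := hsq
  obtain ⟨C, rfl⟩ := ZMod.intCast_surjective c
  have hdvd : (r : ℤ) ∣ C ^ 2 - (l * m : ℕ) := by
    rw [← ZMod.intCast_zmod_eq_zero_iff_dvd]
    push_cast at hc ⊢
    rw [hc]; ring
  have hrl' : ¬ r ∣ l := fun hd => hrl (by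
    rw [← CharP.cast_eq_zero_iff (ZMod r) r] at hd
    rw [hd]; exact ⟨0, by simp⟩)
  have hrC : ¬ (r : ℤ) ∣ C := by
    intro hd
    rw [← ZMod.intCast_zmod_eq_zero_iff_dvd] at hd
    rw [hd, mul_zero, CharP.cast_eq_zero_iff (ZMod r) r, hrp.dvd_mul] at hc
    exact hc.elim hrl' hrm
  have hp := Nat.prime_iff_prime_int.1 hrp
  have hcop : IsCoprime (-2 * C) (r : ℤ) := by
    refine IsCoprime.mul_left ?_ (hp.coprime_iff_not_dvd.2 hrC).symm
    exact (Nat.isCoprime_iff_coprime.2 ((Nat.coprime_primes Nat.prime_two hrp).2 hr2.symm)).neg_left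
  obtain ⟨D, hD, hD2, hDc⟩ := hτ.exists_sqrt_int
  set S := algebraMap (𝓞 k) (𝓞 K) s
  have hS : S ^ 2 = l := by rw [← map_pow, h.sq_s, map_natCast]
  have hR : Ideal.span {(r : 𝓞 K), S * D - C} *
      (Ideal.span {(r : 𝓞 K), S * D - C}).map (IsQuadExt.conjInt τ') =
      Ideal.span {algebraMap (𝓞 k) (𝓞 K) r} := by
    rw [Ideal.map_span, Set.image_pair, map_natCast, map_natCast, map_sub, map_mul, map_intCast,
      hDc, IsQuadExt.conjInt_algebraMap]
    refine span_pair_mul_span_pair_eq ?_ ?_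
    · obtain ⟨e, he⟩ := hdvd
      refine ⟨e, ?_⟩
      have := congrArg (Int.cast : ℤ → 𝓞 K) he
      rw [map_natCast] at hD2
      push_cast at this
      linear_combination this - D ^ 2 * hS - l * hD2
    · have := intCast_isCoprime (R := 𝓞 K) hcop
      rw [show S * D - (C : 𝓞 K) + (S * -D - C) = ((-2 * C : ℤ) : 𝓞 K) by push_cast; ring]
      simpa using this
  obtain ⟨α, η, hα⟩ := hτ.exists_mul_conjInt_eq (by exact_mod_cast hrp.ne_zero) hR
  have key := hτ.isNormForm_of_mul_conjInt hα
  refine ⟨classNumber K, hoddK, ?_⟩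
  obtain ⟨θ, hθ⟩ := h.unit_cases η
  set j := classNumber K
  have hθ0 : ((θ : 𝓞 k) : k) ≠ 0 := by simp
  rcases hθ with rfl | rfl | rfl | rfl
  · left
    convert key.div (IsNormForm.of_sq (θ : k)) using 1
    · simp
    · simp
  · left
    convert (key.div (IsNormForm.of_sq (θ : k))).mul hneg using 1
    · simp; field_simp
    · simp
  · right
    convert key.div (IsNormForm.of_sq (θ : k)) using 1
    · simp; field_simp
    · simp
  · right
    convert (key.div (IsNormForm.of_sq (θ : k))).mul hneg using 1
    · simp; field_simp
    · simp

end IsBaseField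

namespace PadicInt

variable {p : ℕ} [hp : Fact p.Prime]

lemma exists_sq_eq {a b : ℤ_[p]} (h : ‖b ^ 2 - a‖ < ‖2 * b‖ ^ 2) : ∃ c : ℤ_[p], c ^ 2 = a := by
  have h1 : (Polynomial.X ^ 2 - Polynomial.C a).derivative = Polynomial.C 2 * Polynomial.X := by
    rw [Polynomial.derivative_sub, Polynomial.derivative_X_sq, Polynomial.derivative_C, sub_zero]
  obtain ⟨z, hz, -⟩ := hensels_lemma (p := p) (F := Polynomial.X ^ 2 - Polynomial.C a) (a := b)
    (by rw [h1]; simpa using h)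
  exact ⟨z, by simpa [sub_eq_zero] using hz⟩

lemma exists_sq_eq_of_isSquare {a : ℕ} (hp2 : p ≠ 2) (ha : ¬ p ∣ a) (h : IsSquare (a : ZMod p)) :
    ∃ c : ℤ_[p], c ^ 2 = a := by
  obtain ⟨b, hb⟩ := h
  obtain ⟨B, rfl⟩ := ZMod.intCast_surjective b
  have hdvd : (p : ℤ) ∣ B ^ 2 - a := by
    rw [← ZMod.intCast_zmod_eq_zero_iff_dvd]
    push_cast
    rw [hb]; ring
  have hpB : ¬ (p : ℤ) ∣ 2 * B := by
    intro hd
    rcases (Nat.prime_iff_prime_int.1 hp.out).dvd_or_dvd hd with h2 | h2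
    · exact hp2 ((Nat.prime_dvd_prime_iff_eq hp.out Nat.prime_two).1 (by exact_mod_cast h2))
    · refine ha (by
        have := (dvd_sub_right (dvd_pow h2 two_ne_zero)).1 hdvd
        exact_mod_cast this)
  have h1 : ‖((2 * B : ℤ) : ℤ_[p])‖ = 1 := by
    refine le_antisymm (norm_le_one _) (not_lt.1 fun hlt => hpB ?_)
    exact norm_intCast_lt_one_iff.1 hlt
  have h2 : ‖((B ^ 2 - a : ℤ) : ℤ_[p])‖ < 1 := norm_intCast_lt_one_iff.2 hdvd
  refine exists_sq_eq (b := (B : ℤ_[p])) ?_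
  push_cast at h1 h2
  rw [h1, one_pow]
  exact h2

lemma exists_sq_eq_of_mod_eight {a : ℕ} (ha : a % 8 = 1) : ∃ c : ℤ_[2], c ^ 2 = a := by
  have h1 : ‖(2 : ℤ_[2])‖ = 2⁻¹ := by simpa using norm_p (p := 2)
  have h2 : ‖((1 - a : ℤ) : ℤ_[2])‖ ≤ (2 : ℝ) ^ (-(3 : ℕ) : ℤ) := by
    have := (norm_le_pow_iff_mem_span_pow (p := 2) ((1 - a : ℤ) : ℤ_[2]) 3).2 (by
      rw [Ideal.mem_span_singleton]
      obtain ⟨m, rfl⟩ : ∃ m, a = 8 * m + 1 := ⟨a / 8, by omega⟩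
      exact ⟨-m, by push_cast; ring⟩)
    simpa using this
  refine exists_sq_eq (b := 1) ?_
  push_cast at h2
  rw [mul_one, h1, one_pow]
  exact h2.trans_lt (by norm_num)

/-- A unit represented by `x² - δ y²` over `ℚ_p`, with `δ` a uniformizer, is represented over
`ℤ_p`. -/
lemma exists_eq_of_isNormForm {δ w : ℤ_[p]} (hδ : ‖δ‖ = (p : ℝ)⁻¹) (hw : ‖w‖ = 1)
    (h : IsNormForm (w : ℚ_[p]) (δ : ℚ_[p])) : ∃ x y : ℤ_[p], w = x ^ 2 - δ * y ^ 2 := by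
  obtain ⟨x, y, hxy⟩ := h
  have hp1 : (1 : ℝ) < p := by exact_mod_cast hp.out.one_lt
  have hp0 : (p : ℝ) ≠ 0 := by positivity
  have hx2 : ‖x ^ 2‖ = ‖x‖ ^ 2 := norm_pow _ _
  have hy2 : ‖(δ : ℚ_[p]) * y ^ 2‖ = (p : ℝ)⁻¹ * ‖y‖ ^ 2 := by
    rw [norm_mul, norm_pow, padic_norm_e_of_padicInt, hδ]
  have hw' : ‖x ^ 2 - (δ : ℚ_[p]) * y ^ 2‖ = 1 := by rw [← hxy, padic_norm_e_of_padicInt, hw]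
  have hne : ‖x ^ 2‖ ≠ ‖(δ : ℚ_[p]) * y ^ 2‖ := by
    intro heq
    rw [hx2, hy2] at heq
    rcases eq_or_ne y 0 with rfl | hy
    · simp at heq
      simp [heq] at hw'
    · rcases eq_or_ne x 0 with rfl | hx
      · simp [hp0, hy] at heq
      · rw [Padic.norm_eq_zpow_neg_valuation hx, Padic.norm_eq_zpow_neg_valuation hy, ← zpow_natCast,
          ← zpow_natCast, ← zpow_mul, ← zpow_mul, ← zpow_neg_one, ← zpow_add₀ hp0] at heq
        have := zpow_right_injective₀ (by positivity) hp1.ne' heq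
        push_cast at this
        omega
  have hmax := Padic.add_eq_max_of_ne (q := x ^ 2) (r := -((δ : ℚ_[p]) * y ^ 2)) (by rwa [norm_neg])
  rw [← sub_eq_add_neg, hw', norm_neg, hx2, hy2] at hmax
  have hx1 : ‖x‖ ≤ 1 := (sq_le_one_iff₀ (norm_nonneg _)).1 (hmax ▸ le_max_left _ _)
  have hy1 : ‖y‖ ≤ 1 := by
    rcases eq_or_ne y 0 with rfl | hy
    · simp
    have h1 : (p : ℝ)⁻¹ * ‖y‖ ^ 2 ≤ 1 := hmax ▸ le_max_right _ _
    rw [Padic.norm_eq_zpow_neg_valuation hy] at h1 ⊢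
    rw [← zpow_natCast, ← zpow_mul, ← zpow_neg_one, ← zpow_add₀ hp0, ← zpow_zero (p : ℝ),
      zpow_le_zpow_iff_right₀ hp1] at h1
    rw [← zpow_zero (p : ℝ), zpow_le_zpow_iff_right₀ hp1]
    push_cast at h1
    omega
  exact ⟨⟨x, hx1⟩, ⟨y, hy1⟩, Subtype.ext (by push_cast; exact hxy)⟩

lemma isSquare_toZMod_of_isNormForm {δ w : ℤ_[p]} (hδ : ‖δ‖ = (p : ℝ)⁻¹) (hw : ‖w‖ = 1)
    (h : IsNormForm (w : ℚ_[p]) (δ : ℚ_[p])) : IsSquare (toZMod w) := by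
  obtain ⟨x, y, rfl⟩ := exists_eq_of_isNormForm hδ hw h
  have hp1 : (1 : ℝ) < p := by exact_mod_cast hp.out.one_lt
  have h0 : toZMod δ = 0 := by
    rw [← RingHom.mem_ker, ker_toZMod, IsLocalRing.mem_maximalIdeal, mem_nonunits, hδ]
    exact inv_lt_one_of_one_lt₀ hp1
  exact ⟨toZMod x, by simp [h0, sq]⟩

lemma toZModPow_sq_eq_one_of_isNormForm {δ w e : ℤ_[2]} (hδ : δ = 2 + 8 * e) (hw : ‖w‖ = 1)
    (h : IsNormForm (w : ℚ_[2]) (δ : ℚ_[2])) : toZModPow 4 w ^ 2 = 1 := by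
  have h2 : ‖(2 : ℤ_[2])‖ = 2⁻¹ := by simpa using norm_p (p := 2)
  have hδ' : ‖δ‖ = ((2 : ℕ) : ℝ)⁻¹ := by
    have h4 : ‖1 + 4 * e‖ = 1 := by
      have h5 : ‖(4 : ℤ_[2]) * e‖ < 1 := by
        rw [show (4 : ℤ_[2]) = 2 * 2 by norm_num, norm_mul, norm_mul, h2]
        have := norm_le_one e
        linarith
      rw [norm_add_eq_max_of_ne (by rw [norm_one]; exact h5.ne'), norm_one, max_eq_left h5.le]
    rw [hδ, show 2 + 8 * e = 2 * (1 + 4 * e) by ring, norm_mul, h4, h2]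
    norm_num
  obtain ⟨x, y, hxy⟩ := exists_eq_of_isNormForm hδ' hw h
  have hunit : IsUnit (toZModPow 4 w) := (isUnit_iff.2 hw).map (toZModPow (p := 2) 4)
  rw [hxy, hδ] at hunit ⊢
  simp only [map_sub, map_mul, map_add, map_pow, map_ofNat] at hunit ⊢
  generalize toZModPow (p := 2) 4 x = X at *
  generalize toZModPow (p := 2) 4 y = Y at *
  generalize toZModPow (p := 2) 4 e = E at *
  have h8 : X ^ 2 - (2 + 8 * E) * Y ^ 2 = X ^ 2 - 2 * Y ^ 2 ∨
      X ^ 2 - (2 + 8 * E) * Y ^ 2 = X ^ 2 - 2 * Y ^ 2 - 8 := by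
    have : ∀ z : ZMod (2 ^ 4), 8 * z = 0 ∨ 8 * z = 8 := by decide
    rcases this (E * Y ^ 2) with h | h
    · left; linear_combination -h
    · right; linear_combination -h
  have key : ∀ X Y : ZMod (2 ^ 4), 8 * (X ^ 2 - 2 * Y ^ 2) = 8 → (X ^ 2 - 2 * Y ^ 2) ^ 2 = 1 ∧
      (X ^ 2 - 2 * Y ^ 2 - 8) ^ 2 = 1 := by decide
  have hodd : ∀ z : ZMod (2 ^ 4), 8 * z = 8 ∨ 8 * z = 0 := by decide
  have h16 : (8 * 8 : ZMod (2 ^ 4)) = 0 := by decide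
  have h80 : (8 : ZMod (2 ^ 4)) ≠ 0 := by decide
  have hne := fun h0 => h80 (hunit.mul_left_eq_zero.1 h0)
  rcases h8 with h8 | h8 <;> rw [h8] at hne ⊢
  · exact (key X Y ((hodd _).resolve_right hne)).1
  · refine (key X Y ((hodd _).resolve_right fun h0 => hne ?_)).2
    linear_combination h0 - h16

end PadicInt

lemma isSquare_mul_of_not_isSquare {F : Type*} [Field F] [Finite F] {a b : F}
    (ha : ¬ IsSquare a) (hb : ¬ IsSquare b) : IsSquare (a * b) := by
  classical
  have := Fintype.ofFinite F
  rcases eq_or_ne (a * b) 0 with h0 | h0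
  · exact h0 ▸ IsSquare.zero
  · rw [← quadraticChar_one_iff_isSquare h0, map_mul,
      quadraticChar_neg_one_iff_not_isSquare.2 ha, quadraticChar_neg_one_iff_not_isSquare.2 hb]
    norm_num

lemma not_isSquare_pow {F : Type*} [Field F] {a : F} (ha : ¬ IsSquare a) {j : ℕ} (hj : Odd j) :
    ¬ IsSquare (a ^ j) := by
  obtain ⟨i, rfl⟩ := hj
  have ha0 : a ≠ 0 := by rintro rfl; exact ha IsSquare.zero
  intro h
  have := h.div (⟨a ^ i, by ring⟩ : IsSquare (a ^ (2 * i)))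
  rw [pow_succ, mul_div_cancel_left₀ _ (pow_ne_zero _ ha0)] at this
  exact ha this

/-- Dirichlet's theorem for a pair of coprime moduli. -/
lemma exists_prime_eq_eq {m n : ℕ} [NeZero m] [NeZero n] (hmn : m.Coprime n) {a : ZMod m}
    {b : ZMod n} (ha : IsUnit a) (hb : IsUnit b) (N : ℕ) :
    ∃ r > N, r.Prime ∧ (r : ZMod m) = a ∧ (r : ZMod n) = b := by
  have : NeZero (m * n) := ⟨mul_ne_zero (NeZero.ne m) (NeZero.ne n)⟩
  set e := ZMod.chineseRemainder hmn
  have hu : IsUnit (e.symm (a, b)) := by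
    rw [MulEquiv.isUnit_map, Prod.isUnit_iff]
    exact ⟨ha, hb⟩
  obtain ⟨r, hr, hrp, heq⟩ := Nat.forall_exists_prime_gt_and_eq_mod hu N
  have h1 : e (r : ZMod (m * n)) = (a, b) := by rw [heq, RingEquiv.apply_symm_apply]
  rw [map_natCast] at h1
  exact ⟨r, hr, hrp, congrArg Prod.fst h1, congrArg Prod.snd h1⟩

lemma exists_not_isSquare_of_odd {l : ℕ} (hl : l.Prime) (hl2 : l ≠ 2) :
    ∃ a : ZMod l, IsUnit a ∧ ¬ IsSquare a := by
  have : Fact l.Prime := ⟨hl⟩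
  obtain ⟨a, ha⟩ := FiniteField.exists_nonsquare (F := ZMod l)
    (by rw [ZMod.ringChar_zmod_n]; exact hl2)
  exact ⟨a, isUnit_iff_ne_zero.2 (by rintro rfl; exact ha IsSquare.zero), ha⟩

lemma exists_prime_not_isSquare {l q : ℕ} (hl : l.Prime) (hl4 : l % 4 = 1) (hq : q.Prime)
    (hq4 : q % 4 = 1) (hne : q ≠ l) : ∃ r, r.Prime ∧ r ≠ 2 ∧ ¬ r ∣ q ∧ ¬ IsSquare (l : ZMod r) ∧
      IsSquare ((l * q : ℕ) : ZMod r) ∧ ¬ IsSquare (r : ZMod q) := by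
  have : Fact l.Prime := ⟨hl⟩
  have : Fact q.Prime := ⟨hq⟩
  obtain ⟨a, ha, ha'⟩ := exists_not_isSquare_of_odd hl (by omega)
  obtain ⟨b, hb, hb'⟩ := exists_not_isSquare_of_odd hq (by omega)
  obtain ⟨r, hr, hrp, rfl, rfl⟩ :=
    exists_prime_eq_eq ((Nat.coprime_primes hl hq).2 hne.symm) ha hb q
  have : Fact r.Prime := ⟨hrp⟩
  have hr2 : r ≠ 2 := by have := hq.two_le; omega
  have h1 : ¬ IsSquare (l : ZMod r) := by
    rwa [← ZMod.exists_sq_eq_prime_iff_of_mod_four_eq_one hl4 hr2]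
  have h2 : ¬ IsSquare (q : ZMod r) := by
    rwa [← ZMod.exists_sq_eq_prime_iff_of_mod_four_eq_one hq4 hr2]
  exact ⟨r, hrp, hr2, fun hd => (Nat.le_of_dvd hq.pos hd).not_gt hr, h1, by
    push_cast; exact isSquare_mul_of_not_isSquare h1 h2, hb'⟩

lemma exists_prime_mod_eight_not_isSquare {l : ℕ} (hl : l.Prime) (hl4 : l % 4 = 1) :
    ∃ r, r.Prime ∧ r ≠ 2 ∧ ¬ r ∣ 2 ∧ ¬ IsSquare (l : ZMod r) ∧
      IsSquare ((l * 2 : ℕ) : ZMod r) ∧ r % 8 = 5 := by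
  have : Fact l.Prime := ⟨hl⟩
  obtain ⟨a, ha, ha'⟩ := exists_not_isSquare_of_odd hl (by omega)
  have hb : IsUnit (5 : ZMod 8) := by decide
  have hcop : l.Coprime 8 := by
    rw [show 8 = 2 ^ 3 by norm_num]
    exact Nat.Coprime.pow_right 3 ((Nat.coprime_primes hl Nat.prime_two).2 (by omega))
  obtain ⟨r, hr, hrp, rfl, h5⟩ := exists_prime_eq_eq hcop ha hb 2
  have : Fact r.Prime := ⟨hrp⟩
  have hr2 : r ≠ 2 := by omega
  have h8 : r % 8 = 5 := (ZMod.natCast_eq_natCast_iff' r 5 8).1 (by exact_mod_cast h5)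
  have h1 : ¬ IsSquare (l : ZMod r) := by
    rwa [← ZMod.exists_sq_eq_prime_iff_of_mod_four_eq_one hl4 hr2]
  have h2 : ¬ IsSquare (2 : ZMod r) := by
    rw [ZMod.exists_sq_eq_two_iff hr2]
    omega
  exact ⟨r, hrp, hr2, fun hd => (Nat.le_of_dvd two_pos hd).not_gt hr, h1, by
    push_cast; exact isSquare_mul_of_not_isSquare h1 h2, h8⟩

/-- The residue of `u + v √l` is a square independently of the choice of the root. -/
lemma isSquare_add_mul_of_sq_eq {F : Type*} [Field F] (hneg : IsSquare (-1 : F)) {u v l c c' : F}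
    (huv : u ^ 2 + 1 = v ^ 2 * l) (hc : c ^ 2 = l) (hc' : c' ^ 2 = l)
    (h : IsSquare (u + v * c)) : IsSquare (u + v * c') := by
  have hmul : (u + v * c) * (u + v * -c) = -1 := by linear_combination huv - v ^ 2 * hc
  have hne : u + v * c ≠ 0 := left_ne_zero_of_mul (hmul ▸ neg_ne_zero.2 one_ne_zero)
  rcases sq_eq_sq_iff_eq_or_eq_neg.1 (hc'.trans hc.symm) with rfl | rfl
  · exact h
  · rw [← mul_div_cancel_left₀ (u + v * -c) hne, hmul]
    exact hneg.div h

namespace IsBaseField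

variable {l u v : ℕ} {k : Type*} [Field k] [NumberField k] {s : 𝓞 k} {ε : (𝓞 k)ˣ}
  {τ : k ≃ₐ[ℚ] k}

lemma ramData_of_split {m : ℕ} (hm : m ≠ 0) (hm2 : m % 4 = 1 ∨ 2 ∣ m) {A B : Ideal (𝓞 k)}
    (hA : A.IsPrime) (hB : B.IsPrime) (hAB : A ≠ B) (hmul : A * B = Ideal.span {(m : 𝓞 k)}) :
    RamData (m : 𝓞 k) (fun b : Bool => cond b A B) := by
  refine ⟨by exact_mod_cast hm, by rintro (_ | _) <;> assumption, ?_, by simpa using hmul.symm, ?_⟩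
  · rintro (_ | _) (_ | _) h
    exacts [rfl, absurd h.symm hAB, absurd h hAB, rfl]
  · refine hm2.imp (fun h => ⟨(m / 4 : ℕ), ?_⟩) fun ⟨c, hc⟩ => ⟨c, by rw [hc]; push_cast; rfl⟩
    have : m = 1 + 4 * (m / 4) := by omega
    conv_lhs => rw [this]
    push_cast
    rfl

lemma norm_unit_eq_one (h : IsBaseField l u v s ε τ) {q : ℕ} [Fact q.Prime] {c : ℤ_[q]}
    (hc : c ^ 2 = l) : ‖(u + v * c : ℤ_[q])‖ = 1 := by
  rw [← PadicInt.isUnit_iff]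
  have h1 := congrArg (Nat.cast : ℕ → ℤ_[q]) h.sq_add_one
  push_cast at h1
  refine .of_mul_eq_one (-(u - v * c)) ?_
  linear_combination -h1 + v ^ 2 * hc

lemma exists_hom_padic (h : IsBaseField l u v s ε τ) {q : ℕ} [Fact q.Prime] {c : ℤ_[q]}
    (hc : c ^ 2 = l) : ∃ φ : k →+* ℚ_[q], φ s = c ∧
      φ ((ε : 𝓞 k) : k) = (u + v * c : ℤ_[q]) := by
  obtain ⟨φ, hφ⟩ := h.exists_hom (L := ℚ_[q]) (c := c) (by rw [← PadicInt.coe_pow, hc]; simp)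
  refine ⟨φ, hφ, ?_⟩
  rw [h.coe_unit']
  simp [hφ]

lemma norm_natCast_eq_one {q r : ℕ} [hq : Fact q.Prime] (h : ¬ q ∣ r) : ‖(r : ℤ_[q])‖ = 1 := by
  refine le_antisymm (PadicInt.norm_le_one _) (not_lt.1 fun hlt => h ?_)
  have := (PadicInt.norm_int_lt_one_iff_dvd (p := q) r).1 (by simpa using hlt)
  exact_mod_cast this

lemma isNormForm_of_split (h : IsBaseField l u v s ε τ) {q : ℕ} (hq : q.Prime) (hq4 : q % 4 = 1)
    (hne : q ≠ l) {c : ZMod q} (hc : c ^ 2 = l) (hsq : IsSquare (u + v * c)) :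
    IsNormForm ((ε : 𝓞 k) : k) (q : k) := by
  by_contra hε
  have : Fact q.Prime := ⟨hq⟩
  have hsql : IsSquare (l : ZMod q) := ⟨c, by rw [← hc, sq]⟩
  have hl4 : l % 4 = 1 := by have := h.mod_eight; omega
  obtain ⟨A, B, hA, hB, hAB, -, hmul⟩ := h.split_of_isSquare hq (by omega) hne hsql
  obtain ⟨r, hrp, hr2, hrq, hrl, hrm, hqr⟩ := exists_prime_not_isSquare h.prime hl4 hq hq4 hne
  obtain ⟨j, hj, hor⟩ := h.exists_isNormForm_pow hq.pos
    (ramData_of_split hq.ne_zero (Or.inl hq4) hA hB hAB hmul)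
    (IsNormForm.of_prime hq (by omega)) hε hrp hr2 hrq hrl hrm
  obtain ⟨C, hC⟩ := PadicInt.exists_sq_eq_of_isSquare (p := q) (a := l) (by omega)
    (fun hd => hne ((Nat.prime_dvd_prime_iff_eq hq h.prime).1 hd)) hsql
  obtain ⟨φ, -, hφ⟩ := h.exists_hom_padic hC
  have hC' : PadicInt.toZMod C ^ 2 = (l : ZMod q) := by rw [← map_pow, hC, map_natCast]
  have huv := congrArg (Nat.cast : ℕ → ZMod q) h.sq_add_one
  push_cast at huv
  have hneg : IsSquare (-1 : ZMod q) := ZMod.exists_sq_eq_neg_one_iff.2 (by omega)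
  have hsq' := isSquare_add_mul_of_sq_eq hneg huv hc hC' hsq
  have hqr' : ¬ q ∣ r := fun hd => hrq ((Nat.prime_dvd_prime_iff_eq hq hrp).1 hd ▸ dvd_rfl)
  have hr1 : ‖(r : ℤ_[q]) ^ j‖ = 1 := by rw [norm_pow, norm_natCast_eq_one hqr', one_pow]
  have hq1 : ‖(q : ℤ_[q])‖ = (q : ℝ)⁻¹ := PadicInt.norm_p
  have hnsq := not_isSquare_pow hqr hj
  rcases hor with hor | hor
  · have h1 := PadicInt.isSquare_toZMod_of_isNormForm hq1 hr1 (by simpa using hor.map φ)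
    rw [map_pow, map_natCast] at h1
    exact hnsq h1
  · have h1 := PadicInt.isSquare_toZMod_of_isNormForm hq1
      (w := ((u : ℤ_[q]) + (v : ℤ_[q]) * C) * (r : ℤ_[q]) ^ j) (by rw [norm_mul, hr1, h.norm_unit_eq_one hC, one_mul])
      (by simpa [hφ] using hor.map φ)
    simp only [map_mul, map_pow, map_natCast, map_add] at h1
    have hne0 : (u + v * PadicInt.toZMod C : ZMod q) ≠ 0 := by
      have hmul : (u + v * PadicInt.toZMod C : ZMod q) * (u + v * -PadicInt.toZMod C) = -1 := by
        linear_combination huv - v ^ 2 * hC'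
      exact left_ne_zero_of_mul (hmul ▸ neg_ne_zero.2 one_ne_zero)
    have := h1.div hsq'
    rw [mul_div_cancel_left₀ _ hne0] at this
    exact hnsq this

lemma isNormForm_of_two (h : IsBaseField l u v s ε τ) (hu : 8 ∣ u) :
    IsNormForm ((ε : 𝓞 k) : k) ((2 : ℕ) : k) := by
  by_contra hε
  have hl4 : l % 4 = 1 := by have := h.mod_eight; omega
  obtain ⟨A, B, hA, hB, hAB, -, hmul⟩ := h.split_two
  obtain ⟨r, hrp, hr2, hrq, hrl, hrm, hr8⟩ := exists_prime_mod_eight_not_isSquare h.prime hl4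
  obtain ⟨j, hj, hor⟩ := h.exists_isNormForm_pow two_pos
    (ramData_of_split two_ne_zero (Or.inr dvd_rfl) hA hB hAB hmul)
    (IsNormForm.of_prime Nat.prime_two (by omega)) hε hrp hr2 hrq hrl hrm
  obtain ⟨C, hC⟩ := PadicInt.exists_sq_eq_of_mod_eight h.mod_eight
  obtain ⟨φ, -, hφ⟩ := h.exists_hom_padic hC
  have h2φ : φ 2 = ((2 : ℤ_[2]) : ℚ_[2]) := map_ofNat φ 2
  have hqr' : ¬ 2 ∣ r := by omega
  have hr1 : ‖(r : ℤ_[2]) ^ j‖ = 1 := by rw [norm_pow, norm_natCast_eq_one hqr', one_pow]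
  have hrj : ((r : ZMod (2 ^ 4)) ^ j) ^ 2 = 9 := by
    obtain ⟨m, hm⟩ : ∃ m, r = 8 * m + 5 := ⟨r / 8, by omega⟩
    obtain ⟨i, rfl⟩ := hj
    have h9 : ∀ m : ZMod (2 ^ 4), (8 * m + 5) ^ 2 = 9 := by decide
    have h81 : (9 ^ 2 : ZMod (2 ^ 4)) = 1 := by decide
    rw [← pow_mul, mul_comm, pow_mul, hm]
    push_cast
    rw [h9, pow_succ, pow_mul, h81, one_pow, one_mul]
  have h91 : (9 : ZMod (2 ^ 4)) ≠ 1 := by decide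
  rcases hor with hor | hor
  · have h1 := PadicInt.toZModPow_sq_eq_one_of_isNormForm (δ := 2) (e := 0) (by ring) hr1
      (by simpa [h2φ] using hor.map φ)
    rw [map_pow, map_natCast, hrj] at h1
    exact h91 h1
  · have h1 := PadicInt.toZModPow_sq_eq_one_of_isNormForm (δ := 2) (e := 0) (by ring)
      (w := ((u : ℤ_[2]) + v * C) * (r : ℤ_[2]) ^ j) (by rw [norm_mul, hr1, h.norm_unit_eq_one hC, one_mul])
      (by simpa [hφ, h2φ] using hor.map φ)
    simp only [map_mul, map_pow, map_natCast, map_add] at h1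
    have hC' := congrArg (PadicInt.toZModPow (p := 2) 4) hC
    rw [map_pow, map_natCast] at hC'
    have huv := congrArg (Nat.cast : ℕ → ZMod (2 ^ 4)) h.sq_add_one
    obtain ⟨a, rfl⟩ := hu
    push_cast at huv h1
    have h16 : (16 : ZMod (2 ^ 4)) = 0 := by decide
    refine h91 ?_
    rw [← h1, mul_pow, hrj]
    generalize PadicInt.toZModPow (p := 2) 4 C = z at *
    linear_combination -9 * (8 * a ^ 2 + a * v * z) * h16 + 9 * huv - 9 * v ^ 2 * hC'

lemma not_isNormForm_of_not_isSquare (h : IsBaseField l u v s ε τ) {q : ℕ} (hq : q.Prime)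
    (hq4 : q % 4 = 1) (hne : q ≠ l) {c : ZMod q} (hc : c ^ 2 = l) (hsq : ¬ IsSquare (u + v * c))
    {m : ℕ} (hm : ¬ q ∣ m) :
    ¬ IsNormForm ((ε : 𝓞 k) : k) ((q * m : ℕ) * ((ε : 𝓞 k) * s)) := by
  intro hε
  have : Fact q.Prime := ⟨hq⟩
  have hql : ¬ q ∣ l := fun hd => hne ((Nat.prime_dvd_prime_iff_eq hq h.prime).1 hd)
  obtain ⟨C, hC⟩ := PadicInt.exists_sq_eq_of_isSquare (p := q) (a := l) (by omega)
    hql ⟨c, by rw [← hc, sq]⟩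
  obtain ⟨φ, hs, hφ⟩ := h.exists_hom_padic hC
  have hC1 : ‖C‖ = 1 := by
    have := norm_natCast_eq_one hql
    rw [← hC, norm_pow] at this
    exact (pow_eq_one_iff_of_nonneg (norm_nonneg _) two_ne_zero).1 this
  have h1 := PadicInt.isSquare_toZMod_of_isNormForm
    (δ := ((q * m : ℕ) : ℤ_[q]) * (((u : ℤ_[q]) + (v : ℤ_[q]) * C) * C)) (w := (u : ℤ_[q]) + (v : ℤ_[q]) * C)
    (by
      push_cast
      rw [norm_mul, norm_mul, norm_mul, hC1, h.norm_unit_eq_one hC, norm_natCast_eq_one hm,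
        PadicInt.norm_p]
      simp) (h.norm_unit_eq_one hC) (by simpa [hφ, hs] using hε.map φ)
  simp only [map_mul, map_natCast, map_add] at h1
  have huv := congrArg (Nat.cast : ℕ → ZMod q) h.sq_add_one
  push_cast at huv
  exact hsq (isSquare_add_mul_of_sq_eq (ZMod.exists_sq_eq_neg_one_iff.2 (by omega)) huv
    (by rw [← map_pow, hC, map_natCast]) hc h1)

lemma not_isNormForm_of_not_dvd (h : IsBaseField l u v s ε τ) (hu : ¬ 8 ∣ u) {m : ℕ}
    (hm : m % 4 = 1) : ¬ IsNormForm ((ε : 𝓞 k) : k) ((2 * m : ℕ) * ((ε : 𝓞 k) * s)) := by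
  intro hε
  obtain ⟨C, hC⟩ := PadicInt.exists_sq_eq_of_mod_eight h.mod_eight
  obtain ⟨φ, hs, hφ⟩ := h.exists_hom_padic hC
  have h2φ : φ 2 = ((2 : ℤ_[2]) : ℚ_[2]) := map_ofNat φ 2
  obtain ⟨a, ha⟩ := h.four_dvd
  obtain ⟨b, hb⟩ : ∃ b, m = 4 * b + 1 := ⟨m / 4, by omega⟩
  obtain ⟨e, he⟩ : ∃ e, v * l = 4 * e + 1 := ⟨v * l / 4, by
    have : (v * l) % 4 = 1 := by
      rw [Nat.mul_mod, h.four_mod, show l % 4 = 1 by have := h.mod_eight; omega]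
    omega⟩
  have he' := congrArg (Nat.cast : ℕ → ℤ_[2]) he
  have h1 := PadicInt.toZModPow_sq_eq_one_of_isNormForm
    (δ := ((2 * m : ℕ) : ℤ_[2]) * (((u : ℤ_[2]) + v * C) * C)) (w := (u : ℤ_[2]) + v * C) (e := b + m * (a * C + e))
    (by
      push_cast at he'
      rw [ha, hb]
      push_cast
      linear_combination (2 * (4 * b + 1)) * (v * hC + he')) (h.norm_unit_eq_one hC)
    (by simpa [hφ, hs, h2φ] using hε.map φ)
  simp only [map_mul, map_natCast, map_add] at h1
  have hC' := congrArg (PadicInt.toZModPow (p := 2) 4) hC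
  rw [map_pow, map_natCast] at hC'
  have huv := congrArg (Nat.cast : ℕ → ZMod (2 ^ 4)) h.sq_add_one
  rw [ha] at huv h1
  push_cast at huv h1
  have h16 : (16 : ZMod (2 ^ 4)) = 0 := by decide
  generalize PadicInt.toZModPow (p := 2) 4 C = z at *
  have h2 : ((8 * a : ℕ) : ZMod (2 ^ 4)) = 0 := by
    push_cast
    linear_combination v * z * h1 - (v * z + 8 * a) * (v ^ 2 * hC' - huv) -
      (2 * v * z * a ^ 2 + 8 * a ^ 3) * h16
  rw [ZMod.natCast_eq_zero_iff] at h2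
  apply hu
  rw [ha]
  omega

end IsBaseField

lemma exists_primitive_sq_sub_eq_pow {l q : ℕ} (hq : q.Prime) {j : ℕ} (hj : Odd j) {x y : ℤ}
    (h : x ^ 2 - l * y ^ 2 = q ^ j) :
    ∃ (x y : ℤ) (j : ℕ), Odd j ∧ x ^ 2 - l * y ^ 2 = q ^ j ∧ ¬ (q : ℤ) ∣ y := by
  induction j using Nat.strong_induction_on generalizing x y with
  | _ j ih =>
    by_cases hy : (q : ℤ) ∣ y
    swap
    · exact ⟨x, y, j, hj, h, hy⟩
    have hp := Nat.prime_iff_prime_int.1 hq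
    have hq0 : (q : ℤ) ^ 2 ≠ 0 := pow_ne_zero _ hp.ne_zero
    have hx : (q : ℤ) ∣ x := by
      refine hp.dvd_of_dvd_pow (n := 2) ?_
      rw [show x ^ 2 = q ^ j + l * y ^ 2 by linear_combination h]
      exact dvd_add (dvd_pow_self _ hj.pos.ne') (Dvd.dvd.mul_left (dvd_pow hy two_ne_zero) _)
    obtain ⟨x, rfl⟩ := hx
    obtain ⟨y, rfl⟩ := hy
    have h1 : (q : ℤ) ^ 2 * (x ^ 2 - l * y ^ 2) = q ^ j := by rw [← h]; ring
    have h2 : 2 ≤ j := (Nat.pow_dvd_pow_iff_le_right hq.one_lt).1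
      (by exact_mod_cast (Dvd.intro _ h1 : (q : ℤ) ^ 2 ∣ q ^ j))
    obtain ⟨i, rfl⟩ := Nat.exists_eq_add_of_le h2
    rw [pow_add] at h1
    exact ih i (by omega) (by rw [Nat.odd_add] at hj; simpa [Nat.odd_iff, Nat.even_iff] using hj)
      (mul_left_cancel₀ hq0 h1)

namespace IsBaseField

variable {l u v : ℕ} {k : Type*} [Field k] [NumberField k] {s : 𝓞 k} {ε : (𝓞 k)ˣ}
  {τ : k ≃ₐ[ℚ] k}

open IsQuadExt in
lemma exists_sq_sub_eq_pow (h : IsBaseField l u v s ε τ) {q : ℕ} (hq : q.Prime) (hq2 : q ≠ 2)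
    (hql : q ≠ l) (hsq : IsSquare (l : ZMod q)) :
    ∃ (x y : ℤ) (j : ℕ), Odd j ∧ x ^ 2 - l * y ^ 2 = q ^ j ∧ ¬ (q : ℤ) ∣ y := by
  obtain ⟨A, B, -, -, -, rfl, hmul⟩ := h.split_of_isSquare hq hq2 hql hsq
  obtain ⟨α, η, hα⟩ := h.ext.exists_mul_conjInt_eq (r := (q : 𝓞 ℚ))
    (by exact_mod_cast hq.ne_zero) (by rw [hmul, map_natCast])
  set j := classNumber k
  obtain ⟨a, b, hab⟩ := h.rep (α : k)
  have hconj : τ (α : k) = a - b * s := by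
    rw [hab, map_add, map_mul, h.conj_s, map_ratCast, map_ratCast]; ring
  obtain ⟨X, hX⟩ := h.exists_intCast (x := α + conjInt τ α)
    (by rw [map_add, h.ext.conjInt_conjInt, add_comm])
  have hX' : 2 * a = X := by
    have := congrArg (algebraMap (𝓞 k) k) hX
    rw [map_add, map_intCast] at this
    change (α : k) + τ α = _ at this
    rw [hconj, hab] at this
    exact_mod_cast (show ((2 * a : ℚ) : k) = (X : ℚ) by push_cast; linear_combination this)
  obtain ⟨M, hM, hMk⟩ : ∃ M : ℤ, (M = q ^ j ∨ M = -q ^ j) ∧ ((η * (q : 𝓞 ℚ) ^ j : 𝓞 ℚ) : ℚ) = M := by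
    obtain h1 | h1 := Int.units_eq_one_or (Units.map Rat.ringOfIntegersEquiv.toMonoidHom η)
    · have h2 : (η : 𝓞 ℚ) = 1 := Rat.ringOfIntegersEquiv.injective
        (by simpa using congrArg Units.val h1)
      exact ⟨q ^ j, Or.inl rfl, by rw [h2]; simp⟩
    · have h2 : (η : 𝓞 ℚ) = -1 := Rat.ringOfIntegersEquiv.injective
        (by simpa using congrArg Units.val h1)
      exact ⟨-q ^ j, Or.inr rfl, by rw [h2]; simp⟩
  have hnorm : a ^ 2 - l * b ^ 2 = M := by
    have := congrArg (algebraMap (𝓞 k) k) hα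
    rw [map_mul] at this
    change (α : k) * τ α = algebraMap ℚ k ((η * (q : 𝓞 ℚ) ^ j : 𝓞 ℚ) : ℚ) at this
    rw [hconj, hab, hMk] at this
    have h2 : ((a ^ 2 - l * b ^ 2 : ℚ) : k) = (M : ℚ) := by
      rw [eq_ratCast] at this
      rw [← this]
      push_cast
      linear_combination (b : k) ^ 2 * h.sq_s'
    exact_mod_cast h2
  have hodd : M % 2 = 1 := by
    have hoq : Odd ((q : ℤ) ^ j) := by
      have : Odd q := hq.odd_of_ne_two hq2
      exact_mod_cast this.pow
    rcases hM with rfl | rfl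
    · exact Int.odd_iff.1 hoq
    · exact Int.odd_iff.1 hoq.neg
  obtain ⟨x, y, rfl, rfl⟩ := exists_int_coords h.prime h.mod_eight hX' hnorm hodd
  have hxy : x ^ 2 - l * y ^ 2 = M := by exact_mod_cast hnorm
  have hj : Odd j := h.odd_classNumber
  rcases hM with rfl | rfl
  · exact exists_primitive_sq_sub_eq_pow hq hj hxy
  · have huv := congrArg (Nat.cast : ℕ → ℤ) h.sq_add_one
    push_cast at huv
    refine exists_primitive_sq_sub_eq_pow hq hj (x := x * u + l * y * v) (y := x * v + y * u) ?_
    linear_combination (x ^ 2 - l * y ^ 2) * huv - hxy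

lemma quartSym_eq_iff (h : IsBaseField l u v s ε τ) {q : ℕ} (hq : q.Prime) (hq4 : q % 4 = 1)
    (hne : q ≠ l) {c : ZMod q} (hc : c ^ 2 = l) :
    quartSym l q = quartSym q l ↔ IsSquare (u + v * c) := by
  obtain ⟨x, y, j, hj, hxy, hqy⟩ := h.exists_sq_sub_eq_pow hq (by omega) hne ⟨c, by rw [← hc, sq]⟩
  exact _root_.quartSym_eq_iff h.prime (by have := h.mod_eight; omega) hq hq4 hne h.four_dvd h.odd
    h.sq_add_one hj hxy hqy hc

end IsBaseField

/-- The ring element `δ` satisfies the conditions of `RamData` with `N` prime ideals. -/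
def HasRamCount {k : Type*} [Field k] [NumberField k] (δ : 𝓞 k) (N : ℕ) : Prop :=
  ∃ (ι : Type) (_ : Fintype ι) (𝔭 : ι → Ideal (𝓞 k)), RamData δ 𝔭 ∧ Fintype.card ι = N

namespace HasRamCount

variable {k : Type*} [Field k] [NumberField k] {δ δ' : 𝓞 k} {N N' : ℕ}

lemma one : HasRamCount (1 : 𝓞 k) 0 :=
  ⟨Empty, inferInstance, Empty.elim, ⟨one_ne_zero, Empty.rec, Function.injective_of_subsingleton _,
    by simp, Or.inl ⟨0, by ring⟩⟩, rfl⟩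

lemma mul (h : HasRamCount δ N) (h' : HasRamCount δ' N') (hc : IsCoprime δ δ') :
    HasRamCount (δ * δ') (N + N') := by
  obtain ⟨ι, _, 𝔭, hr, rfl⟩ := h
  obtain ⟨ι', _, 𝔭', hr', rfl⟩ := h'
  have hne : ∀ i j, 𝔭 i ≠ 𝔭' j := by
    intro i j heq
    obtain ⟨a, b, hab⟩ := hc
    refine (hr.prime i).ne_top ((Ideal.eq_top_iff_one _).2 ?_)
    rw [← hab]
    exact add_mem (Ideal.mul_mem_left _ _ (hr.mem i)) (Ideal.mul_mem_left _ _ (heq ▸ hr'.mem j))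
  refine ⟨ι ⊕ ι', inferInstance, Sum.elim 𝔭 𝔭', ⟨mul_ne_zero hr.ne_zero hr'.ne_zero, ?_,
    hr.inj.sumElim hr'.inj hne, ?_, ?_⟩, Fintype.card_sum⟩
  · rintro (i | i)
    exacts [hr.prime i, hr'.prime i]
  · rw [← Ideal.span_singleton_mul_span_singleton, hr.prod_eq, hr'.prod_eq, Fintype.prod_sum_type]
    simp
  · rcases hr.two with ⟨c, hc⟩ | hd
    · rcases hr'.two with ⟨c', hc'⟩ | hd
      · exact Or.inl ⟨c + c' + 4 * c * c', by rw [hc, hc']; ring⟩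
      · exact Or.inr (hd.mul_left _)
    · exact Or.inr (hd.mul_right _)

lemma prod {α : Type*} {t : Finset α} {f : α → 𝓞 k} {N : ℕ} (h : ∀ i ∈ t, HasRamCount (f i) N)
    (hc : (t : Set α).Pairwise (Function.onFun IsCoprime f)) :
    HasRamCount (∏ i ∈ t, f i) (t.card * N) := by
  classical
  induction t using Finset.induction_on with
  | empty => simpa using one
  | insert i t hi ih =>
    rw [Finset.prod_insert hi, Finset.card_insert_of_notMem hi, add_mul, one_mul, add_comm]
    refine (h i (Finset.mem_insert_self _ _)).mul
      (ih (fun j hj => h j (Finset.mem_insert_of_mem hj))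
        (hc.mono (by simp))) (IsCoprime.prod_right fun j hj => ?_)
    exact hc (by simp) (by simp [hj]) (by rintro rfl; exact hi hj)

end HasRamCount

lemma natCast_isCoprime {R : Type*} [CommRing R] {a b : ℕ} (h : a.Coprime b) :
    IsCoprime (a : R) (b : R) := by
  simpa using IsBaseField.intCast_isCoprime (R := R) (Nat.isCoprime_iff_coprime.2 h)

lemma prod_mod_four {α : Type*} {t : Finset α} {f : α → ℕ} (h : ∀ i ∈ t, f i % 4 = 1) :
    (∏ i ∈ t, f i) % 4 = 1 := by
  rw [Finset.prod_nat_mod, Finset.prod_congr rfl h, Finset.prod_const_one,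
    Nat.one_mod]

namespace IsBaseField

variable {l u v : ℕ} {k : Type*} [Field k] [NumberField k] {s : 𝓞 k} {ε : (𝓞 k)ˣ}
  {τ : k ≃ₐ[ℚ] k}

lemma hasRamCount_of_inert (h : IsBaseField l u v s ε τ) {p : ℕ} (hp : p.Prime) (hp4 : p % 4 = 1)
    (hlp : ¬ IsSquare (l : ZMod p)) : HasRamCount (p : 𝓞 k) 1 := by
  refine ⟨Unit, inferInstance, fun _ => Ideal.span {(p : 𝓞 k)}, ⟨by exact_mod_cast hp.ne_zero,
    fun _ => h.span_natCast_prime hp hlp, fun _ _ _ => Subsingleton.elim _ _, by simp,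
    Or.inl ⟨(p / 4 : ℕ), ?_⟩⟩, rfl⟩
  have : p = 1 + 4 * (p / 4) := by omega
  conv_lhs => rw [this]
  push_cast
  rfl

lemma hasRamCount_of_split (h : IsBaseField l u v s ε τ) {q : ℕ} (hq : q.Prime) (hq4 : q % 4 = 1)
    (hne : q ≠ l) (hsq : IsSquare (l : ZMod q)) : HasRamCount (q : 𝓞 k) 2 := by
  obtain ⟨A, B, hA, hB, hAB, -, hmul⟩ := h.split_of_isSquare hq (by omega) hne hsq
  exact ⟨Bool, inferInstance, _, ramData_of_split hq.ne_zero (Or.inl hq4) hA hB hAB hmul, rfl⟩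

lemma hasRamCount_two (h : IsBaseField l u v s ε τ) : HasRamCount ((2 : ℕ) : 𝓞 k) 2 := by
  obtain ⟨A, B, hA, hB, hAB, -, hmul⟩ := h.split_two
  exact ⟨Bool, inferInstance, _, ramData_of_split two_ne_zero (Or.inr dvd_rfl) hA hB hAB hmul, rfl⟩

theorem card_twoTorsion {k : Type*} [Field k] [NumberField k] {s : 𝓞 k} {ε : (𝓞 k)ˣ}
    {τ : k ≃ₐ[ℚ] k} (h : IsBaseField l u v s ε τ) {t₁ t₂ : ℕ} {p : Fin t₁ → ℕ} {q : Fin t₂ → ℕ}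
    (hp : ∀ i, (p i).Prime) (hq : ∀ j, (q j).Prime) (hpinj : Function.Injective p)
    (hqinj : Function.Injective q) (hpq : ∀ i j, p i ≠ q j) (hpl : ∀ i, p i ≠ l)
    (hql : ∀ j, q j ≠ l) (hp4 : ∀ i, p i % 4 = 1) (hq4 : ∀ j, q j % 4 = 1)
    (hps : ∀ i, ¬ IsSquare (l : ZMod (p i))) (hqs : ∀ j, IsSquare (l : ZMod (q j)))
    {n : ℕ} (hn : n = 2 * ((∏ i, p i) * ∏ j, q j))
    {K : Type*} [Field K] [NumberField K] [Algebra k K] {d : K}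
    (hd : d ^ 2 = algebraMap k K ((n : 𝓞 k) * ((ε : 𝓞 k) * s) : 𝓞 k))
    (hrep : ∀ x : K, ∃ a b : k, x = algebraMap k K a + algebraMap k K b * d) :
    ((quartSym l 2 = (-1 : ℤ) ^ ((l - 1) / 8) ∧ ∀ j, quartSym l (q j) = quartSym (q j) l) →
        Nat.card {c : ClassGroup (𝓞 K) // c ^ 2 = 1} = 2 ^ (t₁ + 2 * t₂ + 2)) ∧
      ((quartSym l 2 ≠ (-1 : ℤ) ^ ((l - 1) / 8) ∨ ∃ j, quartSym l (q j) ≠ quartSym (q j) l) →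
        Nat.card {c : ClassGroup (𝓞 K) // c ^ 2 = 1} = 2 ^ (t₁ + 2 * t₂ + 1)) := by
  have := h.isTotallyReal
  have hpp : ∀ {i j}, i ≠ j → (p i).Coprime (p j) := fun hij =>
    (Nat.coprime_primes (hp _) (hp _)).2 (hpinj.ne hij)
  have hqq : ∀ {i j}, i ≠ j → (q i).Coprime (q j) := fun hij =>
    (Nat.coprime_primes (hq _) (hq _)).2 (hqinj.ne hij)
  have hP4 : (∏ i, p i) % 4 = 1 := prod_mod_four fun i _ => hp4 i
  have hQ4 : (∏ j, q j) % 4 = 1 := prod_mod_four fun i _ => hq4 i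
  have hPQ4 : ((∏ i, p i) * ∏ j, q j) % 4 = 1 := by rw [Nat.mul_mod, hP4, hQ4]
  have hPQ : (∏ i, p i).Coprime (∏ j, q j) := Nat.Coprime.prod_left fun i _ =>
    Nat.Coprime.prod_right fun j _ => (Nat.coprime_primes (hp i) (hq j)).2 (hpq i j)
  have hln : l.Coprime n := by
    rw [hn]
    refine Nat.Coprime.mul_right ?_ (Nat.Coprime.mul_right (Nat.Coprime.prod_right fun i _ => ?_)
      (Nat.Coprime.prod_right fun j _ => ?_))
    · exact (Nat.coprime_primes h.prime Nat.prime_two).2 (by have := h.mod_eight; omega)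
    · exact (Nat.coprime_primes h.prime (hp i)).2 (hpl i).symm
    · exact (Nat.coprime_primes h.prime (hq j)).2 (hql j).symm
  have hn0 : 0 < n := by rw [hn]; omega
  have hcount : HasRamCount ((n : 𝓞 k) * ((ε : 𝓞 k) * s)) (t₁ + 2 * t₂ + 3) := by
    have hP : HasRamCount (∏ i, (p i : 𝓞 k)) (t₁ * 1) := by
      simpa using HasRamCount.prod (t := Finset.univ) (f := fun i => (p i : 𝓞 k))
        (fun i _ => h.hasRamCount_of_inert (hp i) (hp4 i) (hps i))
        fun i _ j _ hij => natCast_isCoprime (hpp hij)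
    have hQ : HasRamCount (∏ j, (q j : 𝓞 k)) (t₂ * 2) := by
      simpa using HasRamCount.prod (t := Finset.univ) (f := fun j => (q j : 𝓞 k))
        (fun j _ => h.hasRamCount_of_split (hq j) (hq4 j) (hql j) (hqs j))
        fun i _ j _ hij => natCast_isCoprime (hqq hij)
    have hcop2 : Nat.Coprime 2 ((∏ i, p i) * ∏ j, q j) :=
      Nat.coprime_two_left.2 (Nat.odd_iff.2 (by omega))
    have h1 := h.hasRamCount_two.mul (hP.mul hQ (by exact_mod_cast natCast_isCoprime hPQ))
      (by exact_mod_cast natCast_isCoprime hcop2)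
    have h2 : HasRamCount ((ε : 𝓞 k) * s) 1 := ⟨Unit, inferInstance, _, h.ramData_unit_mul, rfl⟩
    have hcop : IsCoprime (n : 𝓞 k) ((ε : 𝓞 k) * s) := by
      rw [isCoprime_mul_unit_left_right ε.isUnit]
      have := natCast_isCoprime (R := 𝓞 k) hln
      rw [← h.sq_s, sq] at this
      exact this.of_mul_left_left.symm
    have h3 := HasRamCount.mul (δ := (n : 𝓞 k)) (N := 2 + (t₁ * 1 + t₂ * 2))
      (by rw [hn]; exact_mod_cast h1) h2 hcop
    convert h3 using 1
    ring
  obtain ⟨ι, _, 𝔭, hr, hι⟩ := hcount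
  have : Nonempty ι := Fintype.card_pos_iff.1 (by omega)
  have hfin := finrank_eq_two_of_rep hd hr.not_isSquare hrep
  obtain ⟨σ, hσ⟩ := exists_isQuadExt hd hr.not_isSquare hrep
  have := hσ.isTotallyReal fun φ => by
    have h1 := mul_pos (Nat.cast_pos.2 hn0 : (0 : ℝ) < n) (h.unit_mul_pos φ)
    simpa using h1
  have hcard := hσ.card_twoTorsion hfin hr h.odd_classNumber
  rw [hι] at hcard
  have hε0 : ((ε : 𝓞 k) : k) ≠ 0 := by simp
  have hδ0 : (((n : 𝓞 k) * ((ε : 𝓞 k) * s) : 𝓞 k) : k) ≠ 0 := by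
    simpa using hr.ne_zero
  have hδ : (((n : 𝓞 k) * ((ε : 𝓞 k) * s) : 𝓞 k) : k) =
      ((2 : ℕ) * ((∏ i, (p i : k)) * ∏ j, (q j : k))) * ((ε : 𝓞 k) * s) := by
    rw [hn]; push_cast; simp [map_ofNat]
  have hneg : -1 ∈ normUnits ((n : 𝓞 k) * ((ε : 𝓞 k) * s)) := by
    rw [mem_normUnits_iff]
    have : IsNormForm (((n : 𝓞 k) * ((ε : 𝓞 k) * s) : 𝓞 k) : k) (-1) := by
      rw [hδ]
      exact ((IsNormForm.of_prime Nat.prime_two (by norm_num)).mul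
        ((IsNormForm.prod fun i _ => IsNormForm.of_prime (hp i) (by rw [hp4]; norm_num)).mul
        (IsNormForm.prod fun j _ => IsNormForm.of_prime (hq j) (by rw [hq4]; norm_num)))).mul
        h.isNormForm_unit_mul
    simpa using this.symm hδ0
  have h2iff := quartSym_two_iff h.prime h.mod_eight h.four_dvd h.sq_add_one
  constructor
  · rintro ⟨hc2, hcq⟩
    have hε : ε ∈ normUnits ((n : 𝓞 k) * ((ε : 𝓞 k) * s)) := by
      rw [mem_normUnits_iff]
      have : IsNormForm (((n : 𝓞 k) * ((ε : 𝓞 k) * s) : 𝓞 k) : k) ((ε : 𝓞 k) : k) := by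
        rw [hδ]
        refine (((h.isNormForm_of_two (h2iff.1 hc2)).symm hε0).mul
          ((IsNormForm.prod fun i _ => (h.isNormForm_of_inert (hp i) (hp4 i) (hps i)).symm hε0).mul
          (IsNormForm.prod fun j _ => IsNormForm.symm ?_ hε0))).mul
          (h.isNormForm_unit_unit_mul.symm hε0)
        obtain ⟨c, hc⟩ := hqs j
        have hc' : c ^ 2 = l := by rw [hc, sq]
        exact h.isNormForm_of_split (hq j) (hq4 j) (hql j) hc'
          ((h.quartSym_eq_iff (hq j) (hq4 j) (hql j) hc').1 (hcq j))
      exact this.symm hδ0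
    rw [h.index_normUnits_eq_one hneg hε] at hcard
    rw [show t₁ + 2 * t₂ + 3 = t₁ + 2 * t₂ + 2 + 1 by ring, pow_succ] at hcard
    omega
  · intro hor
    have hε : ε ∉ normUnits ((n : 𝓞 k) * ((ε : 𝓞 k) * s)) := by
      rw [mem_normUnits_iff]
      intro hN
      have hcoe : (((n : 𝓞 k) * ((ε : 𝓞 k) * s) : 𝓞 k) : k) = n * ((ε : 𝓞 k) * s) := by simp
      rw [hcoe] at hN
      rcases hor with hc2 | ⟨j, hj⟩
      · rw [hn] at hN
        exact h.not_isNormForm_of_not_dvd (mt h2iff.2 hc2) hPQ4 hN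
      · obtain ⟨c, hc⟩ := hqs j
        have hc' : c ^ 2 = l := by rw [hc, sq]
        have hm : n = q j * (2 * ((∏ i, p i) * ∏ i ∈ Finset.univ.erase j, q i)) := by
          rw [hn, ← Finset.mul_prod_erase _ _ (Finset.mem_univ j)]; ring
        rw [hm] at hN
        refine h.not_isNormForm_of_not_isSquare (hq j) (hq4 j) (hql j) hc'
          (mt (h.quartSym_eq_iff (hq j) (hq4 j) (hql j) hc').2 hj) ?_ hN
        rw [← (hq j).coprime_iff_not_dvd]
        refine Nat.Coprime.mul_right ?_ (Nat.Coprime.mul_right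
          (Nat.Coprime.prod_right fun i _ => ?_) (Nat.Coprime.prod_right fun i hi => ?_))
        · exact (Nat.coprime_primes (hq j) Nat.prime_two).2 (by have := hq4 j; omega)
        · exact (Nat.coprime_primes (hq j) (hp i)).2 (hpq i j).symm
        · exact hqq (Finset.ne_of_mem_erase hi).symm
    rw [h.index_normUnits_eq_two hneg hε] at hcard
    rw [show t₁ + 2 * t₂ + 3 = t₁ + 2 * t₂ + 1 + 1 + 1 by ring, pow_succ, pow_succ] at hcard
    omega

end IsBaseField

lemma exists_nat_coords {l : ℕ} (hl : l.Prime) (hl8 : l % 8 = 1) {ε : ℝ} {u v : ℚ} (h1 : 1 < ε)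
    (hint : IsIntegral ℤ ε) (hint' : IsIntegral ℤ ε⁻¹) (hε : ε = u + v * √(l : ℝ))
    (huv : (u : ℝ) ^ 2 - (v : ℝ) ^ 2 * l = -1) :
    ∃ a b : ℕ, ε = a + b * √(l : ℝ) ∧ a ^ 2 + 1 = b ^ 2 * l ∧ 4 ∣ a ∧ b % 2 = 1 := by
  have hsq : √(l : ℝ) ^ 2 = l := Real.sq_sqrt (Nat.cast_nonneg l)
  have hspos : 0 < √(l : ℝ) := Real.sqrt_pos.2 (by exact_mod_cast hl.pos)
  have hinv : ε⁻¹ = v * √(l : ℝ) - u := by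
    refine inv_eq_of_mul_eq_one_right ?_
    rw [hε]
    linear_combination (v : ℝ) ^ 2 * hsq - huv
  have hinv1 : ε⁻¹ < 1 := inv_lt_one_of_one_lt₀ h1
  have hinv0 : 0 < ε⁻¹ := by positivity
  have htrace : IsIntegral ℤ (2 * u : ℚ) := by
    rw [← isIntegral_algebraMap_iff (algebraMap ℚ ℝ).injective (A := ℚ)]
    have : (algebraMap ℚ ℝ) (2 * u) = ε - ε⁻¹ := by
      rw [hinv, hε, eq_ratCast]; push_cast; ring
    rw [this]
    exact hint.sub hint'
  obtain ⟨X, hX⟩ := IsIntegrallyClosed.isIntegral_iff.1 htrace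
  have huv' : u ^ 2 - l * v ^ 2 = ((-1 : ℤ) : ℚ) := by
    push_cast
    rw [mul_comm]
    exact_mod_cast huv
  obtain ⟨x, y, rfl, rfl⟩ := exists_int_coords hl hl8 (X := X) (by simpa using hX.symm) huv' (by decide)
  have hx : 0 ≤ x := by
    have : (0 : ℝ) < x := by push_cast at hε hinv; linarith
    exact_mod_cast this.le
  have hy : 0 ≤ y := by
    have : 0 < (y : ℝ) * √(l : ℝ) := by push_cast at hε hinv; linarith
    exact_mod_cast (pos_of_mul_pos_left this hspos.le).le
  lift x to ℕ using hx
  lift y to ℕ using hy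
  have hxy : x ^ 2 + 1 = y ^ 2 * l := by
    have : (x : ℝ) ^ 2 + 1 = y ^ 2 * l := by push_cast at huv; linarith
    exact_mod_cast this
  have hmod : (x % 8) ^ 2 + 1 ≡ (y % 8) ^ 2 * 1 [MOD 8] :=
    (((Nat.mod_modEq x 8).pow 2).add_right 1).trans
      ((congrArg (· % 8) hxy).trans (((Nat.mod_modEq y 8).pow 2).mul
        (show 1 ≡ l [MOD 8] from hl8.symm)).symm)
  have hx8 : x % 8 < 8 := Nat.mod_lt _ (by norm_num)
  have hy8 : y % 8 < 8 := Nat.mod_lt _ (by norm_num)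
  have hres : x % 8 % 4 = 0 ∧ y % 8 % 2 = 1 := by
    generalize x % 8 = r at *
    generalize y % 8 = t at *
    interval_cases r <;> interval_cases t <;> revert hmod <;> decide
  exact ⟨x, y, by exact_mod_cast hε, hxy, by omega, by omega⟩

lemma isSquare_of_legSym_eq_one {l a : ℕ} (hl : l.Prime) (hl2 : l ≠ 2) (ha : a.Prime)
    (ha4 : a % 4 = 1) (hal : a ≠ l) (h : legSym l a = 1) : IsSquare (l : ZMod a) := by
  have : Fact l.Prime := ⟨hl⟩
  have : Fact a.Prime := ⟨ha⟩
  rw [ZMod.exists_sq_eq_prime_iff_of_mod_four_eq_one ha4 hl2]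
  have ha0 : ((a : ℕ) : ZMod l) ≠ 0 := by
    rw [Ne, ZMod.natCast_eq_zero_iff]
    exact fun hd => hal ((Nat.prime_dvd_prime_iff_eq hl ha).1 hd).symm
  rw [ZMod.euler_criterion l ha0]
  have hodd := hl.eq_two_or_odd.resolve_left hl2
  rw [show l / 2 = (l - 1) / 2 by omega]
  by_contra hne
  simp [legSym, hne, ha0] at h

lemma not_isSquare_of_legSym_eq_neg_one {l a : ℕ} (hl : l.Prime) (hl2 : l ≠ 2) (ha : a.Prime)
    (ha4 : a % 4 = 1) (hal : a ≠ l) (h : legSym l a = -1) : ¬ IsSquare (l : ZMod a) := by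
  have : Fact l.Prime := ⟨hl⟩
  have : Fact a.Prime := ⟨ha⟩
  rw [ZMod.exists_sq_eq_prime_iff_of_mod_four_eq_one ha4 hl2]
  have ha0 : ((a : ℕ) : ZMod l) ≠ 0 := by
    rw [Ne, ZMod.natCast_eq_zero_iff]
    exact fun hd => hal ((Nat.prime_dvd_prime_iff_eq hl ha).1 hd).symm
  rw [ZMod.euler_criterion l ha0]
  have hodd := hl.eq_two_or_odd.resolve_left hl2
  rw [show l / 2 = (l - 1) / 2 by omega]
  intro he
  simp [legSym, he] at h

/-- If `d ^ 2` lies in the image of `k`, then so do the coordinates of the elements of `ℚ⟮d⟯`. -/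
lemma exists_rep_of_mem_adjoin {k L : Type*} [Field k] [CharZero k] [Field L] [CharZero L]
    (φ : k →+* L) {d : L} {δ : k} (hd : d ^ 2 = φ δ) {x : L}
    (hx : x ∈ IntermediateField.adjoin ℚ {d}) : ∃ a b : k, x = φ a + φ b * d := by
  induction hx using IntermediateField.adjoin_induction with
  | mem x hx => exact ⟨0, 1, by simpa using hx⟩
  | algebraMap x => exact ⟨x, 0, by simp⟩
  | add x y _ _ hx hy =>
    obtain ⟨a, b, rfl⟩ := hx
    obtain ⟨a', b', rfl⟩ := hy
    exact ⟨a + a', b + b', by simp only [map_add]; ring⟩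
  | mul x y _ _ hx hy =>
    obtain ⟨a, b, rfl⟩ := hx
    obtain ⟨a', b', rfl⟩ := hy
    refine ⟨a * a' + b * b' * δ, a * b' + a' * b, ?_⟩
    simp only [map_add, map_mul]
    linear_combination φ b * φ b' * hd
  | inv x _ hx =>
    obtain ⟨a, b, rfl⟩ := hx
    have hprod : (φ a + φ b * d) * (φ a - φ b * d) = φ (a ^ 2 - b ^ 2 * δ) := by
      simp only [map_sub, map_mul, map_pow]
      linear_combination - (φ b) ^ 2 * hd
    rcases eq_or_ne (φ a + φ b * d) 0 with h0 | h0
    · exact ⟨0, 0, by simp [h0]⟩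
    rcases eq_or_ne (φ a - φ b * d) 0 with h1 | h1
    · refine ⟨(2 * a)⁻¹, 0, ?_⟩
      rw [← sub_eq_zero.1 h1, ← two_mul]
      simp [map_ofNat]
    · refine ⟨a / (a ^ 2 - b ^ 2 * δ), - b / (a ^ 2 - b ^ 2 * δ), ?_⟩
      simp only [map_div₀, map_neg, ← hprod]
      field_simp
      ring

namespace IsBaseField

variable {l u v : ℕ} {k : Type*} [Field k] [NumberField k] {s : 𝓞 k} {ε : (𝓞 k)ˣ}
  {τ : k ≃ₐ[ℚ] k}

/-- The base field embeds into every field containing a square root of `n * ε * s`. -/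
lemma apply_mem (h : IsBaseField l u v s ε τ) {L : Type*} [Field L] [CharZero L] (φ : k →+* L)
    {n : ℕ} (hn : n ≠ 0) {F : IntermediateField ℚ L}
    (hF : φ ((n : 𝓞 k) * ((ε : 𝓞 k) * s) : 𝓞 k) ∈ F) (x : k) : φ x ∈ F := by
  have hs : φ s ∈ F := by
    have hn0 : (n : L) ≠ 0 := Nat.cast_ne_zero.2 hn
    have hu0 : (u : L) ≠ 0 := Nat.cast_ne_zero.2 h.pos_u.ne'
    have h1 := congrArg φ h.sq_s'
    rw [map_pow, map_natCast] at h1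
    have h2 : φ ((n : 𝓞 k) * ((ε : 𝓞 k) * s) : 𝓞 k) = n * ((u + v * φ s) * φ s) := by
      simp [h.coe_unit]
    have h3 : φ s = (φ ((n : 𝓞 k) * ((ε : 𝓞 k) * s) : 𝓞 k) / n - v * l) / u := by
      rw [h2]
      field_simp
      linear_combination - (v : L) * h1
    rw [h3]
    exact F.div_mem (F.sub_mem (F.div_mem hF (natCast_mem F n))
      (F.mul_mem (natCast_mem F v) (natCast_mem F l))) (natCast_mem F u)
  obtain ⟨a, b, rfl⟩ := h.rep x
  rw [map_add, map_mul, map_ratCast, map_ratCast]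
  exact F.add_mem (SubfieldClass.ratCast_mem F a) (F.mul_mem (SubfieldClass.ratCast_mem F b) hs)

end IsBaseField

end QuadraticClassGroup

/-- `l ≡ 1 (mod 8)` prime, `n = 2·p₁⋯p_{t₁}·q₁⋯q_{t₂}` with
`t₁ + t₂ ≥ 1` distinct primes `≡ 1 (mod 4)` coprime to `l`, `(pᵢ/l) = -1`,
`(qⱼ/l) = 1`.  If `(2/l)₄ = (-1)^((l-1)/8)` and `(qⱼ/l)₄ = (l/qⱼ)₄` for all `j`
then `r₂(H) = t₁ + 2t₂ + 2`; otherwise `r₂(H) = t₁ + 2t₂ + 1`. -/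
theorem stmt_3 (l : ℕ) (hl : l.Prime) (hl8 : l % 8 = 1)
    (ε₀ : ℝ) (hε : IsFundamentalUnit l ε₀)
    (hεnorm : ∃ u v : ℚ, ε₀ = (u : ℝ) + (v : ℝ) * Real.sqrt (l : ℝ) ∧
      (u : ℝ) ^ 2 - (v : ℝ) ^ 2 * (l : ℝ) = -1)
    (t₁ t₂ : ℕ) (ht : 1 ≤ t₁ + t₂)
    (p : Fin t₁ → ℕ) (q : Fin t₂ → ℕ)
    (hpprime : ∀ i, (p i).Prime) (hqprime : ∀ j, (q j).Prime)
    (hpinj : Function.Injective p) (hqinj : Function.Injective q)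
    (hpq : ∀ i j, p i ≠ q j)
    (hpl : ∀ i, p i ≠ l) (hql : ∀ j, q j ≠ l)
    (hp4 : ∀ i, p i % 4 = 1) (hq4 : ∀ j, q j % 4 = 1)
    (hpleg : ∀ i, legSym l (p i) = -1) (hqleg : ∀ j, legSym l (q j) = 1)
    (n : ℕ) (hn : n = 2 * ((∏ i, p i) * ∏ j, q j))
    (K : IntermediateField ℚ ℝ)
    (hK : K = IntermediateField.adjoin ℚ
      ({Real.sqrt ((n : ℝ) * ε₀ * Real.sqrt (l : ℝ))} : Set ℝ))
    [NumberField K] :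
    ((quartSym l 2 = (-1 : ℤ) ^ ((l - 1) / 8) ∧
        ∀ j, quartSym l (q j) = quartSym (q j) l) →
        twoTorsCard K = 2 ^ (t₁ + 2 * t₂ + 2)) ∧
      ((quartSym l 2 ≠ (-1 : ℤ) ^ ((l - 1) / 8) ∨
        ∃ j, quartSym l (q j) ≠ quartSym (q j) l) →
        twoTorsCard K = 2 ^ (t₁ + 2 * t₂ + 1)) := by
  obtain ⟨u', v', huv, hnorm⟩ := hεnorm
  obtain ⟨u, v, hu, huv, h4, hv⟩ := exists_nat_coords hl hl8 hε.1 hε.2.2.1 hε.2.2.2.1 huv hnorm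
  obtain ⟨k, _, _, s, ε, τ, h⟩ := exists_isBaseField hl hl8 huv h4 hv
  obtain ⟨φ, hφ⟩ := h.exists_hom (L := ℝ) (c := √(l : ℝ)) (Real.sq_sqrt (Nat.cast_nonneg l))
  have hn0 : n ≠ 0 := by
    rw [hn]
    exact mul_ne_zero two_ne_zero (mul_ne_zero
      (Finset.prod_ne_zero_iff.2 fun i _ => (hpprime i).ne_zero)
      (Finset.prod_ne_zero_iff.2 fun j _ => (hqprime j).ne_zero))
  set d := √((n : ℝ) * ε₀ * √(l : ℝ)) with hd
  have hε0 : 0 < ε₀ := one_pos.trans hε.1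
  have hd2 : d ^ 2 = φ ((n * (ε * s) : NumberField.RingOfIntegers k)) := by
    rw [hd, Real.sq_sqrt (by positivity), hu, ← hφ]
    simp [h.coe_unit, mul_assoc]
  have hdK : d ∈ K := hK ▸ IntermediateField.mem_adjoin_simple_self ℚ d
  have hmem : ∀ x, φ x ∈ K := h.apply_mem φ hn0 (hd2 ▸ pow_mem hdK 2)
  let : Algebra k K := (φ.codRestrict K hmem).toAlgebra
  refine h.card_twoTorsion hpprime hqprime hpinj hqinj hpq hpl hql hp4 hq4
    (fun i => not_isSquare_of_legSym_eq_neg_one hl (by omega) (hpprime i) (hp4 i) (hpl i) (hpleg i))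
    (fun j => isSquare_of_legSym_eq_one hl (by omega) (hqprime j) (hq4 j) (hql j) (hqleg j))
    hn (d := ⟨d, hdK⟩) (Subtype.ext hd2) fun x => ?_
  obtain ⟨a, b, hab⟩ := exists_rep_of_mem_adjoin φ hd2 (hK.le x.2)
  exact ⟨a, b, Subtype.ext hab⟩
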